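/- arXiv:2110.13722 — 4 statements merged into one kernel-verified Lean document; each statement's English description precedes it below -/
import Mathlib

section
/- Let X be a Banach space, let C ⊆ X be a closed, bounded, convex, non-empty set containing at least two points, and let M = M(C) denote the space of non-expansive mappings C → C equipped with the supremum metric. Then there exists a σ-lower porous subset N of M such that for every f ∈ M \ N the set R(f) := {x ∈ C : Lip(f,x) = 1} is a residual (comeagre) subset of C. -/
open Filter Metric Set Topology

section Porosity

variable {α : Type*} [MetricSpace α]

/-- The set of radii `s > 0` such that some open ball of radius `s` is contained in
`ball x r \ P`.  Its supremum is the quantity `γ(x,r,P)` (with `sup ∅ = -∞`, i.e. the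
set being nonempty is exactly the condition `γ(x,r,P) > 0`). -/
def porHoles (P : Set α) (x : α) (r : ℝ) : Set ℝ :=
  {s : ℝ | 0 < s ∧ ∃ y : α, Metric.ball y s ⊆ Metric.ball x r \ P}

/-- `γ(x,r,P)`, as a real number. -/
noncomputable def porGamma (P : Set α) (x : α) (r : ℝ) : ℝ :=
  sSup (porHoles P x r)

/-- `P` is `φ`-upper porous at `x`:  `γ(x,r,P) > 0` for all `r > 0` and
`limsup_{r → 0+} φ(γ(x,r,P))/r > 0` (the limsup taken in the extended reals). -/
def IsPhiUpperPorousAt (φ : ℝ → ℝ) (P : Set α) (x : α) : Prop :=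
  (∀ r > 0, (porHoles P x r).Nonempty) ∧
    0 < Filter.limsup (fun r : ℝ => ((φ (porGamma P x r) / r : ℝ) : EReal))
        (nhdsWithin 0 (Set.Ioi 0))

/-- `P` is `φ`-lower porous at `x`:  `γ(x,r,P) > 0` for all `r > 0` and
`liminf_{r → 0+} φ(γ(x,r,P))/r > 0` (the liminf taken in the extended reals). -/
def IsPhiLowerPorousAt (φ : ℝ → ℝ) (P : Set α) (x : α) : Prop :=
  (∀ r > 0, (porHoles P x r).Nonempty) ∧
    0 < Filter.liminf (fun r : ℝ => ((φ (porGamma P x r) / r : ℝ) : EReal))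
        (nhdsWithin 0 (Set.Ioi 0))

def IsPhiUpperPorous (φ : ℝ → ℝ) (P : Set α) : Prop :=
  ∀ x ∈ P, IsPhiUpperPorousAt φ P x

def IsPhiLowerPorous (φ : ℝ → ℝ) (P : Set α) : Prop :=
  ∀ x ∈ P, IsPhiLowerPorousAt φ P x

def IsSigmaPhiUpperPorous (φ : ℝ → ℝ) (P : Set α) : Prop :=
  ∃ F : ℕ → Set α, P = ⋃ n, F n ∧ ∀ n, IsPhiUpperPorous φ (F n)

def IsSigmaPhiLowerPorous (φ : ℝ → ℝ) (P : Set α) : Prop :=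
  ∃ F : ℕ → Set α, P = ⋃ n, F n ∧ ∀ n, IsPhiLowerPorous φ (F n)

/-- Ordinary lower porosity is `φ`-lower porosity with `φ = id`. -/
def IsLowerPorousAt (P : Set α) (x : α) : Prop :=
  IsPhiLowerPorousAt (fun t => t) P x

def IsLowerPorous (P : Set α) : Prop :=
  IsPhiLowerPorous (fun t => t) P

def IsSigmaLowerPorous (P : Set α) : Prop :=
  IsSigmaPhiLowerPorous (fun t => t) P

end Porosity

section Nonexpansive

variable {X : Type*} [NormedAddCommGroup X]

/-- `Lip(f,x,r)`: the Lipschitz constant of `f` witnessed at `x` at scale `r`, i.e.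
`sup {‖f(y)-f(x)‖/‖y-x‖ : y ∈ C, 0 < ‖y-x‖ ≤ r}`.  (In the subtype `↥C`, `dist y x`
is exactly `‖(y:X) - (x:X)‖`.) -/
noncomputable def LipScale {C : Set X} (f : ↥C → ↥C) (x : ↥C) (r : ℝ) : ℝ :=
  sSup ((fun y : ↥C => dist (f y) (f x) / dist y x) '' {y : ↥C | 0 < dist y x ∧ dist y x ≤ r})

/-- `Lip(f,x) = lim_{r → 0+} Lip(f,x,r)`; since `r ↦ Lip(f,x,r)` is nonnegative and
monotone, this limit is the infimum over `r > 0`. -/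
noncomputable def LipPt {C : Set X} (f : ↥C → ↥C) (x : ↥C) : ℝ :=
  sInf ((fun r : ℝ => LipScale f x r) '' Set.Ioi 0)

/-- `Lip(f)`: the (global) Lipschitz constant of `f`. -/
noncomputable def LipGlobal {C : Set X} (f : ↥C → ↥C) : ℝ :=
  sSup {L : ℝ | ∃ x y : ↥C, y ≠ x ∧ L = dist (f y) (f x) / dist y x}

/-- The space `M(C)` of non-expansive mappings `C → C`, equipped with the supremum
metric (as a subspace of the bounded continuous functions `↥C →ᵇ ↥C`; every
non-expansive self-map of a bounded set is bounded and continuous). -/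
abbrev NonexpMap (C : Set X) : Type _ :=
  {f : BoundedContinuousFunction ↥C ↥C // LipschitzWith 1 ⇑f}

end Nonexpansive

noncomputable def thetaAux (δ r t : ℝ) : ℝ :=
  if t ≤ δ * r then 0 else if t ≤ δ then (t - δ * r) / ((1 - r) * t) else 1

lemma theta_low {δ r t : ℝ} (h : t ≤ δ * r) : thetaAux δ r t = 0 := by
  simp [thetaAux, h]

lemma theta_mid {δ r t : ℝ} (hδ : 0 < δ) (hr : 0 < r) (hr1 : r < 1)
    (h : δ * r ≤ t) (h2 : t ≤ δ) : (1 - r) * (thetaAux δ r t * t) = t - δ * r := by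
  have h0 : 0 < δ * r := by positivity
  have ht : 0 < t := by linarith
  have h1 : 0 < 1 - r := by linarith
  unfold thetaAux
  split_ifs with h3
  · nlinarith
  · field_simp

lemma theta_high {δ r t : ℝ} (hδ : 0 < δ) (hr : 0 < r) (hr1 : r < 1)
    (h : δ ≤ t) : thetaAux δ r t = 1 := by
  have h1 : 0 < 1 - r := by linarith
  have h3 : ¬ t ≤ δ * r := by nlinarith
  unfold thetaAux
  rw [if_neg h3]
  split_ifs with h4
  · have : t = δ := le_antisymm h4 h
    subst this
    field_simp
  · rfl

lemma theta_nonneg {δ r t : ℝ} (hδ : 0 < δ) (hr : 0 < r) (hr1 : r < 1) :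
    0 ≤ thetaAux δ r t := by
  have h1 : 0 < 1 - r := by linarith
  have h0 : 0 < δ * r := by positivity
  unfold thetaAux
  split_ifs with h h2
  · rfl
  · have : 0 < t := by linarith
    have : 0 < t - δ * r := by linarith
    positivity
  · exact zero_le_one

lemma theta_le_one {δ r t : ℝ} (hδ : 0 < δ) (hr : 0 < r) (hr1 : r < 1) :
    thetaAux δ r t ≤ 1 := by
  have h1 : 0 < 1 - r := by linarith
  have h0 : 0 < δ * r := by positivity
  unfold thetaAux
  split_ifs with h h2
  · exact zero_le_one
  · have : 0 < t := by linarith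
    rw [div_le_one (by positivity)]
    nlinarith
  · rfl

lemma theta_mono {δ r a b : ℝ} (hδ : 0 < δ) (hr : 0 < r) (hr1 : r < 1) (hab : b ≤ a) :
    thetaAux δ r b ≤ thetaAux δ r a := by
  have h1 : 0 < 1 - r := by linarith
  have h0 : 0 < δ * r := by positivity
  rcases le_total b (δ * r) with hb | hb
  · rw [theta_low hb]; exact theta_nonneg hδ hr hr1
  rcases le_total δ a with ha | ha
  · rw [theta_high hδ hr hr1 ha]; exact theta_le_one hδ hr hr1
  have e1 := theta_mid hδ hr hr1 hb (hab.trans ha)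
  have e2 := theta_mid hδ hr hr1 (hb.trans hab) ha
  have hb0 : 0 < b := by linarith
  have ha0 : 0 < a := by linarith
  have e1' : thetaAux δ r b = (b - δ * r) / ((1 - r) * b) := by
    rw [← e1]; field_simp
  have e2' : thetaAux δ r a = (a - δ * r) / ((1 - r) * a) := by
    rw [← e2]; field_simp
  rw [e1', e2', div_le_div_iff₀ (by positivity) (by positivity)]
  have : (a - δ * r) * ((1 - r) * b) - (b - δ * r) * ((1 - r) * a)
      = (1 - r) * (δ * r) * (a - b) := by ring
  have : 0 ≤ (1 - r) * (δ * r) * (a - b) := by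
    have : 0 ≤ a - b := by linarith
    positivity
  linarith

lemma rho_inc {δ r a b : ℝ} (hδ : 0 < δ) (hr : 0 < r) (hr1 : r < 1) (hb0 : 0 ≤ b)
    (hab : b ≤ a) :
    (1 - r) * (thetaAux δ r a * a - thetaAux δ r b * b) ≤ a - b := by
  have h1 : 0 < 1 - r := by linarith
  have h0 : 0 < δ * r := by positivity
  rcases le_total a (δ * r) with ha | ha
  · rw [theta_low ha, theta_low (hab.trans ha)]; linarith
  rcases le_total a δ with ha2 | ha2
  · have e2 := theta_mid hδ hr hr1 ha ha2
    rcases le_total b (δ * r) with hb | hb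
    · rw [theta_low hb]; linarith
    · have e1 := theta_mid hδ hr hr1 hb (hab.trans ha2)
      linarith
  · rw [theta_high hδ hr hr1 ha2]
    rcases le_total b (δ * r) with hb | hb
    · rw [theta_low hb]; nlinarith
    rcases le_total b δ with hb2 | hb2
    · have e1 := theta_mid hδ hr hr1 hb hb2
      nlinarith
    · rw [theta_high hδ hr hr1 hb2]; nlinarith

lemma rho_disp {δ r t : ℝ} (hδ : 0 < δ) (hr : 0 < r) (hr1 : r < 1) :
    t - thetaAux δ r t * t ≤ δ * r := by
  have h1 : 0 < 1 - r := by linarith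
  have h0 : 0 < δ * r := by positivity
  rcases le_total t (δ * r) with ha | ha
  · rw [theta_low ha]; linarith
  rcases le_total t δ with ha2 | ha2
  · have e2 := theta_mid hδ hr hr1 ha ha2
    have : 0 ≤ thetaAux δ r t * t :=
      mul_nonneg (theta_nonneg hδ hr hr1) (by linarith)
    nlinarith
  · rw [theta_high hδ hr hr1 ha2]; linarith

section Bump
variable {X : Type*} [NormedAddCommGroup X] [NormedSpace ℝ X]

lemma radial_lip {δ r : ℝ} (hδ : 0 < δ) (hr : 0 < r) (hr1 : r < 1) (v w : X) :
    (1 - r) * ‖thetaAux δ r ‖v‖ • v - thetaAux δ r ‖w‖ • w‖ ≤ ‖v - w‖ := by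
  wlog h : ‖w‖ ≤ ‖v‖ generalizing v w
  · have := this w v (le_of_not_ge h)
    rwa [norm_sub_rev, norm_sub_rev v w]
  have h1 : 0 < 1 - r := by linarith
  set A := thetaAux δ r ‖v‖ with hA
  set B := thetaAux δ r ‖w‖ with hB
  have hAB : B ≤ A := theta_mono hδ hr hr1 h
  have hA0 : 0 ≤ A := theta_nonneg hδ hr hr1
  have hA1 : A ≤ 1 := theta_le_one hδ hr hr1
  have key : ‖A • v - B • w‖ ≤ A * ‖v - w‖ + (A - B) * ‖w‖ := by
    have : A • v - B • w = A • (v - w) + (A - B) • w := by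
      rw [smul_sub, sub_smul]; abel
    rw [this]
    refine (norm_add_le _ _).trans ?_
    rw [norm_smul, norm_smul, Real.norm_of_nonneg hA0, Real.norm_of_nonneg (by linarith)]
  have hi := rho_inc hδ hr hr1 (norm_nonneg w) h
  rw [← hA, ← hB] at hi
  have hd : ‖v‖ - ‖w‖ ≤ ‖v - w‖ := norm_sub_norm_le v w
  have h2 : 0 ≤ 1 - (1 - r) * A := by nlinarith
  have h3 := mul_le_mul_of_nonneg_left hd h2
  have h4 := mul_le_mul_of_nonneg_left key h1.le
  nlinarith

variable {C : Set X}

noncomputable def phiAux (hC : Convex ℝ C) {δ r : ℝ} (hδ : 0 < δ) (hr : 0 < r) (hr1 : r < 1)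
    (p x : C) : C :=
  ⟨(p : X) + thetaAux δ r ‖(x : X) - p‖ • ((x : X) - p),
    hC.add_smul_sub_mem p.2 x.2 ⟨theta_nonneg hδ hr hr1, theta_le_one hδ hr hr1⟩⟩

noncomputable def bumpAux (hC : Convex ℝ C) {δ r : ℝ} (hδ : 0 < δ) (hr : 0 < r) (hr1 : r < 1)
    (F : C → X) (e : C → X) (p x : C) : X :=
  F (phiAux hC hδ hr hr1 p x) + max 0 (δ * r - dist x p) • e p

variable (hC : Convex ℝ C) {δ r : ℝ} (hδ : 0 < δ) (hr : 0 < r) (hr1 : r < 1)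

lemma dist_coe_norm (x y : C) : dist x y = ‖(x : X) - y‖ := by
  rw [Subtype.dist_eq, dist_eq_norm]

lemma phi_lip (p x y : C) :
    (1 - r) * dist (phiAux hC hδ hr hr1 p x) (phiAux hC hδ hr hr1 p y) ≤ dist x y := by
  have := radial_lip hδ hr hr1 ((x : X) - p) ((y : X) - p)
  rw [dist_coe_norm, dist_coe_norm]
  simp only [phiAux]
  rw [add_sub_add_left_eq_sub]
  simpa using this

lemma phi_near (p x : C) (h : dist x p ≤ δ * r) : phiAux hC hδ hr hr1 p x = p := by
  rw [dist_coe_norm] at h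
  apply Subtype.ext
  simp [phiAux, theta_low h]

lemma phi_far (p x : C) (h : δ ≤ dist x p) : phiAux hC hδ hr hr1 p x = x := by
  rw [dist_coe_norm] at h
  apply Subtype.ext
  simp [phiAux, theta_high hδ hr hr1 h]

lemma phi_disp (p x : C) : dist (phiAux hC hδ hr hr1 p x) x ≤ δ * r := by
  have h := rho_disp (t := ‖(x : X) - p‖) hδ hr hr1
  rw [dist_comm, dist_coe_norm]
  have : (x : X) - (phiAux hC hδ hr hr1 p x : C)
      = (1 - thetaAux δ r ‖(x : X) - p‖) • ((x : X) - p) := by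
    simp only [phiAux, sub_smul, one_smul]; abel
  rw [this, norm_smul, Real.norm_of_nonneg (by linarith [theta_le_one (t := ‖(x : X) - p‖) hδ hr hr1])]
  linarith

lemma phi_rad (p x : C) (h : δ * r ≤ dist x p) :
    (1 - r) * dist p (phiAux hC hδ hr hr1 p x) ≤ dist x p - δ * r := by
  have h0 : 0 < δ * r := by positivity
  have hi := rho_inc hδ hr hr1 h0.le h
  rw [theta_low le_rfl] at hi
  have : dist p (phiAux hC hδ hr hr1 p x) = thetaAux δ r (dist x p) * dist x p := by
    rw [dist_comm, dist_coe_norm, dist_coe_norm]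
    simp only [phiAux, add_sub_cancel_left]
    rw [norm_smul, Real.norm_of_nonneg (theta_nonneg hδ hr hr1)]
  rw [this]; linarith

variable (F : C → X) (hF : ∀ x y, dist (F x) (F y) ≤ (1 - r) * dist x y)
  (e : C → X) (he : ∀ p, ‖e p‖ = 1)

lemma bump_far (p x : C) (h : δ ≤ dist x p) : bumpAux hC hδ hr hr1 F e p x = F x := by
  have : δ * r ≤ dist x p := by nlinarith
  simp [bumpAux, phi_far hC hδ hr hr1 p x h, max_eq_left (sub_nonpos.2 this)]

include hF he in
lemma bump_disp (p x : C) : dist (bumpAux hC hδ hr hr1 F e p x) (F x) ≤ 2 * (δ * r) := by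
  have h0 : 0 < δ * r := by positivity
  have h1 := hF (phiAux hC hδ hr hr1 p x) x
  have h2 := phi_disp hC hδ hr hr1 p x
  have h3 : ‖max 0 (δ * r - dist x p) • e p‖ ≤ δ * r := by
    rw [norm_smul, he, mul_one, Real.norm_of_nonneg (le_max_left _ _)]
    exact max_le h0.le (by linarith [dist_nonneg (x := x) (y := p)])
  have h4 : dist (bumpAux hC hδ hr hr1 F e p x) (F x) ≤
      dist (F (phiAux hC hδ hr hr1 p x)) (F x) + ‖max 0 (δ * r - dist x p) • e p‖ := by
    rw [dist_eq_norm, dist_eq_norm, bumpAux, add_sub_right_comm]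
    exact norm_add_le _ _
  nlinarith [dist_nonneg (x := phiAux hC hδ hr hr1 p x) (y := x)]

include hF he in
lemma bump_lip (p x y : C) :
    dist (bumpAux hC hδ hr hr1 F e p x) (bumpAux hC hδ hr hr1 F e p y) ≤ dist x y := by
  wlog hxy : dist x p ≤ dist y p generalizing x y
  · have := this y x (le_of_not_ge hxy)
    rwa [dist_comm, dist_comm x y]
  have h0 : 0 < δ * r := by positivity
  have h1 := hF (phiAux hC hδ hr hr1 p x) (phiAux hC hδ hr hr1 p y)
  have tri : dist y p ≤ dist x y + dist x p := by
    rw [dist_comm x y]; exact dist_triangle _ _ _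
  have h4 : dist (bumpAux hC hδ hr hr1 F e p x) (bumpAux hC hδ hr hr1 F e p y) ≤
      dist (F (phiAux hC hδ hr hr1 p x)) (F (phiAux hC hδ hr hr1 p y))
        + |max 0 (δ * r - dist x p) - max 0 (δ * r - dist y p)| := by
    rw [dist_eq_norm, dist_eq_norm, bumpAux, bumpAux, add_sub_add_comm, ← sub_smul]
    refine (norm_add_le _ _).trans ?_
    rw [norm_smul, he, mul_one, Real.norm_eq_abs]
  refine h4.trans ?_
  rcases le_total (dist y p) (δ * r) with hy | hy
  · have hx := hxy.trans hy
    rw [phi_near hC hδ hr hr1 p x hx, phi_near hC hδ hr hr1 p y hy, dist_self, zero_add,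
      max_eq_right (by linarith), max_eq_right (by linarith), abs_of_nonneg (by linarith)]
    linarith
  · rcases le_total (dist x p) (δ * r) with hx | hx
    · rw [phi_near hC hδ hr hr1 p x hx] at h1 ⊢
      have := phi_rad hC hδ hr hr1 p y hy
      rw [max_eq_right (by linarith), max_eq_left (by linarith), abs_of_nonneg (by linarith)]
      linarith
    · rw [max_eq_left (by linarith), max_eq_left (by linarith)]
      have := phi_lip hC hδ hr hr1 p x y
      simp only [sub_self, abs_zero]
      linarith

lemma bump_mem (hFC : ∀ x, F x ∈ C)
    (heC : ∀ p, ∀ τ : ℝ, 0 ≤ τ → τ ≤ δ * r → F p + τ • e p ∈ C) (p x : C) :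
    bumpAux hC hδ hr hr1 F e p x ∈ C := by
  have h0 : 0 < δ * r := by positivity
  rcases le_total (dist x p) (δ * r) with hx | hx
  · rw [bumpAux, phi_near hC hδ hr hr1 p x hx]
    exact heC p _ (le_max_left _ _) (max_le h0.le (by linarith [dist_nonneg (x := x) (y := p)]))
  · rw [bumpAux, max_eq_left (by linarith), zero_smul, add_zero]
    exact hFC _

open Classical in
noncomputable def multiAux (hC : Convex ℝ C) {δ r : ℝ} (hδ : 0 < δ) (hr : 0 < r) (hr1 : r < 1)
    (F : C → X) (e : C → X) (Γ : Set C) (x : C) : X :=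
  if h : ∃ p ∈ Γ, dist x p < δ then bumpAux hC hδ hr hr1 F e h.choose x else F x

variable (Γ : Set C) {σ : ℝ} (hΓ : ∀ p ∈ Γ, ∀ q ∈ Γ, p ≠ q → σ ≤ dist p q) (hσ : 6 * δ ≤ σ)

include hΓ hσ in
lemma multi_eq (p x : C) (hp : p ∈ Γ) (hx : dist x p < δ) :
    multiAux hC hδ hr hr1 F e Γ x = bumpAux hC hδ hr hr1 F e p x := by
  have h : ∃ p ∈ Γ, dist x p < δ := ⟨p, hp, hx⟩
  rw [multiAux, dif_pos h]
  congr 1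
  by_contra hne
  have h1 := hΓ _ h.choose_spec.1 _ hp hne
  have h2 := h.choose_spec.2
  have h3 := dist_triangle_left h.choose p x
  linarith

lemma multi_eq_none (x : C) (h : ¬ ∃ p ∈ Γ, dist x p < δ) :
    multiAux hC hδ hr hr1 F e Γ x = F x := by
  rw [multiAux, dif_neg h]

include hF he in
lemma multi_disp (x : C) :
    dist (multiAux hC hδ hr hr1 F e Γ x) (F x) ≤ 2 * (δ * r) := by
  rw [multiAux]
  split_ifs with h
  · exact bump_disp hC hδ hr hr1 F hF e he _ x
  · rw [dist_self]; positivity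

lemma multi_mem (hFC : ∀ x, F x ∈ C)
    (heC : ∀ p, ∀ τ : ℝ, 0 ≤ τ → τ ≤ δ * r → F p + τ • e p ∈ C) (x : C) :
    multiAux hC hδ hr hr1 F e Γ x ∈ C := by
  rw [multiAux]
  split_ifs with h
  · exact bump_mem hC hδ hr hr1 F e hFC heC _ x
  · exact hFC x

include hF he hΓ hσ in
lemma multi_lip (x y : C) :
    dist (multiAux hC hδ hr hr1 F e Γ x) (multiAux hC hδ hr hr1 F e Γ y) ≤ dist x y := by
  by_cases hx : ∃ p ∈ Γ, dist x p < δ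
  · obtain ⟨p, hp, hxp⟩ := hx
    by_cases hy : dist y p < δ
    · rw [multi_eq hC hδ hr hr1 F e Γ hΓ hσ p x hp hxp, multi_eq hC hδ hr hr1 F e Γ hΓ hσ p y hp hy]
      exact bump_lip hC hδ hr hr1 F hF e he p x y
    by_cases hy' : ∃ q ∈ Γ, dist y q < δ
    · obtain ⟨q, hq, hyq⟩ := hy'
      have hpq : p ≠ q := by
        rintro rfl; exact hy hyq
      have h1 := hΓ p hp q hq hpq
      have h2 : dist p q ≤ dist x p + dist x y + dist y q := by
        have := dist_triangle4 p x y q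
        rwa [dist_comm p x] at this
      have h3 := dist_triangle4 (multiAux hC hδ hr hr1 F e Γ x) (F x) (F y)
        (multiAux hC hδ hr hr1 F e Γ y)
      have h4 := multi_disp hC hδ hr hr1 F hF e he Γ x
      have h5 := multi_disp hC hδ hr hr1 F hF e he Γ y
      rw [dist_comm] at h5
      have h6 := hF x y
      have h7 : 4 * δ ≤ dist x y := by linarith
      nlinarith
    · rw [multi_eq hC hδ hr hr1 F e Γ hΓ hσ p x hp hxp, multi_eq_none hC hδ hr hr1 F e Γ y hy',
        ← bump_far hC hδ hr hr1 F e p y (not_lt.1 hy)]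
      exact bump_lip hC hδ hr hr1 F hF e he p x y
  · by_cases hy' : ∃ q ∈ Γ, dist y q < δ
    · obtain ⟨p, hp, hyp⟩ := hy'
      have hxp : δ ≤ dist x p := by
        by_contra hcon
        exact hx ⟨p, hp, not_le.1 hcon⟩
      rw [multi_eq hC hδ hr hr1 F e Γ hΓ hσ p y hp hyp, multi_eq_none hC hδ hr hr1 F e Γ x hx,
        ← bump_far hC hδ hr hr1 F e p x hxp]
      exact bump_lip hC hδ hr hr1 F hF e he p x y
    · rw [multi_eq_none hC hδ hr hr1 F e Γ x hx, multi_eq_none hC hδ hr hr1 F e Γ y hy']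
      have := hF x y
      nlinarith [dist_nonneg (x := x) (y := y)]

end Bump

lemma exists_maxsep {α : Type*} [MetricSpace α] (σ : ℝ) (hσ : 0 < σ) :
    ∃ Γ : Set α, (∀ p ∈ Γ, ∀ q ∈ Γ, p ≠ q → σ ≤ dist p q) ∧ ∀ x, ∃ p ∈ Γ, dist x p < σ := by
  obtain ⟨Γ, hΓ⟩ := zorn_subset {Γ : Set α | ∀ p ∈ Γ, ∀ q ∈ Γ, p ≠ q → σ ≤ dist p q} (by
    intro c hc hchain
    refine ⟨⋃₀ c, ?_, fun s hs => subset_sUnion_of_mem hs⟩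
    rintro p ⟨s, hs, hps⟩ q ⟨t, ht, hqt⟩ hpq
    rcases hchain.total hs ht with h | h
    · exact hc ht p (h hps) q hqt hpq
    · exact hc hs p hps q (h hqt) hpq)
  refine ⟨Γ, hΓ.prop, fun x => ?_⟩
  by_contra! hcon
  have hmem : insert x Γ ∈ {Γ : Set α | ∀ p ∈ Γ, ∀ q ∈ Γ, p ≠ q → σ ≤ dist p q} := by
    rintro p (rfl | hp) q (rfl | hq) hpq
    · exact absurd rfl hpq
    · exact hcon q hq
    · rw [dist_comm]; exact hcon p hp
    · exact hΓ.prop p hp q hq hpq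
  have := hΓ.le_of_ge hmem (subset_insert x Γ) (mem_insert x Γ)
  have := hcon x this
  rw [dist_self] at this
  linarith

section Main
variable {X : Type*} [NormedAddCommGroup X] [NormedSpace ℝ X] {C : Set X}

/-- Maps which are `a`-Lipschitz on some ball of radius `ε`. -/
def badSet (C : Set X) (a ε : ℝ) : Set (NonexpMap C) :=
  {f | ∃ x : C, ∀ u v : C, dist u x < ε → dist v x < ε → dist (f.1 u) (f.1 v) ≤ a * dist u v}

lemma step_dir (hC : Convex ℝ C) {ℓ : ℝ} (hℓ : 0 < ℓ) (hfar : ∀ z ∈ C, ∃ w ∈ C, ℓ ≤ dist w z)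
    (z : X) (hz : z ∈ C) :
    ∃ e : X, ‖e‖ = 1 ∧ ∀ τ : ℝ, 0 ≤ τ → τ ≤ ℓ → z + τ • e ∈ C := by
  obtain ⟨w, hw, hwz⟩ := hfar z hz
  rw [dist_eq_norm] at hwz
  have hpos : 0 < ‖w - z‖ := by linarith
  refine ⟨‖w - z‖⁻¹ • (w - z), ?_, fun τ h0 h1 => ?_⟩
  · rw [norm_smul, norm_inv, norm_norm, inv_mul_cancel₀ hpos.ne']
  · rw [smul_smul]
    refine hC.add_smul_sub_mem hz hw ⟨by positivity, ?_⟩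
    rw [← div_eq_mul_inv, div_le_one hpos]; linarith

lemma exists_hole (hC : Convex ℝ C) {ℓ D : ℝ} (hℓ : 0 < ℓ)
    (hfar : ∀ z ∈ C, ∃ w ∈ C, ℓ ≤ dist w z) (hD : ∀ x ∈ C, ∀ y ∈ C, dist x y ≤ D)
    {a ε δ r : ℝ} (ha : a < 1) (hδ : 0 < δ) (hδε : 12 * δ ≤ ε) (hδℓ : δ ≤ ℓ)
    (hr : 0 < r) (hr1 : r < 1) (z0 : C) (f : NonexpMap C) :
    ∃ g : NonexpMap C, dist g f ≤ r * (D + 2 * δ) ∧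
      ∀ h : NonexpMap C, dist h g < δ * r * (1 - a) / 2 → h ∉ badSet C a ε := by
  have h0 : 0 < δ * r := by positivity
  have h1r : 0 < 1 - r := by linarith
  obtain ⟨Γ, hΓ, hcov⟩ := exists_maxsep (α := C) (6 * δ) (by positivity)
  set F : C → X := fun x => (1 - r) • (f.1 x : X) + r • (z0 : X) with hFdef
  have hFC : ∀ x, F x ∈ C := fun x =>
    hC (f.1 x).2 z0.2 h1r.le hr.le (by ring)
  have hf : ∀ x y, dist (f.1 x) (f.1 y) ≤ dist x y := fun x y => by
    simpa using f.2.dist_le_mul x y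
  have hF : ∀ x y, dist (F x) (F y) ≤ (1 - r) * dist x y := by
    intro x y
    have := hf x y
    simp only [hFdef]
    rw [dist_add_right, dist_smul₀, Real.norm_of_nonneg h1r.le]
    exact mul_le_mul_of_nonneg_left this h1r.le
  have hFf : ∀ x, dist (F x) (f.1 x) ≤ r * D := by
    intro x
    have h2 : F x - (f.1 x : X) = r • ((z0 : X) - f.1 x) := by
      simp only [hFdef, sub_smul, smul_sub, one_smul]; abel
    rw [dist_eq_norm, h2, norm_smul, Real.norm_of_nonneg hr.le, ← dist_eq_norm]
    exact mul_le_mul_of_nonneg_left (hD _ z0.2 _ (f.1 x).2) hr.le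
  choose e he heC using fun p : C => step_dir hC hℓ hfar (F p) (hFC p)
  have heC' : ∀ p, ∀ τ : ℝ, 0 ≤ τ → τ ≤ δ * r → F p + τ • e p ∈ C := fun p τ h1 h2 =>
    heC p τ h1 (by nlinarith)
  set G : C → C := fun x => ⟨multiAux hC hδ hr hr1 F e Γ x,
    multi_mem hC hδ hr hr1 F e Γ hFC heC' x⟩ with hG
  have hGl : LipschitzWith 1 G := LipschitzWith.of_dist_le_mul fun x y => by
    have := multi_lip hC hδ hr hr1 F hF e he Γ hΓ le_rfl x y
    simpa [hG, Subtype.dist_eq] using this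
  have hDb : ∀ x y : C, dist x y ≤ D := fun x y => hD x x.2 y y.2
  have hD0 : 0 ≤ D := dist_nonneg.trans (hDb z0 z0)
  let g : NonexpMap C := ⟨⟨⟨G, hGl.continuous⟩, ⟨D, fun x y => hDb _ _⟩⟩, hGl⟩
  have hgv : ∀ x, ((g.1 x : C) : X) = multiAux hC hδ hr hr1 F e Γ x := fun x => rfl
  refine ⟨g, ?_, ?_⟩
  · rw [Subtype.dist_eq, BoundedContinuousFunction.dist_le (by positivity)]
    intro x
    rw [Subtype.dist_eq, hgv]
    have h1 := multi_disp hC hδ hr hr1 F hF e he Γ x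
    have h2 := hFf x
    have h3 := dist_triangle (multiAux hC hδ hr hr1 F e Γ x) (F x) (f.1 x)
    linarith
  · rintro h hhg ⟨x, hx⟩
    obtain ⟨p, hp, hxp⟩ := hcov x
    obtain ⟨e', he', heC''⟩ := step_dir hC hℓ hfar p p.2
    let y : C := ⟨(p : X) + (δ * r) • e', heC'' _ h0.le (by nlinarith)⟩
    have hyp : dist y p = δ * r := by
      rw [dist_coe_norm]
      simp only [y, add_sub_cancel_left]
      rw [norm_smul, he', mul_one, Real.norm_of_nonneg h0.le]
    have hyδ : dist y p < δ := by rw [hyp]; nlinarith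
    have h1 := hx p y (by rw [dist_comm]; linarith)
      (by have := dist_triangle_right y x p; linarith)
    have gp : ((g.1 p : C) : X) = F p + (δ * r) • e p := by
      rw [hgv, multi_eq hC hδ hr hr1 F e Γ hΓ le_rfl p p hp (by simpa using hδ), bumpAux,
        phi_near hC hδ hr hr1 p p (by simpa using h0.le), dist_self, sub_zero, max_eq_right h0.le]
    have gy : ((g.1 y : C) : X) = F p := by
      rw [hgv, multi_eq hC hδ hr hr1 F e Γ hΓ le_rfl p y hp hyδ, bumpAux,
        phi_near hC hδ hr hr1 p y hyp.le, hyp, sub_self, max_self, zero_smul, add_zero]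
    have gd : dist (g.1 p) (g.1 y) = δ * r := by
      rw [dist_coe_norm, gp, gy, add_sub_cancel_left, norm_smul, he, mul_one,
        Real.norm_of_nonneg h0.le]
    have hd : ∀ u, dist (h.1 u) (g.1 u) ≤ dist h g := fun u =>
      BoundedContinuousFunction.dist_coe_le_dist u
    have h5 := hd p
    have h6 := hd y
    have h7 := dist_triangle4 (g.1 p) (h.1 p) (h.1 y) (g.1 y)
    rw [dist_comm (g.1 p) (h.1 p)] at h7
    rw [dist_comm p y, hyp] at h1
    linarith


lemma bad_porous (hC : Convex ℝ C) {ℓ D : ℝ} (hℓ : 0 < ℓ)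
    (hfar : ∀ z ∈ C, ∃ w ∈ C, ℓ ≤ dist w z) (hD : ∀ x ∈ C, ∀ y ∈ C, dist x y ≤ D)
    {a ε : ℝ} (ha : a < 1) (hε : 0 < ε) (z0 : C) :
    IsLowerPorous (badSet C a ε) := by
  intro f _
  have hDb : ∀ x y : C, dist x y ≤ D := fun x y => hD x x.2 y y.2
  have hD0 : 0 ≤ D := dist_nonneg.trans (hDb z0 z0)
  obtain ⟨δ, hδ, hδε, hδℓ⟩ : ∃ δ : ℝ, 0 < δ ∧ 12 * δ ≤ ε ∧ δ ≤ ℓ :=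
    ⟨min (ε / 12) ℓ, by positivity, by linarith [min_le_left (ε / 12) ℓ], min_le_right _ _⟩
  have h1a : 0 < 1 - a := by linarith
  set K : ℝ := D + 2 * δ + δ * (1 - a) / 2 with hK
  have hK0 : 0 < K := by positivity
  set κ : ℝ := δ * (1 - a) / 2 / K with hκ
  have hκ0 : 0 < κ := by positivity
  have hole : ∀ R : ℝ, 0 < R → R < K → κ * R ∈ porHoles (badSet C a ε) f R := by
    intro R hR hRK
    have hr : 0 < R / K := by positivity
    have hr1 : R / K < 1 := (div_lt_one hK0).2 hRK
    obtain ⟨g, hg, hgb⟩ := exists_hole hC hℓ hfar hD ha hδ hδε hδℓ hr hr1 z0 f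
    have e1 : δ * (R / K) * (1 - a) / 2 = κ * R := by rw [hκ]; ring
    have e2 : R / K * (D + 2 * δ) + κ * R = R := by
      have : R / K * (D + 2 * δ) + κ * R = R / K * K := by rw [← e1, hK]; ring
      rw [this, div_mul_cancel₀ _ hK0.ne']
    rw [e1] at hgb
    refine ⟨by positivity, g, fun h hh => ⟨?_, hgb h hh⟩⟩
    rw [mem_ball] at hh ⊢
    have := dist_triangle h g f
    linarith
  refine ⟨fun R hR => ?_, ?_⟩
  · have hm : 0 < min R (K / 2) := by positivity
    obtain ⟨h0, y, hy⟩ := hole (min R (K / 2)) hm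
      (lt_of_le_of_lt (min_le_right _ _) (by linarith))
    exact ⟨_, h0, y, hy.trans (diff_subset_diff_left (ball_subset_ball (min_le_left _ _)))⟩
  · refine lt_of_lt_of_le (b := ((κ : ℝ) : EReal)) (by exact_mod_cast hκ0) ?_
    refine le_liminf_of_le (by isBoundedDefault) ?_
    have hm : 0 < min K (ℓ / 2) := by positivity
    filter_upwards [Ioo_mem_nhdsGT hm] with R hR
    have hRK : R < K := hR.2.trans_le (min_le_left _ _)
    have hRℓ : R < ℓ / 2 := hR.2.trans_le (min_le_right _ _)
    rw [EReal.coe_le_coe_iff, le_div_iff₀ hR.1]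
    refine le_csSup ⟨D + 1, ?_⟩ (hole R hR.1 hRK)
    rintro s ⟨hs, y, hy⟩
    by_contra! hcon
    have hall : ∀ h : NonexpMap C, dist h f < R := by
      intro h
      have : h ∈ ball y s := by
        rw [mem_ball, Subtype.dist_eq]
        refine lt_of_le_of_lt ((BoundedContinuousFunction.dist_le hD0).2 fun x => hDb _ _) ?_
        linarith
      exact (hy this).1
    obtain ⟨w, hw, hwz⟩ := hfar z0 z0.2
    let c : C → NonexpMap C := fun z =>
      ⟨BoundedContinuousFunction.const C z, by
        simpa using (LipschitzWith.const z).weaken zero_le_one⟩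
    have h1 := hall (c z0)
    have h2 := hall (c ⟨w, hw⟩)
    have h3 : dist w (z0 : X) ≤ dist (c ⟨w, hw⟩) (c z0) :=
      BoundedContinuousFunction.dist_coe_le_dist (f := (c ⟨w, hw⟩).1) (g := (c z0).1) z0
    have h4 := dist_triangle_right (c ⟨w, hw⟩) (c z0) f
    linarith

lemma good_residual (f : NonexpMap C)
    (hf : ∀ n : ℕ, f ∉ badSet C (1 - 1 / ((n : ℝ) + 1)) (1 / ((n : ℝ) + 1))) :
    {x : C | LipPt (⇑(f.1)) x = 1} ∈ residual C := by
  have hfl : ∀ x y, dist (f.1 x) (f.1 y) ≤ dist x y := fun x y => by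
    simpa using f.2.dist_le_mul x y
  let O : ℕ → Set C := fun n => ⋃ y : C, {x : C | 0 < dist y x ∧ dist y x < 2 / ((n : ℝ) + 1) ∧
    (1 - 1 / ((n : ℝ) + 1)) * dist y x < dist (f.1 y) (f.1 x)}
  have hfc : Continuous fun x => f.1 x := f.1.continuous
  have hO : ∀ n, IsOpen (O n) := by
    intro n
    refine isOpen_iUnion fun y => ?_
    refine IsOpen.and (isOpen_lt (by fun_prop) (by fun_prop)) (IsOpen.and
      (isOpen_lt (by fun_prop) (by fun_prop)) (isOpen_lt (by fun_prop) (by fun_prop)))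
  have hOd : ∀ n, Dense (O n) := by
    intro n
    rw [Metric.dense_iff]
    intro x η hη
    obtain ⟨m0, hm0⟩ := exists_nat_one_div_lt hη
    set m := max m0 n
    have hmn : 1 / ((m : ℝ) + 1) ≤ 1 / ((n : ℝ) + 1) := by
      apply one_div_le_one_div_of_le (by positivity)
      have : (n : ℝ) ≤ m := by exact_mod_cast le_max_right m0 n
      linarith
    have hmm : 1 / ((m : ℝ) + 1) ≤ 1 / ((m0 : ℝ) + 1) := by
      apply one_div_le_one_div_of_le (by positivity)
      have : (m0 : ℝ) ≤ m := by exact_mod_cast le_max_left m0 n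
      linarith
    have := hf m
    simp only [badSet, mem_setOf_eq, not_exists] at this
    have := this x
    push Not at this
    obtain ⟨u, v, hu, hv, huv⟩ := this
    refine ⟨v, by rw [mem_ball]; linarith, mem_iUnion.2 ⟨u, ?_, ?_, ?_⟩⟩
    · rw [dist_pos]
      rintro rfl
      simp at huv
    · have := dist_triangle_right u v x
      have e : 2 / ((n : ℝ) + 1) = 1 / ((n : ℝ) + 1) + 1 / ((n : ℝ) + 1) := by ring
      linarith
    · refine lt_of_le_of_lt ?_ huv
      exact mul_le_mul_of_nonneg_right (by linarith) dist_nonneg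
  have hres : (⋂ n, O n) ∈ residual C :=
    countable_iInter_mem.2 fun n => residual_of_dense_open (hO n) (hOd n)
  refine mem_of_superset hres fun x hx => ?_
  have hsc : ∀ r : ℝ, 0 < r → LipScale (⇑(f.1)) x r = 1 := by
    intro r hr
    have hub : ∀ q ∈ ((fun y : C => dist (f.1 y) (f.1 x) / dist y x) ''
        {y : C | 0 < dist y x ∧ dist y x ≤ r}), q ≤ 1 := by
      rintro _ ⟨y, hy, rfl⟩
      exact div_le_one_of_le₀ (hfl y x) dist_nonneg
    apply le_antisymm
    · exact Real.sSup_le hub zero_le_one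
    · refine le_of_forall_pos_le_add fun η hη => ?_
      obtain ⟨n, hn⟩ := exists_nat_one_div_lt (lt_min hη (half_pos hr))
      obtain ⟨y, h1, h2, h3⟩ := mem_iUnion.1 (mem_iInter.1 hx n)
      have e : 2 / ((n : ℝ) + 1) = 1 / ((n : ℝ) + 1) + 1 / ((n : ℝ) + 1) := by ring
      have hn1 := hn.trans_le (min_le_left _ _)
      have hn2 := hn.trans_le (min_le_right _ _)
      have h4 : dist (f.1 y) (f.1 x) / dist y x ≤ LipScale (⇑(f.1)) x r :=
        le_csSup ⟨1, hub⟩ ⟨y, ⟨h1, by linarith⟩, rfl⟩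
      rw [← lt_div_iff₀ h1] at h3
      linarith
  show LipPt (⇑(f.1)) x = 1
  have : (fun r : ℝ => LipScale (⇑(f.1)) x r) '' Set.Ioi 0 = {1} := by
    ext q
    constructor
    · rintro ⟨r, hr, rfl⟩
      exact hsc r hr
    · rintro rfl
      exact ⟨1, mem_Ioi.2 one_pos, hsc 1 one_pos⟩
  rw [LipPt, this, csInf_singleton]

end Main

/-- For a closed, bounded, convex, nontrivial subset `C` of a Banach
space `X`, there is a σ-lower porous subset `N` of the space `M(C)` of non-expansive
mappings `C → C` (with the supremum metric) such that for every `f ∈ M(C) \ N` the set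
`R(f) = {x ∈ C : Lip(f,x) = 1}` is residual (comeagre) in `C`. -/
theorem stmt_0 {X : Type*} [NormedAddCommGroup X] [NormedSpace ℝ X] [CompleteSpace X]
    (C : Set X) (hC_closed : IsClosed C) (hC_bdd : Bornology.IsBounded C)
    (hC_conv : Convex ℝ C) (hC_nontriv : C.Nontrivial) :
    ∃ N : Set (NonexpMap C), IsSigmaLowerPorous N ∧
      ∀ f : NonexpMap C, f ∉ N →
        {x : ↥C | LipPt (⇑(f.1)) x = 1} ∈ residual ↥C := by
  obtain ⟨a, ha, b, hb, hab⟩ := hC_nontriv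
  have hd : 0 < dist a b := dist_pos.2 hab
  have hfar : ∀ z ∈ C, ∃ w ∈ C, dist a b / 2 ≤ dist w z := by
    intro z _
    by_contra! hcon
    have h1 := hcon a ha
    have h2 := hcon b hb
    have h3 := dist_triangle_right a b z
    linarith
  obtain ⟨D, hD⟩ := Metric.isBounded_iff.1 hC_bdd
  refine ⟨⋃ n : ℕ, badSet C (1 - 1 / ((n : ℝ) + 1)) (1 / ((n : ℝ) + 1)),
    ⟨_, rfl, fun n => ?_⟩, fun f hf => ?_⟩
  · have hp : 0 < 1 / ((n : ℝ) + 1) := by positivity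
    exact bad_porous hC_conv (half_pos hd) hfar (fun x hx y hy => hD hx hy)
      (by linarith) hp ⟨a, ha⟩
  · refine good_residual f fun n hn => hf (mem_iUnion.2 ⟨n, hn⟩)
end

section
/- Let X be a Banach space, let C ⊆ X be a closed, bounded, convex, non-empty set containing at least two points, and let M = M(C) denote the space of non-expansive mappings C → C equipped with the supremum metric. Let K > 1 and let φ, ξ : (0,1/K) → (0,∞) be strictly increasing concave functions satisfying φ(t)·ξ(t) ≥ t/K for all t ∈ (0,1/K) and lim_{t→0} ξ(t) = 0. Then there exists a σ-ξ-lower porous subset N of M such that for every f ∈ M \ N the set C \ R(f), where R(f) := {x ∈ C : Lip(f,x) = 1}, is a σ-φ-upper porous subset of C. -/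
open Filter Metric Set Topology

section Helpers

theorem aux_gamma_bounds {α : Type*} [MetricSpace α] (P : Set α) (x : α) (ρ E σ : ℝ)
    (hz : ∃ z : α, ρ ≤ dist z x ∧ dist z x ≤ E * ρ)
    (hσ : σ ∈ porHoles P x ρ) :
    σ ≤ porGamma P x ρ ∧ porGamma P x ρ ≤ (E + 1) * ρ := by
  obtain ⟨z, hz1, hz2⟩ := hz
  have hb : ∀ s ∈ porHoles P x ρ, s ≤ (E + 1) * ρ := by
    rintro s ⟨hs, y, hy⟩
    have h1 : y ∈ ball x ρ := (hy (mem_ball_self hs)).1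
    have h2 : z ∉ ball y s := by
      intro h
      have := (hy h).1
      rw [mem_ball] at this
      linarith
    rw [mem_ball] at h1 h2
    have := dist_triangle z x y
    rw [dist_comm x y] at this
    linarith
  exact ⟨le_csSup ⟨_, hb⟩ hσ, csSup_le ⟨σ, hσ⟩ hb⟩

theorem aux_holes_mono {α : Type*} [MetricSpace α] (P : Set α) (x : α) {r r' : ℝ} (h : r ≤ r')
    (hn : (porHoles P x r).Nonempty) : (porHoles P x r').Nonempty := by
  obtain ⟨s, hs, y, hy⟩ := hn
  exact ⟨s, hs, y, hy.trans (sdiff_subset_sdiff_left (ball_subset_ball h))⟩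

theorem aux_value {α : Type*} [MetricSpace α] (P : Set α) (x : α) (ρ E σ k : ℝ) (ψ : ℝ → ℝ)
    (hψ : StrictMonoOn ψ (Set.Ioo 0 k))
    (hz : ∃ z : α, ρ ≤ dist z x ∧ dist z x ≤ E * ρ)
    (hσ : σ ∈ porHoles P x ρ) (hk : (E + 1) * ρ < k) :
    ψ σ ≤ ψ (porGamma P x ρ) := by
  obtain ⟨h1, h2⟩ := aux_gamma_bounds P x ρ E σ hz hσ
  have h0 := hσ.1
  exact hψ.monotoneOn ⟨h0, by linarith⟩ ⟨by linarith, by linarith⟩ h1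

theorem aux_lower {α : Type*} [MetricSpace α] (P : Set α) (x : α) (E k c ρ0 : ℝ) (ψ : ℝ → ℝ)
    (hE : 0 < E) (hk : 0 < k) (hc : 0 < c) (hρ0 : 0 < ρ0)
    (hψ : StrictMonoOn ψ (Set.Ioo 0 k))
    (hz : ∀ ρ, 0 < ρ → ρ < ρ0 → ∃ z : α, ρ ≤ dist z x ∧ dist z x ≤ E * ρ)
    (h : ∀ ρ, 0 < ρ → ρ < ρ0 → ∃ σ ∈ porHoles P x ρ, c * ρ ≤ ψ σ) :
    IsPhiLowerPorousAt ψ P x := by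
  constructor
  · intro r hr
    obtain ⟨σ, hσ, -⟩ := h (min r (ρ0 / 2)) (by positivity)
      (lt_of_le_of_lt (min_le_right _ _) (by linarith))
    exact aux_holes_mono P x (min_le_left _ _) ⟨σ, hσ⟩
  · have hc' : (0 : EReal) < (c : EReal) := by exact_mod_cast hc
    refine lt_of_lt_of_le hc' ?_
    apply le_liminf_of_le
    · isBoundedDefault
    · have hm : 0 < min ρ0 (k / (E + 1)) := by positivity
      filter_upwards [Ioo_mem_nhdsGT hm] with ρ hρ
      obtain ⟨hρ1, hρ2⟩ := hρ
      have h1 : ρ < ρ0 := lt_of_lt_of_le hρ2 (min_le_left _ _)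
      have h2 : ρ < k / (E + 1) := lt_of_lt_of_le hρ2 (min_le_right _ _)
      obtain ⟨σ, hσ, hcσ⟩ := h ρ hρ1 h1
      have hv := aux_value P x ρ E σ k ψ hψ (hz ρ hρ1 h1) hσ (by
        rw [lt_div_iff₀ (by positivity)] at h2; linarith)
      have : c ≤ ψ (porGamma P x ρ) / ρ := by
        rw [le_div_iff₀ hρ1]; linarith
      exact_mod_cast this

theorem aux_upper {α : Type*} [MetricSpace α] (P : Set α) (x : α) (E k c ρ0 : ℝ) (ψ : ℝ → ℝ)
    (hE : 0 < E) (hk : 0 < k) (hc : 0 < c) (hρ0 : 0 < ρ0)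
    (hψ : StrictMonoOn ψ (Set.Ioo 0 k))
    (hz : ∀ ρ, 0 < ρ → ρ < ρ0 → ∃ z : α, ρ ≤ dist z x ∧ dist z x ≤ E * ρ)
    (h : ∀ δ > 0, ∃ ρ, 0 < ρ ∧ ρ < δ ∧ ∃ σ ∈ porHoles P x ρ, c * ρ ≤ ψ σ) :
    IsPhiUpperPorousAt ψ P x := by
  constructor
  · intro r hr
    obtain ⟨ρ, -, hρ, σ, hσ, -⟩ := h r hr
    exact aux_holes_mono P x hρ.le ⟨σ, hσ⟩
  · have hc' : (0 : EReal) < (c : EReal) := by exact_mod_cast hc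
    refine lt_of_lt_of_le hc' ?_
    apply le_limsup_of_frequently_le
    · rw [frequently_iff]
      intro U hU
      obtain ⟨δ, hδ, hδU⟩ := mem_nhdsGT_iff_exists_Ioo_subset.1 hU
      have hδ' : 0 < δ := hδ
      have hm : 0 < min δ (min ρ0 (k / (E + 1))) := by positivity
      obtain ⟨ρ, hρ1, hρ2, σ, hσ, hcσ⟩ := h _ hm
      have h0 : ρ < δ := lt_of_lt_of_le hρ2 (min_le_left _ _)
      have h1 : ρ < ρ0 := lt_of_lt_of_le hρ2 ((min_le_right _ _).trans (min_le_left _ _))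
      have h2 : ρ < k / (E + 1) := lt_of_lt_of_le hρ2 ((min_le_right _ _).trans (min_le_right _ _))
      have hv := aux_value P x ρ E σ k ψ hψ (hz ρ hρ1 h1) hσ (by
        rw [lt_div_iff₀ (by positivity)] at h2; linarith)
      have : c ≤ ψ (porGamma P x ρ) / ρ := by
        rw [le_div_iff₀ hρ1]; linarith
      exact ⟨ρ, hδU ⟨hρ1, h0⟩, by exact_mod_cast this⟩
    · isBoundedDefault

/-- concavity: `(s/(2t)) ψ t ≤ ψ s`. -/
theorem aux_concave (k : ℝ) (ψ : ℝ → ℝ) (hconc : ConcaveOn ℝ (Set.Ioo 0 k) ψ)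
    (hpos : ∀ t ∈ Set.Ioo 0 k, 0 < ψ t) (s t : ℝ) (hs : 0 < s) (hst : s ≤ t) (htk : t < k) :
    s / (2 * t) * ψ t ≤ ψ s := by
  have ht : 0 < t := by linarith
  have hψt := hpos t ⟨ht, htk⟩
  have he : s / 2 ∈ Set.Ioo 0 k := ⟨by linarith, by linarith⟩
  have hψe := hpos _ he
  have hd : 0 < 2 * t - s := by linarith
  have hd' := hd.ne'
  have hc2 := hconc.2
  have h := @hc2 _ he _ (⟨ht, htk⟩ : t ∈ Set.Ioo 0 k)
    ((2 * (t - s)) / (2 * t - s)) (s / (2 * t - s))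
    (div_nonneg (by linarith) hd.le) (by positivity)
    (by rw [← add_div, div_eq_one_iff_eq hd']; ring)
  simp only [smul_eq_mul] at h
  have e : (2 * (t - s)) / (2 * t - s) * (s / 2) + s / (2 * t - s) * t = s := by
    rw [div_mul_eq_mul_div, div_mul_eq_mul_div, ← add_div, div_eq_iff hd']; ring
  rw [e] at h
  have h1 : 0 ≤ (2 * (t - s)) / (2 * t - s) * ψ (s / 2) :=
    mul_nonneg (div_nonneg (by linarith) hd.le) hψe.le
  have h2 : s / (2 * t) ≤ s / (2 * t - s) := by
    rw [div_le_div_iff₀ (by positivity) hd]; nlinarith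
  have h3 := mul_le_mul_of_nonneg_right h2 hψt.le
  linarith

/-- uniformly locally nonexpansive on a convex set implies nonexpansive. -/
theorem aux_local_global {X : Type*} [NormedAddCommGroup X] [NormedSpace ℝ X]
    (C : Set X) (hC : Convex ℝ C) (g : C → C) (δ : ℝ) (hδ : 0 < δ)
    (h : ∀ x y : C, dist x y < δ → dist (g x) (g y) ≤ dist x y) :
    LipschitzWith 1 g := by
  have key : ∀ n : ℕ, ∀ x y : C, dist x y < (n + 1) * δ → dist (g x) (g y) ≤ dist x y := by
    intro n
    induction n with
    | zero => intro x y hxy; exact h x y (by simpa using hxy)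
    | succ n ih =>
      intro x y hxy
      push_cast at hxy
      -- point at fraction 1/(n+2) from x
      have hn : (0 : ℝ) < (n : ℝ) + 2 := by positivity
      set a : ℝ := 1 / ((n : ℝ) + 2) with ha
      have ha0 : 0 < a := by positivity
      have ha1 : a ≤ 1 := by rw [ha, div_le_one hn]; linarith [(Nat.cast_nonneg n : (0:ℝ) ≤ n)]
      let z : C := ⟨(1 - a) • (x : X) + a • (y : X),
        hC x.2 y.2 (by linarith) ha0.le (by ring)⟩
      have e1 : dist x z = a * dist x y := by
        rw [Subtype.dist_eq, Subtype.dist_eq, dist_eq_norm, dist_eq_norm]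
        have : (x : X) - (z : X) = a • ((x : X) - y) := by
          simp only [z]; module
        rw [this, norm_smul, Real.norm_of_nonneg ha0.le]
      have e2 : dist z y = (1 - a) * dist x y := by
        rw [Subtype.dist_eq, Subtype.dist_eq, dist_eq_norm, dist_eq_norm]
        have : (z : X) - (y : X) = (1 - a) • ((x : X) - y) := by
          simp only [z]; module
        rw [this, norm_smul, Real.norm_of_nonneg (by linarith)]
      have hxy' : dist x y < ((n : ℝ) + 2) * δ := by linarith
      have han : a * ((n : ℝ) + 2) = 1 := by rw [ha]; field_simp
      have b1 : dist x z < δ := by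
        rw [e1]
        calc a * dist x y < a * (((n : ℝ) + 2) * δ) := by gcongr
          _ = δ := by rw [← mul_assoc, han, one_mul]
      have b2 : dist z y < ((n : ℝ) + 1) * δ := by
        rw [e2]
        have h1a : 0 < 1 - a := by
          rw [ha, sub_pos, div_lt_one hn]; linarith [(Nat.cast_nonneg n : (0:ℝ) ≤ n)]
        calc (1 - a) * dist x y < (1 - a) * (((n : ℝ) + 2) * δ) := by gcongr
          _ = ((n : ℝ) + 2) * δ - (a * ((n : ℝ) + 2)) * δ := by ring
          _ = ((n : ℝ) + 1) * δ := by rw [han]; ring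
      have c1 := h x z b1
      have c2 := ih z y b2
      have := dist_triangle (g x) (g z) (g y)
      rw [e1] at c1; rw [e2] at c2
      linarith
  refine LipschitzWith.of_dist_le_mul fun x y => ?_
  obtain ⟨n, hn⟩ := exists_nat_gt (dist x y / δ)
  rw [div_lt_iff₀ hδ] at hn
  simpa using key n x y (by linarith)


theorem aux_scalar (r R : ℝ) (hr : 0 < r) (hr1 : r < 1) (hR : 0 < R) :
    ∃ a : ℝ → ℝ, (∀ t, 0 ≤ a t ∧ a t ≤ 1) ∧
      (∀ t t', 0 < t → t ≤ t' → a t ≤ a t' ∧ (1 - r) * (a t' * t' - a t * t) ≤ t' - t) ∧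
      (∀ t, R ≤ t → a t = 1) ∧ (∀ t, 0 < t → t ≤ r * R → a t = 0) ∧
      (∀ t, 0 < t → r * R ≤ t → (1 - r) * (a t * t) ≤ t - r * R) ∧
      (∀ t, 0 ≤ t → t - a t * t ≤ r * R) := by
  have h1r : 0 < 1 - r := by linarith
  have hs : 0 < r * R := by positivity
  have hsR : r * R < R := by nlinarith
  have hth : ∀ t, 0 < t → max 0 (min 1 ((1 - r * R / t) / (1 - r))) * t
      = max 0 (min t ((t - r * R) / (1 - r))) := by
    intro t ht
    rw [max_mul_of_nonneg _ _ ht.le, min_mul_of_nonneg _ _ ht.le]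
    congr 2
    · ring
    · ring
    · field_simp
  have hnn : ∀ t, 0 < t → r * R ≤ t → (1 - r) * max 0 (min t ((t - r * R) / (1 - r)))
      ≤ t - r * R := by
    intro t ht h
    rw [mul_max_of_nonneg _ _ h1r.le, mul_min_of_nonneg _ _ h1r.le, mul_div_cancel₀ _ h1r.ne']
    apply max_le (by linarith) (min_le_right _ _)
  refine ⟨fun t => max 0 (min 1 ((1 - r * R / t) / (1 - r))), ?_, ?_, ?_, ?_, ?_, ?_⟩
  · intro t
    exact ⟨le_max_left _ _, max_le zero_le_one (min_le_left _ _)⟩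
  · intro t t' ht htt'
    have ht' : 0 < t' := by linarith
    constructor
    · dsimp only
      gcongr
    · dsimp only
      rw [hth t ht, hth t' ht', mul_sub]
      rw [mul_max_of_nonneg _ _ h1r.le, mul_min_of_nonneg _ _ h1r.le, mul_div_cancel₀ _ h1r.ne',
        mul_max_of_nonneg _ _ h1r.le, mul_min_of_nonneg _ _ h1r.le, mul_div_cancel₀ _ h1r.ne']
      have k1 : (1 - r) * (t' - t) ≤ t' - t := by nlinarith
      rw [sub_le_iff_le_add]
      apply max_le
      · have := le_max_left ((1 - r) * 0) (min ((1 - r) * t) (t - r * R))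
        linarith
      · have : min ((1 - r) * t') (t' - r * R) ≤ t' - t + min ((1 - r) * t) (t - r * R) := by
          rcases min_cases ((1 - r) * t) (t - r * R) with h | h <;> rw [h.1]
          · exact (min_le_left _ _).trans (by linarith)
          · exact (min_le_right _ _).trans (by linarith)
        have h2 := le_max_right ((1 - r) * 0) (min ((1 - r) * t) (t - r * R))
        linarith
  · intro t ht
    have ht0 : 0 < t := by linarith
    have : 1 ≤ (1 - r * R / t) / (1 - r) := by
      rw [le_div_iff₀ h1r]
      have : r * R / t ≤ r := by rw [div_le_iff₀ ht0]; nlinarith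
      linarith
    dsimp only
    rw [min_eq_left this]; simp
  · intro t ht h
    have : (1 - r * R / t) / (1 - r) ≤ 0 := by
      apply div_nonpos_of_nonpos_of_nonneg _ h1r.le
      have : 1 ≤ r * R / t := by rw [le_div_iff₀ ht]; linarith
      linarith
    dsimp only
    exact max_eq_left ((min_le_right _ _).trans this)
  · intro t ht h
    dsimp only
    rw [hth t ht]
    exact hnn t ht h
  · intro t ht
    rcases ht.eq_or_lt with rfl | ht
    · simpa using hs.le
    dsimp only
    rw [hth t ht]
    by_cases h : t ≤ r * R
    · have := le_max_left 0 (min t ((t - r * R) / (1 - r)))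
      linarith
    · push Not at h
      have h2 := le_max_right 0 (min t ((t - r * R) / (1 - r)))
      have h3 : t - r * R ≤ min t ((t - r * R) / (1 - r)) := by
        apply le_min (by linarith)
        rw [le_div_iff₀ h1r]
        nlinarith
      linarith

theorem aux_radial {X : Type*} [NormedAddCommGroup X] [NormedSpace ℝ X]
    (C : Set X) (hC : Convex ℝ C) (r R : ℝ) (hr : 0 < r) (hr1 : r < 1) (hR : 0 < R) (y : C) :
    ∃ ψ : C → C, (∀ x x', (1 - r) * dist (ψ x) (ψ x') ≤ dist x x') ∧
      (∀ x, R ≤ dist x y → ψ x = x) ∧ (∀ x, dist x y ≤ r * R → ψ x = y) ∧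
      (∀ x, r * R ≤ dist x y → (1 - r) * dist (ψ x) y ≤ dist x y - r * R) ∧
      ∀ x, dist (ψ x) x ≤ r * R := by
  obtain ⟨a, ha1, ha2, ha3, ha4, ha5, ha6⟩ := aux_scalar r R hr hr1 hR
  have hs : 0 < r * R := by positivity
  let ψ : C → C := fun x => ⟨(1 - a (dist x y)) • (y : X) + a (dist x y) • (x : X),
    hC y.2 x.2 (by linarith [(ha1 (dist x y)).2]) (ha1 _).1 (by ring)⟩
  have hψ : ∀ x : C, (ψ x : X) = (1 - a (dist x y)) • (y : X) + a (dist x y) • (x : X) :=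
    fun x => rfl
  have hψy : ∀ x : C, dist (ψ x) y = a (dist x y) * dist x y := by
    intro x
    rw [Subtype.dist_eq, Subtype.dist_eq x y, dist_eq_norm, dist_eq_norm (x : X) y]
    have : (ψ x : X) - (y : X) = a (dist x y) • ((x : X) - y) := by rw [hψ]; module
    rw [this, norm_smul, Real.norm_of_nonneg (ha1 _).1, Subtype.dist_eq, dist_eq_norm]
  have hyy : ψ y = y := by
    have := hψy y
    simpa using this
  have key : ∀ x x' : C, dist x' y ≤ dist x y → (1 - r) * dist (ψ x) (ψ x') ≤ dist x x' := by
    intro x x' hle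
    rcases (dist_nonneg : 0 ≤ dist x' y).eq_or_lt with h0 | h0
    · have hx' : x' = y := dist_eq_zero.1 h0.symm
      rw [hx', hyy, hψy]
      have := ha1 (dist x y)
      have hd : 0 ≤ dist x y := dist_nonneg
      nlinarith [mul_nonneg this.1 hd]
    · obtain ⟨b1, b2⟩ := ha2 _ _ h0 hle
      have e : (ψ x : X) - (ψ x' : X) = a (dist x' y) • ((x : X) - x')
          + (a (dist x y) - a (dist x' y)) • ((x : X) - y) := by
        rw [hψ, hψ]; module
      have hn : dist (ψ x) (ψ x') ≤ a (dist x' y) * dist x x'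
          + (a (dist x y) - a (dist x' y)) * dist x y := by
        rw [Subtype.dist_eq (ψ x), dist_eq_norm, e]
        refine (norm_add_le _ _).trans ?_
        rw [norm_smul, norm_smul, Real.norm_of_nonneg (ha1 _).1,
          Real.norm_of_nonneg (sub_nonneg.2 b1), ← dist_eq_norm, ← dist_eq_norm,
          ← Subtype.dist_eq, ← Subtype.dist_eq]
      have tri : dist x y - dist x' y ≤ dist x x' := by
        have := dist_triangle x x' y; linarith
      have hb := ha1 (dist x' y)
      have h1r : 0 < 1 - r := by linarith
      have hn2 := mul_le_mul_of_nonneg_left hn h1r.le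
      have hβ : 0 ≤ 1 - (1 - r) * a (dist x' y) := by nlinarith
      nlinarith [mul_le_mul_of_nonneg_left tri hβ]
  refine ⟨ψ, ?_, ?_, ?_, ?_, ?_⟩
  · intro x x'
    rcases le_total (dist x' y) (dist x y) with h | h
    · exact key x x' h
    · rw [dist_comm (ψ x), dist_comm x]; exact key x' x h
  · intro x hx
    apply Subtype.ext
    rw [hψ, ha3 _ hx]; module
  · intro x hx
    rcases (dist_nonneg : 0 ≤ dist x y).eq_or_lt with h0 | h0
    · rw [dist_eq_zero.1 h0.symm, hyy]
    · apply Subtype.ext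
      rw [hψ, ha4 _ h0 hx]; module
  · intro x hx
    rw [hψy]
    exact ha5 _ (by linarith) hx
  · intro x
    have e : (x : X) - (ψ x : X) = (1 - a (dist x y)) • ((x : X) - y) := by rw [hψ]; module
    have h6 := ha6 (dist x y) dist_nonneg
    rw [dist_comm, Subtype.dist_eq, dist_eq_norm, e, norm_smul,
      Real.norm_of_nonneg (by linarith [(ha1 (dist x y)).2]), ← dist_eq_norm, ← Subtype.dist_eq]
    linarith

/-- a point of `C` far from a given point -/
theorem aux_far {α : Type*} [MetricSpace α] (p q x : α) :
    ∃ w : α, dist p q / 2 ≤ dist w x := by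
  by_contra! h
  have h1 := h p
  have h2 := h q
  have := dist_triangle p x q
  rw [dist_comm x q] at this
  linarith

theorem aux_single {X : Type*} [NormedAddCommGroup X] [NormedSpace ℝ X]
    (C : Set X) (hC : Convex ℝ C) (p q : C) (f : C → C) (hf : LipschitzWith 1 f)
    (r R : ℝ) (hr : 0 < r) (hr1 : r < 1) (hR : 0 < R) (hpq : r * R ≤ dist p q / 2)
    (F : C → C) (hF : ∀ x, (F x : X) = (1 - r) • (f x : X) + r • (p : X)) (y : C) :
    ∃ G : C → C, LipschitzWith 1 G ∧ (∀ x, R ≤ dist x y → G x = F x) ∧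
      (∀ x, dist (G x) (F x) ≤ 2 * (r * R)) ∧
      (∀ x, dist x y ≤ r * R → dist (G x) (G y) = dist x y) := by
  obtain ⟨ψ, hψ1, hψ2, hψ3, hψ4, hψ5⟩ := aux_radial C hC r R hr hr1 hR y
  have hs : 0 < r * R := by positivity
  have hsR : r * R < R := by nlinarith
  have h1r : 0 < 1 - r := by linarith
  have hf' : ∀ x x', dist (f x) (f x') ≤ dist x x' := fun x x' => by
    simpa using hf.dist_le_mul x x'
  have hFd : ∀ x x', dist (F x) (F x') = (1 - r) * dist (f x) (f x') := by
    intro x x'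
    rw [Subtype.dist_eq, Subtype.dist_eq, dist_eq_norm, dist_eq_norm, hF, hF]
    have : (1 - r) • (f x : X) + r • (p : X) - ((1 - r) • (f x' : X) + r • (p : X))
      = (1 - r) • ((f x : X) - f x') := by module
    rw [this, norm_smul, Real.norm_of_nonneg h1r.le]
  have hF2 : ∀ x x', dist (F x) (F x') ≤ (1 - r) * dist x x' := by
    intro x x'
    rw [hFd]
    exact mul_le_mul_of_nonneg_left (hf' _ _) h1r.le
  have hFψ : ∀ x x', dist (F (ψ x)) (F (ψ x')) ≤ dist x x' := fun x x' =>
    (hF2 _ _).trans (hψ1 x x')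
  obtain ⟨w, hw⟩ := aux_far p q (F y)
  set d := dist w (F y) with hd
  have hd0 : 0 < d := by linarith
  have hsd : r * R ≤ d := by linarith
  -- bump
  let β : C → ℝ := fun x => max 0 (r * R - dist x y) / d
  have hβ0 : ∀ x, 0 ≤ β x := fun x => div_nonneg (le_max_left _ _) hd0.le
  have hβ1 : ∀ x, β x ≤ 1 := fun x => by
    apply (div_le_one hd0).2
    apply max_le hd0.le
    have : 0 ≤ dist x y := dist_nonneg
    linarith
  have hβout : ∀ x, r * R ≤ dist x y → β x = 0 := fun x hx => by
    simp only [β]; rw [max_eq_left (by linarith)]; simp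
  have hβin : ∀ x, dist x y ≤ r * R → β x * d = r * R - dist x y := fun x hx => by
    simp only [β]; rw [max_eq_right (by linarith)]; field_simp
  let G : C → C := fun x => ⟨(1 - β x) • (F (ψ x) : X) + β x • (w : X),
    hC (F (ψ x)).2 w.2 (by linarith [hβ1 x]) (hβ0 x) (by ring)⟩
  have hGout : ∀ x, r * R ≤ dist x y → G x = F (ψ x) := fun x hx => by
    apply Subtype.ext
    simp only [G]
    rw [hβout x hx]; module
  have hGin : ∀ x, dist x y ≤ r * R → (G x : X) = (F y : X) + β x • ((w : X) - F y) :=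
    fun x hx => by
    simp only [G]
    rw [hψ3 x hx]; module
  have hGin2 : ∀ x x', dist x y ≤ r * R → dist x' y ≤ r * R →
      dist (G x) (G x') = |dist x' y - dist x y| := by
    intro x x' hx hx'
    rw [Subtype.dist_eq, dist_eq_norm, hGin x hx, hGin x' hx']
    have : (F y : X) + β x • ((w : X) - F y) - ((F y : X) + β x' • ((w : X) - F y))
        = (β x - β x') • ((w : X) - F y) := by module
    have hdn : ‖(w : X) - F y‖ = d := by rw [← dist_eq_norm, ← Subtype.dist_eq]
    have e2 : |β x - β x'| * d = |(β x - β x') * d| := by rw [abs_mul, abs_of_pos hd0]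
    rw [this, norm_smul, hdn, Real.norm_eq_abs, e2, sub_mul, hβin x hx, hβin x' hx']
    congr 1; ring
  have hGin3 : ∀ x, dist x y ≤ r * R → dist (G x) (F y) = r * R - dist x y := by
    intro x hx
    rw [Subtype.dist_eq, dist_eq_norm, hGin x hx]
    rw [add_sub_cancel_left, norm_smul, ← dist_eq_norm, ← Subtype.dist_eq, ← hd,
      Real.norm_of_nonneg (hβ0 x), hβin x hx]
  have hmix : ∀ x x', dist x y ≤ r * R → r * R ≤ dist x' y → dist (G x) (G x') ≤ dist x x' := by
    intro x x' hx hx'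
    have h1 := dist_triangle (G x) (F y) (G x')
    rw [hGin3 x hx] at h1
    have h2 : dist (F y) (G x') ≤ dist x' y - r * R := by
      rw [hGout x' hx', dist_comm]
      exact (hF2 _ _).trans (hψ4 x' hx')
    have h3 := dist_triangle x' x y
    rw [dist_comm x' x] at h3
    linarith
  refine ⟨G, ?_, ?_, ?_, ?_⟩
  · refine LipschitzWith.of_dist_le_mul fun x x' => ?_
    simp only [NNReal.coe_one, one_mul]
    rcases le_total (dist x y) (r * R) with hx | hx <;>
    rcases le_total (dist x' y) (r * R) with hx' | hx'
    · rw [hGin2 x x' hx hx', dist_comm x x']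
      exact abs_dist_sub_le x' x y
    · exact hmix x x' hx hx'
    · rw [dist_comm (G x), dist_comm x]; exact hmix x' x hx' hx
    · rw [hGout x hx, hGout x' hx']
      exact hFψ x x'
  · intro x hx
    rw [hGout x (by linarith), hψ2 x hx]
  · intro x
    have h1 : dist (F (ψ x)) (F x) ≤ r * R := by
      refine (hF2 _ _).trans ?_
      have := hψ5 x
      have h0 : 0 ≤ dist (ψ x) x := dist_nonneg
      nlinarith
    have h2 : dist (G x) (F (ψ x)) ≤ r * R := by
      rcases le_total (dist x y) (r * R) with hx | hx
      · rw [hψ3 x hx, hGin3 x hx]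
        have : 0 ≤ dist x y := dist_nonneg
        linarith
      · rw [hGout x hx, dist_self]; exact hs.le
    have := dist_triangle (G x) (F (ψ x)) (F x)
    linarith
  · intro x hx
    rw [hGin2 x y hx (by rw [dist_self]; exact hs.le), dist_self, zero_sub, abs_neg,
      abs_of_nonneg dist_nonneg]


theorem aux_net (α : Type*) [MetricSpace α] (δ : ℝ) (hδ : 0 < δ) :
    ∃ Γ : Set α, (∀ y ∈ Γ, ∀ y' ∈ Γ, dist y y' < δ → y = y') ∧
      ∀ x : α, ∃ y ∈ Γ, dist x y < δ := by
  obtain ⟨Γ, hΓ⟩ := zorn_subset {S : Set α | ∀ y ∈ S, ∀ y' ∈ S, dist y y' < δ → y = y'} (by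
    intro c hc hchain
    refine ⟨⋃₀ c, ?_, fun s hs => subset_sUnion_of_mem hs⟩
    rintro y ⟨S, hS, hy⟩ y' ⟨S', hS', hy'⟩ h
    rcases hchain.total hS hS' with h1 | h1
    · exact hc hS' y (h1 hy) y' hy' h
    · exact hc hS y hy y' (h1 hy') h)
  refine ⟨Γ, hΓ.prop, fun x => ?_⟩
  by_contra! hx
  have hins : insert x Γ ∈ {S : Set α | ∀ y ∈ S, ∀ y' ∈ S, dist y y' < δ → y = y'} := by
    rintro y (rfl | hy) y' (rfl | hy') h
    · rfl
    · exact absurd h (not_lt.2 (hx y' hy'))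
    · rw [dist_comm] at h; exact absurd h (not_lt.2 (hx y hy))
    · exact hΓ.prop y hy y' hy' h
  have hxΓ : x ∈ Γ := hΓ.le_of_ge hins (subset_insert x Γ) (mem_insert x Γ)
  have := hx x hxΓ
  rw [dist_self] at this
  linarith

theorem aux_global {X : Type*} [NormedAddCommGroup X] [NormedSpace ℝ X]
    (C : Set X) (hC : Convex ℝ C) (p q : C) (f : C → C) (hf : LipschitzWith 1 f)
    (r R : ℝ) (hr : 0 < r) (hr1 : r < 1) (hR : 0 < R) (hpq : r * R ≤ dist p q / 2)
    (D : ℝ) (hD : ∀ x y : C, dist x y ≤ D) :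
    ∃ g : C → C, LipschitzWith 1 g ∧ (∀ x, dist (g x) (f x) ≤ r * D + 2 * (r * R)) ∧
      ∀ x, ∃ y, dist x y < 3 * R ∧ ∀ z, dist z y ≤ r * R → dist (g z) (g y) = dist z y := by
  classical
  have hs : 0 < r * R := by positivity
  have hsR : r * R < R := by nlinarith
  let F : C → C := fun x => ⟨(1 - r) • (f x : X) + r • (p : X),
    hC (f x).2 p.2 (by linarith) hr.le (by ring)⟩
  have hF : ∀ x, (F x : X) = (1 - r) • (f x : X) + r • (p : X) := fun x => rfl
  have hFf : ∀ x, dist (F x) (f x) ≤ r * D := by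
    intro x
    have e : (F x : X) - f x = r • ((p : X) - f x) := by rw [hF]; module
    rw [Subtype.dist_eq, dist_eq_norm, e, norm_smul, Real.norm_of_nonneg hr.le, ← dist_eq_norm,
      ← Subtype.dist_eq]
    exact mul_le_mul_of_nonneg_left (hD _ _) hr.le
  choose G hG1 hG2 hG3 hG4 using
    fun y => aux_single C hC p q f hf r R hr hr1 hR hpq F hF y
  have hG1' : ∀ y x x', dist (G y x) (G y x') ≤ dist x x' := fun y x x' => by
    simpa using (hG1 y).dist_le_mul x x'
  have hF1 : ∀ x x', dist (F x) (F x') ≤ dist x x' := by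
    intro x x'
    have e : (F x : X) - F x' = (1 - r) • ((f x : X) - f x') := by rw [hF, hF]; module
    have h2 : dist (f x) (f x') ≤ dist x x' := by simpa using hf.dist_le_mul x x'
    rw [Subtype.dist_eq, dist_eq_norm, e, norm_smul, Real.norm_of_nonneg (by linarith),
      ← dist_eq_norm, ← Subtype.dist_eq]
    have h3 : 0 ≤ dist (f x) (f x') := dist_nonneg
    nlinarith
  obtain ⟨Γ, hΓ1, hΓ2⟩ := aux_net C (3 * R) (by linarith)
  let g : C → C := fun x =>
    if h : ∃ y ∈ Γ, dist x y < R then G h.choose x else F x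
  have hgin : ∀ x, ∀ y ∈ Γ, dist x y < R → g x = G y x := by
    intro x y hy hxy
    have h : ∃ y ∈ Γ, dist x y < R := ⟨y, hy, hxy⟩
    have e : h.choose = y := by
      apply hΓ1 _ h.choose_spec.1 _ hy
      have h1 := h.choose_spec.2
      have := dist_triangle_left h.choose y x
      linarith
    simp only [g]
    rw [dif_pos h, e]
  have hgout : ∀ x, (∀ y ∈ Γ, R ≤ dist x y) → g x = F x := by
    intro x hx
    have h : ¬ ∃ y ∈ Γ, dist x y < R := by
      rintro ⟨y, hy, h⟩
      linarith [hx y hy]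
    simp only [g]
    rw [dif_neg h]
  have hgnear : ∀ x, ∀ y ∈ Γ, dist x y < 2 * R → g x = G y x := by
    intro x y hy hxy
    by_cases h : dist x y < R
    · exact hgin x y hy h
    · push Not at h
      rw [hG2 y x h]
      apply hgout
      intro y' hy'
      by_contra! h'
      have e : y' = y := by
        apply hΓ1 _ hy' _ hy
        have := dist_triangle_left y' y x
        linarith
      rw [e] at h'
      linarith
  refine ⟨g, ?_, ?_, ?_⟩
  · apply aux_local_global C hC g (R / 2) (by linarith)
    intro x x' hxx'
    by_cases h : ∃ y ∈ Γ, dist x y < 3 * R / 2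
    · obtain ⟨y, hy, hxy⟩ := h
      rw [hgnear x y hy (by linarith), hgnear x' y hy (by
        have := dist_triangle_left x' y x
        linarith)]
      exact hG1' y x x'
    · push Not at h
      rw [hgout x (fun y hy => by linarith [h y hy]), hgout x' (fun y hy => by
        have := h y hy
        have := dist_triangle x x' y
        linarith)]
      exact hF1 x x'
  · intro x
    have h1 : dist (g x) (F x) ≤ 2 * (r * R) := by
      by_cases h : ∃ y ∈ Γ, dist x y < R
      · obtain ⟨y, hy, hxy⟩ := h
        rw [hgin x y hy hxy]; exact hG3 y x
      · push Not at h
        rw [hgout x h, dist_self]; linarith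
    have := dist_triangle (g x) (F x) (f x)
    linarith [hFf x]
  · intro x
    obtain ⟨y, hy, hxy⟩ := hΓ2 x
    refine ⟨y, hxy, fun z hz => ?_⟩
    rw [hgin z y hy (by linarith), hgin y y hy (by rw [dist_self]; exact hR)]
    exact hG4 y z hz

/-- the set of points where the map is a strict contraction, quantified by `n`. -/
def auxP {X : Type*} [NormedAddCommGroup X] {C : Set X} (h : C → C) (n : ℕ) : Set C :=
  {x | ∀ z, dist z x ≤ 1 / ((n : ℝ) + 1) → dist (h z) (h x) ≤ (1 - 1 / ((n : ℝ) + 1)) * dist z x}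

theorem auxP_mono {X : Type*} [NormedAddCommGroup X] {C : Set X} (h : C → C) {n m : ℕ}
    (hnm : n ≤ m) : auxP h n ⊆ auxP h m := by
  intro x hx z hz
  have hle : 1 / ((m : ℝ) + 1) ≤ 1 / ((n : ℝ) + 1) := by
    have : (n : ℝ) ≤ m := by exact_mod_cast hnm
    gcongr
  refine (hx z (hz.trans hle)).trans ?_
  gcongr

theorem auxP_union {X : Type*} [NormedAddCommGroup X] {C : Set X} (f : C → C)
    (hf : LipschitzWith 1 f) : {x : C | LipPt f x = 1}ᶜ = ⋃ n, auxP f n := by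
  have hf' : ∀ x x', dist (f x) (f x') ≤ dist x x' := fun x x' => by
    simpa using hf.dist_le_mul x x'
  have hs0 : ∀ x r, 0 ≤ LipScale f x r := by
    intro x r
    apply Real.sSup_nonneg
    rintro _ ⟨y, -, rfl⟩
    positivity
  have hub : ∀ x r, BddAbove ((fun y : C => dist (f y) (f x) / dist y x) ''
      {y : C | 0 < dist y x ∧ dist y x ≤ r}) := by
    intro x r
    refine ⟨1, ?_⟩
    rintro _ ⟨y, hy, rfl⟩
    exact (div_le_one hy.1).2 (hf' y x)
  have hs1 : ∀ x r, LipScale f x r ≤ 1 := by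
    intro x r
    apply Real.sSup_le _ zero_le_one
    rintro _ ⟨y, hy, rfl⟩
    exact (div_le_one hy.1).2 (hf' y x)
  have hbb : ∀ x, BddBelow ((fun r : ℝ => LipScale f x r) '' Set.Ioi 0) := by
    intro x
    refine ⟨0, ?_⟩
    rintro _ ⟨r, -, rfl⟩
    exact hs0 x r
  have hL : ∀ x r, 0 < r → LipPt f x ≤ LipScale f x r := fun x r hr =>
    csInf_le (hbb x) ⟨r, hr, rfl⟩
  ext x
  simp only [mem_compl_iff, mem_ofPred_eq, mem_iUnion]
  constructor
  · intro hx
    have hlt : LipPt f x < 1 := lt_of_le_of_ne ((hL x 1 one_pos).trans (hs1 x 1)) hx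
    obtain ⟨_, ⟨r, hr, rfl⟩, hr1⟩ := exists_lt_of_csInf_lt (Set.Nonempty.image _ ⟨1, one_pos⟩) hlt
    have hr0 : 0 < r := hr
    dsimp only at hr1
    have hm : 0 < min r (1 - LipScale f x r) := lt_min hr0 (by linarith)
    obtain ⟨n, hn⟩ := exists_nat_one_div_lt hm
    refine ⟨n, fun z hz => ?_⟩
    rcases (dist_nonneg : 0 ≤ dist z x).eq_or_lt with h0 | h0
    · rw [← h0]
      have := hf' z x
      rw [← h0] at this
      linarith
    · have h1 : dist (f z) (f x) / dist z x ≤ LipScale f x r :=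
        le_csSup (hub x r) ⟨z, ⟨h0, hz.trans (hn.le.trans (min_le_left _ _))⟩, rfl⟩
      have h2 := hn.le.trans (min_le_right _ _)
      rw [← div_le_iff₀ h0]
      linarith
  · rintro ⟨n, hn⟩ h1
    have hp : (0 : ℝ) < 1 / ((n : ℝ) + 1) := by positivity
    have hp1 : 1 / ((n : ℝ) + 1) ≤ 1 := by
      rw [div_le_one (by positivity)]; linarith [(Nat.cast_nonneg n : (0:ℝ) ≤ n)]
    have h2 : LipScale f x (1 / ((n : ℝ) + 1)) ≤ 1 - 1 / ((n : ℝ) + 1) := by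
      apply Real.sSup_le _ (by linarith)
      rintro _ ⟨y, hy, rfl⟩
      dsimp only
      rw [div_le_iff₀ hy.1]
      exact hn y hy.2
    have := hL x _ hp
    linarith

/-- from `x` there is a point of `C` at any small prescribed distance -/
theorem aux_point {X : Type*} [NormedAddCommGroup X] [NormedSpace ℝ X]
    (C : Set X) (hC : Convex ℝ C) (p q : C) (x : C) (t : ℝ) (ht : 0 < t)
    (htd : t ≤ dist p q / 2) : ∃ z : C, dist z x = t := by
  obtain ⟨w, hw⟩ := aux_far p q x
  have hd : 0 < dist w x := by linarith
  have ha : 0 ≤ t / dist w x := by positivity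
  have ha1 : t / dist w x ≤ 1 := by rw [div_le_one hd]; linarith
  refine ⟨⟨(1 - t / dist w x) • (x : X) + (t / dist w x) • (w : X),
    hC x.2 w.2 (by linarith) ha (by ring)⟩, ?_⟩
  rw [Subtype.dist_eq, dist_eq_norm]
  have e : (1 - t / dist w x) • (x : X) + (t / dist w x) • (w : X) - x
    = (t / dist w x) • ((w : X) - x) := by module
  dsimp only
  rw [e, norm_smul, Real.norm_of_nonneg ha, ← dist_eq_norm, ← Subtype.dist_eq]
  field_simp

theorem aux_hole {X : Type*} [NormedAddCommGroup X] [NormedSpace ℝ X]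
    (C : Set X) (hC : Convex ℝ C) (p q : C) (g h : C → C) (n : ℕ) (s R : ℝ)
    (hs : 0 < s) (hsR : s ≤ R) (hsn : s ≤ 1 / ((n : ℝ) + 1)) (hpq : s ≤ dist p q / 2)
    (hgh : ∀ x, dist (g x) (h x) < s / (8 * ((n : ℝ) + 1)))
    (x y : C) (hxy : dist x y < 3 * R)
    (hy : ∀ z, dist z y ≤ s → dist (g z) (g y) = dist z y) :
    s / 4 ∈ porHoles (auxP h n) x (4 * R) := by
  obtain ⟨y', hy'⟩ := aux_point C hC p q y (s / 2) (by linarith) (by linarith)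
  refine ⟨by linarith, y', fun z hz => ?_⟩
  rw [mem_ball] at hz
  have h1 : dist z y < 3 * s / 4 := by
    have := dist_triangle z y' y; linarith
  have h2 : s / 4 < dist z y := by
    have := dist_triangle_left y' y z; linarith
  refine ⟨?_, fun hP => ?_⟩
  · rw [mem_ball]
    have := dist_triangle_right z x y
    linarith
  · have h3 := hP y (by rw [dist_comm]; linarith)
    have h4 := hy z (by linarith)
    rw [dist_comm (h y), dist_comm y] at h3
    have h5 := dist_triangle4 (g z) (h z) (h y) (g y)
    have h6 := hgh z
    have h7 := hgh y
    rw [dist_comm (g y)] at h7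
    have hp : (0 : ℝ) < 1 / ((n : ℝ) + 1) := by positivity
    have e : s / (8 * ((n : ℝ) + 1)) = (1 / ((n : ℝ) + 1)) * (s / 8) := by
      field_simp
    rw [e] at h6 h7
    nlinarith [mul_lt_mul_of_pos_left h2 hp]


theorem aux_mk {X : Type*} [NormedAddCommGroup X] (C : Set X) (g : C → C)
    (hg : LipschitzWith 1 g) (D : ℝ) (hD : ∀ x y : C, dist x y ≤ D) :
    ∃ G : NonexpMap C, ∀ x, G.1 x = g x :=
  ⟨⟨BoundedContinuousFunction.mkOfBound ⟨g, hg.continuous⟩ D (fun _ _ => hD _ _), hg⟩,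
    fun _ => rfl⟩

theorem aux_far_map {X : Type*} [NormedAddCommGroup X] [NormedSpace ℝ X]
    (C : Set X) (hC : Convex ℝ C) (p q : C) (hpq : 0 < dist p q)
    (D : ℝ) (hD0 : 0 ≤ D) (hD : ∀ x y : C, dist x y ≤ D) (f : NonexpMap C) (ρ : ℝ) (hρ : 0 < ρ)
    (hρd : ρ ≤ dist p q / 2) :
    ∃ z : NonexpMap C, ρ ≤ dist z f ∧ dist z f ≤ (2 * D / dist p q) * ρ := by
  obtain ⟨w, hw⟩ := aux_far p q (f.1 p)
  set t := 2 * ρ / dist p q with ht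
  have ht0 : 0 < t := by positivity
  have ht1 : t ≤ 1 := by rw [ht, div_le_one hpq]; linarith
  let g : C → C := fun x => ⟨(1 - t) • (f.1 x : X) + t • (w : X),
    hC (f.1 x).2 w.2 (by linarith) ht0.le (by ring)⟩
  have hgf : ∀ x, dist (g x) (f.1 x) = t * dist w (f.1 x) := by
    intro x
    have e : (g x : X) - f.1 x = t • ((w : X) - f.1 x) := by simp only [g]; module
    rw [Subtype.dist_eq, dist_eq_norm, e, norm_smul, Real.norm_of_nonneg ht0.le, ← dist_eq_norm,
      ← Subtype.dist_eq]
  have hg : LipschitzWith 1 g := by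
    refine LipschitzWith.of_dist_le_mul fun x x' => ?_
    have e : (g x : X) - g x' = (1 - t) • ((f.1 x : X) - f.1 x') := by simp only [g]; module
    have h2 : dist (f.1 x) (f.1 x') ≤ dist x x' := by simpa using f.2.dist_le_mul x x'
    rw [Subtype.dist_eq, dist_eq_norm, e, norm_smul, Real.norm_of_nonneg (by linarith),
      ← dist_eq_norm, ← Subtype.dist_eq, NNReal.coe_one, one_mul]
    have h3 : 0 ≤ dist (f.1 x) (f.1 x') := dist_nonneg
    nlinarith
  obtain ⟨z, hz⟩ := aux_mk C g hg D hD
  refine ⟨z, ?_, ?_⟩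
  · have h1 : dist (z.1 p) (f.1 p) ≤ dist z f := BoundedContinuousFunction.dist_coe_le_dist p
    rw [hz, hgf] at h1
    refine le_trans ?_ h1
    calc ρ = t * (dist p q / 2) := by rw [ht]; field_simp
      _ ≤ _ := by gcongr
  · have h1 : dist z f ≤ t * D := by
      rw [Subtype.dist_eq]
      refine (BoundedContinuousFunction.dist_le (by positivity)).2 fun x => ?_
      rw [hz, hgf]
      exact mul_le_mul_of_nonneg_left (hD _ _) ht0.le
    refine h1.trans (le_of_eq ?_)
    rw [ht]; ring

/-- the good maps at stage `n` -/
def auxU {X : Type*} [NormedAddCommGroup X] (C : Set X) (K : ℝ) (φ : ℝ → ℝ) (n : ℕ) :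
    Set (NonexpMap C) :=
  {h | ∃ s R : ℝ, 0 < s ∧ s < 1 / K ∧ 0 < R ∧ R < 1 / ((n : ℝ) + 1) ∧ R ≤ K * φ s ∧
    ∀ x, s / 4 ∈ porHoles (auxP h.1 n) x (4 * R)}

set_option maxHeartbeats 1000000 in
theorem aux_main_lower {X : Type*} [NormedAddCommGroup X] [NormedSpace ℝ X]
    (C : Set X) (hC : Convex ℝ C) (p q : C) (hpq : 0 < dist p q)
    (D : ℝ) (hD0 : 0 < D) (hD : ∀ x y : C, dist x y ≤ D)
    (K : ℝ) (hK : 1 < K) (φ ξ : ℝ → ℝ)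
    (hξ_mono : StrictMonoOn ξ (Set.Ioo 0 (1 / K)))
    (hξ_conc : ConcaveOn ℝ (Set.Ioo 0 (1 / K)) ξ)
    (hξ_pos : ∀ t ∈ Set.Ioo 0 (1 / K), 0 < ξ t)
    (hprod : ∀ t ∈ Set.Ioo 0 (1 / K), t / K ≤ φ t * ξ t)
    (hξ_lim : Filter.Tendsto ξ (nhdsWithin 0 (Set.Ioi 0)) (nhds 0)) (n : ℕ) (f : NonexpMap C) :
    IsPhiLowerPorousAt ξ (auxU C K φ n)ᶜ f := by
  have hK0 : 0 < K := by linarith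
  have hk : 0 < 1 / K := by positivity
  have hn0 : (0 : ℝ) < (n : ℝ) + 1 := by positivity
  set t0 : ℝ := 1 / K / 2 with ht0
  have ht0p : 0 < t0 := by positivity
  have ht0k : t0 < 1 / K := by rw [ht0]; linarith
  have hξt0 : 0 < ξ t0 := hξ_pos t0 ⟨ht0p, ht0k⟩
  set B : ℝ := 2 * t0 / ξ t0 with hB
  have hB0 : 0 < B := by positivity
  have hlin : ∀ s, 0 < s → s ≤ t0 → s ≤ B * ξ s := by
    intro s hs hst
    have := aux_concave (1 / K) ξ hξ_conc hξ_pos s t0 hs hst ht0k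
    calc s = B * (s / (2 * t0) * ξ t0) := by rw [hB]; field_simp
      _ ≤ _ := by gcongr
  have hcont : ContinuousOn ξ (Set.Ioo 0 (1 / K)) := hξ_conc.continuousOn isOpen_Ioo
  have hivt : ∀ v, 0 < v → v < ξ t0 → ∃ s, 0 < s ∧ s ≤ t0 ∧ ξ s = v := by
    intro v hv hvt
    have hev : ∀ᶠ s in nhdsWithin (0 : ℝ) (Set.Ioi 0), ξ s < v := hξ_lim.eventually_lt_const hv
    obtain ⟨e, he1, he2, he3⟩ := (hev.and (Ioo_mem_nhdsGT ht0p)).exists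
    have hsub : Set.Icc e t0 ⊆ Set.Ioo 0 (1 / K) := fun u hu =>
      ⟨lt_of_lt_of_le he2 hu.1, lt_of_le_of_lt hu.2 ht0k⟩
    obtain ⟨s, hs, hsv⟩ := intermediate_value_Icc he3.le (hcont.mono hsub) ⟨he1.le, hvt.le⟩
    exact ⟨s, lt_of_lt_of_le he2 hs.1, hs.2, hsv⟩
  set c : ℝ := 1 / (1 + 2 * B * ((n : ℝ) + 1)) with hc
  have hc0 : 0 < c := by positivity
  have hc1 : c ≤ 1 := by
    rw [hc, div_le_one (by positivity)]
    have : 0 < 2 * B * ((n : ℝ) + 1) := by positivity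
    linarith
  have hBc : B * c < 1 / ((n : ℝ) + 1) := by
    rw [hc, mul_one_div, div_lt_div_iff₀ (by positivity) hn0]
    have : 0 < B * ((n : ℝ) + 1) := by positivity
    nlinarith
  have hn1 : 1 / ((n : ℝ) + 1) ≤ 1 := by
    rw [div_le_one hn0]; linarith [(Nat.cast_nonneg n : (0:ℝ) ≤ n)]
  have hρ0 : 0 < min (dist p q / 2) (min 1 (min (ξ t0) (1 / ((n : ℝ) + 1)))) := by positivity
  refine aux_lower _ f (2 * D / dist p q) (1 / K)
    (c / (D + 3) / (16 * ((n : ℝ) + 1))) _ ξ (by positivity) hk (by positivity) hρ0 hξ_mono ?_ ?_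
  · intro ρ hρ hρ1
    exact aux_far_map C hC p q hpq D hD0.le hD f ρ hρ (hρ1.le.trans (min_le_left _ _))
  · intro ρ hρ hρlt
    obtain ⟨hρd, hρ2⟩ := lt_min_iff.1 hρlt
    obtain ⟨hρ1, hρ3⟩ := lt_min_iff.1 hρ2
    obtain ⟨hρξ, hρn⟩ := lt_min_iff.1 hρ3
    set r : ℝ := ρ / (D + 3) with hr
    have hr0 : 0 < r := by positivity
    have hrρ : r * (D + 3) = ρ := by rw [hr]; field_simp
    have hrle : r ≤ ρ := by nlinarith
    have hcr : c * r ≤ ρ := by nlinarith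
    obtain ⟨s, hs0, hst, hsv⟩ := hivt (c * r) (by positivity) (by linarith)
    have hsk : s < 1 / K := by linarith
    have hsB : s ≤ B * c * r := by
      have := hlin s hs0 hst; rw [hsv] at this; linarith
    set R : ℝ := s / r with hR
    have hR0 : 0 < R := by positivity
    have hrR : r * R = s := by rw [hR]; field_simp
    have hRBc : R ≤ B * c := by rw [hR, div_le_iff₀ hr0]; exact hsB
    have hRn : R < 1 / ((n : ℝ) + 1) := by linarith
    have hsr : s ≤ r := by rw [← hrR]; nlinarith
    have hsR : s ≤ R := by rw [← hrR]; nlinarith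
    have hsd : s ≤ dist p q / 2 := by linarith
    obtain ⟨g, hg1, hg2, hg3⟩ := aux_global C hC p q f.1 f.2 r R hr0 (by linarith) hR0
      (by rw [hrR]; exact hsd) D hD
    rw [hrR] at hg2 hg3
    obtain ⟨G, hG⟩ := aux_mk C g hg1 D hD
    have hσ0 : 0 < s / (8 * ((n : ℝ) + 1)) := by positivity
    have hσs : s / (8 * ((n : ℝ) + 1)) ≤ s := by
      apply div_le_self hs0.le
      linarith [(Nat.cast_nonneg n : (0:ℝ) ≤ n)]
    refine ⟨s / (8 * ((n : ℝ) + 1)), ⟨hσ0, G, ?_⟩, ?_⟩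
    · intro h hh
      rw [mem_ball] at hh
      have hGf : dist G f ≤ r * D + 2 * s := by
        rw [Subtype.dist_eq]
        refine (BoundedContinuousFunction.dist_le (by positivity)).2 fun x => ?_
        rw [hG]; exact hg2 x
      constructor
      · rw [mem_ball]
        have := dist_triangle h G f
        nlinarith
      · rw [Set.notMem_compl_iff]
        refine ⟨s, R, hs0, hsk, hR0, hRn, ?_, fun x => ?_⟩
        · have h1 := hprod s ⟨hs0, hsk⟩
          rw [hsv, ← hrR, div_le_iff₀ hK0] at h1
          have h2 : r * R ≤ r * (c * (K * φ (r * R))) := by linarith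
          have h3 := le_of_mul_le_mul_left h2 hr0
          rw [hrR] at h3
          have h4 : 0 < K * φ s := by
            by_contra! hneg
            have := mul_nonpos_of_nonneg_of_nonpos hc0.le hneg
            linarith
          have h5 := mul_le_mul_of_nonneg_right hc1 h4.le
          linarith
        · obtain ⟨y, hxy, hy⟩ := hg3 x
          refine aux_hole C hC p q g h.1 n s R hs0 hsR (by linarith) hsd ?_ x y hxy hy
          intro z
          rw [← hG, dist_comm]
          exact lt_of_le_of_lt (BoundedContinuousFunction.dist_coe_le_dist z) hh
    · have := aux_concave (1 / K) ξ hξ_conc hξ_pos _ s hσ0 hσs hsk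
      rw [hsv] at this
      refine le_trans (le_of_eq ?_) this
      rw [hr]
      field_simp
      ring

end Helpers

/-- Let `C` be a closed, bounded, convex, nontrivial subset of a
Banach space, `K > 1` and `φ, ξ : (0,1/K) → (0,∞)` strictly increasing concave
functions with `φ(t)ξ(t) ≥ t/K` on `(0,1/K)` and `ξ(t) → 0` as `t → 0`.  Then there is
a σ-`ξ`-lower porous set `N ⊆ M(C)` such that for every `f ∈ M(C) \ N` the set
`C \ R(f)` is σ-`φ`-upper porous in `C`. -/
theorem stmt_1 {X : Type*} [NormedAddCommGroup X] [NormedSpace ℝ X] [CompleteSpace X]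
    (C : Set X) (hC_closed : IsClosed C) (hC_bdd : Bornology.IsBounded C)
    (hC_conv : Convex ℝ C) (hC_nontriv : C.Nontrivial)
    (K : ℝ) (hK : 1 < K) (φ ξ : ℝ → ℝ)
    (hφ_mono : StrictMonoOn φ (Set.Ioo 0 (1 / K)))
    (hφ_conc : ConcaveOn ℝ (Set.Ioo 0 (1 / K)) φ)
    (hφ_pos : ∀ t ∈ Set.Ioo 0 (1 / K), 0 < φ t)
    (hξ_mono : StrictMonoOn ξ (Set.Ioo 0 (1 / K)))
    (hξ_conc : ConcaveOn ℝ (Set.Ioo 0 (1 / K)) ξ)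
    (hξ_pos : ∀ t ∈ Set.Ioo 0 (1 / K), 0 < ξ t)
    (hprod : ∀ t ∈ Set.Ioo 0 (1 / K), t / K ≤ φ t * ξ t)
    (hξ_lim : Filter.Tendsto ξ (nhdsWithin 0 (Set.Ioi 0)) (nhds 0)) :
    ∃ N : Set (NonexpMap C), IsSigmaPhiLowerPorous ξ N ∧
      ∀ f : NonexpMap C, f ∉ N →
        IsSigmaPhiUpperPorous φ ({x : ↥C | LipPt (⇑(f.1)) x = 1}ᶜ) := by

  obtain ⟨p0, hp0, q0, hq0, hpq0⟩ := hC_nontriv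
  let p : C := ⟨p0, hp0⟩
  let q : C := ⟨q0, hq0⟩
  have hpq : 0 < dist p q := dist_pos.2 (fun h => hpq0 (congrArg Subtype.val h))
  obtain ⟨D, hD'⟩ := Metric.isBounded_iff.1 hC_bdd
  have hD : ∀ x y : C, dist x y ≤ D := fun x y => hD' x.2 y.2
  have hD0 : 0 < D := lt_of_lt_of_le hpq (hD p q)
  have hK0 : 0 < K := by linarith
  have hk : 0 < 1 / K := by positivity
  refine ⟨⋃ n, (auxU C K φ n)ᶜ, ⟨_, rfl, fun n f _ => ?_⟩, fun f hf => ?_⟩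
  · exact aux_main_lower C hC_conv p q hpq D hD0 hD K hK φ ξ hξ_mono hξ_conc hξ_pos hprod hξ_lim n f
  · refine ⟨fun n => auxP f.1 n, auxP_union f.1 f.2, fun n x _ => ?_⟩
    have hfU : ∀ n, f ∈ auxU C K φ n := by
      intro n
      by_contra h
      exact hf (mem_iUnion.2 ⟨n, h⟩)
    refine aux_upper _ x 1 (1 / K) (1 / (32 * K)) (dist p q / 2) φ one_pos hk (by positivity)
      (by positivity) hφ_mono ?_ ?_
    · intro ρ hρ hρ1
      obtain ⟨z, hz⟩ := aux_point C hC_conv p q x ρ hρ hρ1.le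
      exact ⟨z, hz.ge, by rw [hz, one_mul]⟩
    · intro δ hδ
      obtain ⟨m, hm⟩ := exists_nat_one_div_lt (show 0 < δ / 4 by positivity)
      obtain ⟨s, R, hs0, hsk, hR0, hRm, hRφ, hh⟩ := hfU (max n m)
      have hle : 1 / (((max n m : ℕ) : ℝ) + 1) ≤ 1 / ((m : ℝ) + 1) := by
        have : (m : ℝ) ≤ ((max n m : ℕ) : ℝ) := by exact_mod_cast le_max_right n m
        gcongr
      refine ⟨4 * R, by positivity, by linarith, s / 4, ?_, ?_⟩
      · obtain ⟨h1, y, hy⟩ := hh x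
        exact ⟨h1, y, hy.trans (sdiff_subset_sdiff_right (auxP_mono _ (le_max_left n m)))⟩
      · have h1 := aux_concave (1 / K) φ hφ_conc hφ_pos (s / 4) s (by positivity) (by linarith) hsk
        have e : s / 4 / (2 * s) = 1 / 8 := by field_simp; norm_num
        rw [e] at h1
        refine le_trans ?_ h1
        rw [div_mul_eq_mul_div, div_le_iff₀ (by positivity)]
        linarith
end

section
/- Let X be a Banach space, let C ⊆ X be a closed, bounded, convex, non-empty set containing at least two points, and let M = M(C) denote the space of non-expansive mappings C → C equipped with the supremum metric. Let η ∈ (0,1) and let φ : (0,η) → (0,∞) be a strictly increasing concave function with lim_{t→0} φ(t)/t = ∞. Then there is a residual subset G of M such that for every f ∈ G the set C \ R(f), where R(f) := {x ∈ C : Lip(f,x) = 1}, is σ-φ-upper porous. -/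
open Filter Metric Set Topology

section Helpers

variable {X : Type*} [NormedAddCommGroup X] [NormedSpace ℝ X]

lemma seg_dist_eq {C : Set X} (hC : Convex ℝ C) {p w : X} (hp : p ∈ C) (hw : w ∈ C) {t : ℝ}
    (ht0 : 0 ≤ t) (ht : t ≤ ‖w - p‖) (htpos : 0 < ‖w - p‖) :
    p + (t / ‖w - p‖) • (w - p) ∈ C ∧ ‖(t / ‖w - p‖) • (w - p)‖ = t := by
  refine ⟨hC.add_smul_sub_mem hp hw ⟨by positivity, (div_le_one htpos).2 ht⟩, ?_⟩
  rw [norm_smul, Real.norm_of_nonneg (by positivity)]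
  field_simp

/-- radial coefficient -/
noncomputable def thetaFn (δ ρ t : ℝ) : ℝ := if t ≤ ρ then 0 else min 1 ((1 - ρ / t) / (1 - δ))

lemma theta_nonneg_s6 {δ ρ : ℝ} (hδ : δ < 1) (hρ : 0 < ρ) (t : ℝ) : 0 ≤ thetaFn δ ρ t := by
  unfold thetaFn
  split_ifs with h
  · exact le_rfl
  · have ht : 0 < t := by linarith
    have : ρ / t ≤ 1 := (div_le_one ht).2 (by linarith)
    exact le_min zero_le_one (div_nonneg (by linarith) (by linarith))

lemma theta_le_one_s6 {δ ρ : ℝ} (t : ℝ) : thetaFn δ ρ t ≤ 1 := by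
  unfold thetaFn
  split_ifs with h
  · exact zero_le_one
  · exact min_le_left _ _

lemma theta_mono_s6 {δ ρ : ℝ} (hδ : δ < 1) (hρ : 0 < ρ) {t t' : ℝ} (h : t' ≤ t) :
    thetaFn δ ρ t' ≤ thetaFn δ ρ t := by
  by_cases h1 : t' ≤ ρ
  · have : thetaFn δ ρ t' = 0 := by simp [thetaFn, h1]
    rw [this]; exact theta_nonneg_s6 hδ hρ t
  · have h2 : ¬ t ≤ ρ := by intro h2; exact h1 (h.trans h2)
    simp only [thetaFn, h1, h2, if_false]
    have : 0 < 1 - δ := by linarith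
    have : 0 < t' := by linarith
    gcongr

lemma tau_eq {δ ρ : ℝ} (hδ : δ < 1) (hρ : 0 < ρ) {t : ℝ} (ht : 0 ≤ t) :
    thetaFn δ ρ t * t = max 0 (min t ((t - ρ) / (1 - δ))) := by
  have hd : 0 < 1 - δ := by linarith
  by_cases h1 : t ≤ ρ
  · have : (t - ρ) / (1 - δ) ≤ 0 := div_nonpos_of_nonpos_of_nonneg (by linarith) hd.le
    rw [max_eq_left ((min_le_right _ _).trans this)]
    simp [thetaFn, h1]
  · have ht' : 0 < t := by linarith
    have : 0 ≤ (t - ρ) / (1 - δ) := div_nonneg (by linarith) hd.le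
    rw [max_eq_right (le_min ht this)]
    simp only [thetaFn, h1, if_false]
    rw [min_mul_of_nonneg _ _ ht, one_mul]
    congr 1
    field_simp

lemma tau_lip {δ ρ : ℝ} (hδ0 : 0 < δ) (hδ : δ < 1) (hρ : 0 < ρ) {t t' : ℝ} (ht' : 0 ≤ t') (h : t' ≤ t) :
    thetaFn δ ρ t * t - thetaFn δ ρ t' * t' ≤ (t - t') / (1 - δ) := by
  have hd : 0 < 1 - δ := by linarith
  rw [tau_eq hδ hρ ht', tau_eq hδ hρ (ht'.trans h)]
  have e : (t - ρ) / (1 - δ) = (t' - ρ) / (1 - δ) + (t - t') / (1 - δ) := by ring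
  have e2 : t - t' ≤ (t - t') / (1 - δ) := by
    rw [le_div_iff₀ hd]; nlinarith
  have e3 : 0 ≤ t - t' := by linarith
  rw [e]
  set A := (t' - ρ) / (1 - δ)
  set B := (t - t') / (1 - δ)
  rcases max_cases 0 (min t (A + B)) with h1 | h1 <;>
  rcases max_cases 0 (min t' A) with h2 | h2 <;>
  rcases min_cases t (A + B) with h3 | h3 <;>
  rcases min_cases t' A with h4 | h4 <;> linarith

lemma theta_eq_one {δ ρ t : ℝ} (hδ0 : 0 < δ) (hδ : δ < 1) (hρ : 0 < ρ) (ht : ρ / δ ≤ t) :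
    thetaFn δ ρ t = 1 := by
  have h1 : ρ ≤ t * δ := by rwa [div_le_iff₀ hδ0] at ht
  have ht : 0 < t := by
    by_contra hcon
    push Not at hcon
    nlinarith
  have h2 : ¬ t ≤ ρ := by nlinarith
  simp only [thetaFn, h2, if_false]
  apply min_eq_left
  have : ρ / t ≤ δ := by rw [div_le_iff₀ ht]; linarith
  rw [le_div_iff₀ (by linarith)]; linarith

lemma radial_lip_s6 {δ ρ : ℝ} (hδ0 : 0 < δ) (hδ : δ < 1) (hρ : 0 < ρ) (a b : X) :
    ‖thetaFn δ ρ ‖a‖ • a - thetaFn δ ρ ‖b‖ • b‖ ≤ ‖a - b‖ / (1 - δ) := by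
  wlog h : ‖b‖ ≤ ‖a‖ generalizing a b
  · rw [norm_sub_rev, norm_sub_rev a b]
    exact this b a (le_of_not_ge h)
  have hd : 0 < 1 - δ := by linarith
  have e : thetaFn δ ρ ‖a‖ • a - thetaFn δ ρ ‖b‖ • b =
      thetaFn δ ρ ‖a‖ • (a - b) + (thetaFn δ ρ ‖a‖ - thetaFn δ ρ ‖b‖) • b := by
    rw [smul_sub, sub_smul]; abel
  rw [e]
  refine (norm_add_le _ _).trans ?_
  rw [norm_smul, norm_smul, Real.norm_of_nonneg (theta_nonneg_s6 hδ hρ _),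
    Real.norm_of_nonneg (sub_nonneg.2 (theta_mono_s6 hδ hρ h))]
  have h1 := tau_lip hδ0 hδ hρ (norm_nonneg b) h
  have h2 := theta_le_one_s6 (δ := δ) (ρ := ρ) ‖a‖
  have h3 := norm_sub_norm_le a b
  have h4 : thetaFn δ ρ ‖a‖ * (‖a - b‖ - (‖a‖ - ‖b‖)) ≤ ‖a - b‖ - (‖a‖ - ‖b‖) := by
    nlinarith
  have h5 : ‖a - b‖ - (‖a‖ - ‖b‖) ≤ (‖a - b‖ - (‖a‖ - ‖b‖)) / (1 - δ) := by
    rw [le_div_iff₀ hd]; nlinarith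
  have h6 : ‖a - b‖ / (1 - δ) = (‖a - b‖ - (‖a‖ - ‖b‖)) / (1 - δ) + (‖a‖ - ‖b‖) / (1 - δ) := by
    ring
  rw [h6]
  nlinarith

lemma local_bump {C : Set X} (hC : Convex ℝ C) (g0 : X → X) (hg0 : MapsTo g0 C C)
    {δ ρ : ℝ} (hδ0 : 0 < δ) (hδ : δ < 1) (hρ : 0 < ρ)
    (hlip : ∀ x ∈ C, ∀ y ∈ C, ‖g0 x - g0 y‖ ≤ (1 - δ) * ‖x - y‖)
    (hD : ∀ p ∈ C, ∃ w ∈ C, ρ ≤ ‖w - p‖) (y : X) (hy : y ∈ C) :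
    ∃ g : X → X, MapsTo g C C ∧ (∀ x ∈ C, ∀ x' ∈ C, ‖g x - g x'‖ ≤ ‖x - x'‖) ∧
      (∀ x ∈ C, ρ / δ ≤ ‖x - y‖ → g x = g0 x) ∧
      (∀ z, ‖z - y‖ = ρ → ‖g z - g y‖ = ρ) := by
  have hd : 0 < 1 - δ := by linarith
  obtain ⟨w, hw, hwρ⟩ := hD _ (hg0 hy)
  have hwpos : 0 < ‖w - g0 y‖ := by linarith
  set T : X → X := fun x => y + thetaFn δ ρ ‖x - y‖ • (x - y) with hT
  have hTC : ∀ x ∈ C, T x ∈ C := fun x hx =>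
    hC.add_smul_sub_mem hy hx ⟨theta_nonneg_s6 hδ hρ _, theta_le_one_s6 _⟩
  have hTlip : ∀ x x', ‖T x - T x'‖ ≤ ‖x - x'‖ / (1 - δ) := by
    intro x x'
    have := radial_lip_s6 hδ0 hδ hρ (x - y) (x' - y)
    simpa [hT] using this
  have hTy : ∀ x, ρ ≤ ‖x - y‖ → ‖T x - y‖ ≤ (‖x - y‖ - ρ) / (1 - δ) := by
    intro x hx
    have : ‖T x - y‖ = thetaFn δ ρ ‖x - y‖ * ‖x - y‖ := by
      simp only [hT, add_sub_cancel_left]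
      rw [norm_smul, Real.norm_of_nonneg (theta_nonneg_s6 hδ hρ _)]
    rw [this, tau_eq hδ hρ (norm_nonneg _)]
    exact max_le (div_nonneg (by linarith) hd.le) (min_le_right _ _)
  set g : X → X := fun x => if ‖x - y‖ < ρ then
    g0 y + ((ρ - ‖x - y‖) / ‖w - g0 y‖) • (w - g0 y) else g0 (T x) with hg
  have hgin : ∀ x, ‖x - y‖ < ρ →
      g x = g0 y + ((ρ - ‖x - y‖) / ‖w - g0 y‖) • (w - g0 y) := fun x hx => by simp [hg, hx]
  have hgout : ∀ x, ρ ≤ ‖x - y‖ → g x = g0 (T x) := fun x hx => by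
    simp [hg, not_lt.2 hx]
  have hmix : ∀ x ∈ C, ∀ x' ∈ C, ‖x - y‖ < ρ → ρ ≤ ‖x' - y‖ → ‖g x - g x'‖ ≤ ‖x - x'‖ := by
    intro x hx x' hx' h h'
    rw [hgin x h, hgout x' h']
    have h1 := (seg_dist_eq hC (hg0 hy) hw (t := ρ - ‖x - y‖) (by linarith)
      (by linarith [norm_nonneg (x - y)]) hwpos).2
    have h2 := hlip y hy _ (hTC x' hx')
    have h3 := hTy x' h'
    rw [le_div_iff₀ hd] at h3
    have h4 : ‖y - T x'‖ = ‖T x' - y‖ := norm_sub_rev _ _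
    have h5 : ‖x' - y‖ - ‖x - y‖ ≤ ‖x - x'‖ := by
      have := norm_sub_norm_le (x' - y) (x - y)
      rw [norm_sub_rev x x']
      simpa using this
    calc _ = ‖((ρ - ‖x - y‖) / ‖w - g0 y‖) • (w - g0 y) + (g0 y - g0 (T x'))‖ := by
          congr 1; abel
      _ ≤ _ := norm_add_le _ _
      _ ≤ (ρ - ‖x - y‖) + (‖x' - y‖ - ρ) := by rw [h1]; nlinarith
      _ ≤ _ := by linarith
  refine ⟨g, ?_, ?_, ?_, ?_⟩
  · intro x hx
    rcases lt_or_ge ‖x - y‖ ρ with h | h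
    · rw [hgin x h]
      exact (seg_dist_eq hC (hg0 hy) hw (by linarith)
        (by linarith [norm_nonneg (x - y)]) hwpos).1
    · rw [hgout x h]; exact hg0 (hTC x hx)
  · intro x hx x' hx'
    rcases lt_or_ge ‖x - y‖ ρ with h | h <;> rcases lt_or_ge ‖x' - y‖ ρ with h' | h'
    · rw [hgin x h, hgin x' h', add_sub_add_left_eq_sub, ← sub_smul, norm_smul, ← sub_div,
        norm_div, norm_norm, div_mul_cancel₀ _ hwpos.ne']
      have := abs_norm_sub_norm_le (x' - y) (x - y)
      rw [norm_sub_rev x x', Real.norm_eq_abs]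
      have e : ρ - ‖x - y‖ - (ρ - ‖x' - y‖) = ‖x' - y‖ - ‖x - y‖ := by ring
      rw [e]
      simpa using this
    · exact hmix x hx x' hx' h h'
    · rw [norm_sub_rev, norm_sub_rev x]; exact hmix x' hx' x hx h' h
    · rw [hgout x h, hgout x' h']
      refine (hlip _ (hTC x hx) _ (hTC x' hx')).trans ?_
      have := hTlip x x'
      rw [le_div_iff₀ hd] at this
      linarith
  · intro x hx h
    have h1 : ρ ≤ ρ / δ := by rw [le_div_iff₀ hδ0]; nlinarith
    rw [hgout x (h1.trans h)]
    simp only [hT, theta_eq_one hδ0 hδ hρ h]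
    simp
  · intro z hz
    have e1 : T z = y := by simp [hT, thetaFn, hz]
    have h0 : ‖y - y‖ < ρ := by simpa using hρ
    rw [hgout z hz.ge, e1, hgin y h0, sub_add_cancel_left, norm_neg]
    simpa using (seg_dist_eq hC (hg0 hy) hw hρ.le hwρ hwpos).2

lemma exists_sep (C : Set X) {R : ℝ} :
    ∃ S ⊆ C, (∀ a ∈ S, ∀ b ∈ S, a ≠ b → R ≤ ‖a - b‖) ∧ ∀ x ∈ C, ∃ y ∈ S, ‖x - y‖ ≤ max R 0 := by
  obtain ⟨S, hS⟩ := zorn_subset {S : Set X | S ⊆ C ∧ ∀ a ∈ S, ∀ b ∈ S, a ≠ b → R ≤ ‖a - b‖} (by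
    intro c hc hchain
    refine ⟨⋃₀ c, ⟨sUnion_subset fun s hs => (hc hs).1, ?_⟩, fun s hs => subset_sUnion_of_mem hs⟩
    rintro a ⟨s, hs, ha⟩ b ⟨t, ht, hb⟩ hab
    rcases hchain.total hs ht with h | h
    · exact (hc ht).2 a (h ha) b hb hab
    · exact (hc hs).2 a ha b (h hb) hab)
  refine ⟨S, hS.prop.1, hS.prop.2, ?_⟩
  intro x hx
  by_contra hcon
  push Not at hcon
  have hle : ∀ y ∈ S, R ≤ ‖x - y‖ := fun y hy => (le_max_left _ _).trans (hcon y hy).le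
  have hmem : insert x S ∈ {S : Set X | S ⊆ C ∧ ∀ a ∈ S, ∀ b ∈ S, a ≠ b → R ≤ ‖a - b‖} := by
    refine ⟨insert_subset hx hS.prop.1, ?_⟩
    rintro a (rfl | ha) b (rfl | hb) hab
    · exact absurd rfl hab
    · exact hle b hb
    · rw [norm_sub_rev]; exact hle a ha
    · exact hS.prop.2 a ha b hb hab
  have hxS : x ∈ S := hS.le_of_ge hmem (subset_insert _ _) (mem_insert _ _)
  have := hcon x hxS
  simp at this

lemma perturb {C : Set X} (hC : Convex ℝ C) (g0 : X → X) (hg0 : MapsTo g0 C C)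
    {δ ρ : ℝ} (hδ0 : 0 < δ) (hδ : δ < 1) (hρ : 0 < ρ)
    (hlip : ∀ x ∈ C, ∀ y ∈ C, ‖g0 x - g0 y‖ ≤ (1 - δ) * ‖x - y‖)
    (hD' : ∀ p ∈ C, ∃ w ∈ C, ρ / δ ≤ ‖w - p‖) :
    ∃ g : X → X, MapsTo g C C ∧ (∀ x ∈ C, ∀ x' ∈ C, ‖g x - g x'‖ ≤ ‖x - x'‖) ∧
      (∀ x ∈ C, ‖g x - g0 x‖ ≤ 4 * (ρ / δ)) ∧
      (∀ x ∈ C, ∃ y ∈ C, ‖x - y‖ ≤ 2 * (ρ / δ) ∧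
        ∀ z ∈ C, ‖z - y‖ = ρ → ‖g z - g y‖ = ρ) := by
  set R := ρ / δ with hR
  have hRpos : 0 < R := div_pos hρ hδ0
  have hρR : ρ < R := by rw [hR, lt_div_iff₀ hδ0]; nlinarith
  have hD : ∀ p ∈ C, ∃ w ∈ C, ρ ≤ ‖w - p‖ := fun p hp => by
    obtain ⟨w, hw, h⟩ := hD' p hp
    exact ⟨w, hw, hρR.le.trans h⟩
  obtain ⟨S, hSC, hsep, hcov⟩ := exists_sep C (R := 2 * R)
  choose! gl hglC hglip hgout hgz using fun y (hy : y ∈ C) =>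
    local_bump hC g0 hg0 hδ0 hδ hρ hlip hD y hy
  have huniq : ∀ x, ∀ a ∈ S, ∀ b ∈ S, ‖x - a‖ < R → ‖x - b‖ < R → a = b := by
    intro x a ha b hb h1 h2
    by_contra hab
    have := hsep a ha b hb hab
    have h3 : ‖a - b‖ ≤ ‖x - a‖ + ‖x - b‖ := by
      rw [norm_sub_rev x a]; simpa using norm_add_le (a - x) (x - b)
    linarith
  classical
  set g : X → X := fun x => if h : ∃ y ∈ S, ‖x - y‖ < R then gl h.choose x else g0 x with hg
  have hgin : ∀ y ∈ S, ∀ x, ‖x - y‖ < R → g x = gl y x := by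
    intro y hy x hx
    have h : ∃ y ∈ S, ‖x - y‖ < R := ⟨y, hy, hx⟩
    simp only [hg, h, dif_pos]
    rw [huniq x _ h.choose_spec.1 y hy h.choose_spec.2 hx]
  have hgo : ∀ x, (∀ y ∈ S, R ≤ ‖x - y‖) → g x = g0 x := by
    intro x hx
    have h : ¬ ∃ y ∈ S, ‖x - y‖ < R := by push Not; exact hx
    simp only [hg, h, dif_neg, not_false_eq_true]
  have hone : ∀ y ∈ S, ∀ x ∈ C, (∀ y' ∈ S, y' ≠ y → R ≤ ‖x - y'‖) → g x = gl y x := by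
    intro y hy x hx h
    rcases lt_or_ge ‖x - y‖ R with h1 | h1
    · exact hgin y hy x h1
    · rw [hgo x, hgout y (hSC hy) x hx h1]
      intro y' hy'
      by_cases e : y' = y
      · rw [e]; exact h1
      · exact h y' hy' e
  have hnear : ∀ y ∈ S, ∀ x, ‖x - y‖ < R → ∀ y' ∈ S, y' ≠ y → R ≤ ‖x - y'‖ := by
    intro y hy x hx y' hy' hne
    by_contra hcon
    push Not at hcon
    exact hne (huniq x y' hy' y hy hcon hx)
  have hsph : ∀ y ∈ S, ∀ x, ‖x - y‖ ≤ R → ∀ y' ∈ S, y' ≠ y → R ≤ ‖x - y'‖ := by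
    intro y hy x hx y' hy' hne
    have := hsep y hy y' hy' hne.symm
    have h3 : ‖y - y'‖ ≤ ‖x - y‖ + ‖x - y'‖ := by
      rw [norm_sub_rev x y]; simpa using norm_add_le (y - x) (x - y')
    linarith
  refine ⟨g, ?_, ?_, ?_, ?_⟩
  · intro x hx
    by_cases h : ∃ y ∈ S, ‖x - y‖ < R
    · obtain ⟨y, hy, h⟩ := h
      rw [hgin y hy x h]; exact hglC y (hSC hy) hx
    · push Not at h
      rw [hgo x h]; exact hg0 hx
  · intro x hx x' hx'
    by_cases h : ∃ y ∈ S, ‖x - y‖ < R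
    · obtain ⟨y, hy, h⟩ := h
      by_cases h' : ∃ y' ∈ S, y' ≠ y ∧ ‖x' - y'‖ < R
      · obtain ⟨y', hy', hne, h'⟩ := h'
        have hx'y : R ≤ ‖x' - y‖ := hnear y' hy' x' h' y hy hne.symm
        have hcont : ContinuousOn (fun s : ℝ => ‖(x + s • (x' - x)) - y‖) (Icc 0 1) := by fun_prop
        obtain ⟨s, hs, hsR⟩ := intermediate_value_Icc (zero_le_one) hcont
          (show R ∈ _ from ⟨by simpa using h.le, by simpa using hx'y⟩)
        set q := x + s • (x' - x) with hq
        have hqC : q ∈ C := hC.add_smul_sub_mem hx hx' hs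
        have hsR : ‖q - y‖ = R := hsR
        have e1 : g q = gl y q := hone y hy q hqC (hsph y hy q hsR.le)
        have hq0 : g q = g0 q := by rw [e1]; exact hgout y (hSC hy) q hqC hsR.ge
        have e2 : g q = gl y' q := by
          rw [hq0, hgout y' (hSC hy') q hqC (hsph y hy q hsR.le y' hy' hne)]
        have n1 : ‖g x - g q‖ ≤ ‖x - q‖ := by
          rw [hgin y hy x h, e1]; exact hglip y (hSC hy) x hx q hqC
        have n2 : ‖g q - g x'‖ ≤ ‖q - x'‖ := by
          rw [hgin y' hy' x' h', e2]; exact hglip y' (hSC hy') q hqC x' hx'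
        have l1 : ‖x - q‖ = s * ‖x - x'‖ := by
          have : x - q = s • (x - x') := by
            rw [hq, smul_sub, smul_sub]; abel
          rw [this, norm_smul, Real.norm_of_nonneg hs.1]
        have l2 : ‖q - x'‖ = (1 - s) * ‖x - x'‖ := by
          have : q - x' = (1 - s) • (x - x') := by
            rw [hq, smul_sub, smul_sub, sub_smul, sub_smul]; simp only [one_smul]; abel
          rw [this, norm_smul, Real.norm_of_nonneg (by linarith [hs.2])]
        have := norm_add_le (g x - g q) (g q - g x')
        rw [sub_add_sub_cancel] at this
        linarith
      · push Not at h'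
        rw [hgin y hy x h, hone y hy x' hx' h']
        exact hglip y (hSC hy) x hx x' hx'
    · push Not at h
      by_cases h' : ∃ y' ∈ S, ‖x' - y'‖ < R
      · obtain ⟨y', hy', h'⟩ := h'
        rw [hgin y' hy' x' h', hone y' hy' x hx (fun z hz _ => h z hz)]
        exact hglip y' (hSC hy') x hx x' hx'
      · push Not at h'
        rw [hgo x h, hgo x' h']
        refine (hlip x hx x' hx').trans ?_
        nlinarith [norm_nonneg (x - x')]
  · intro x hx
    by_cases h : ∃ y ∈ S, ‖x - y‖ < R
    · obtain ⟨y, hy, h⟩ := h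
      rw [hgin y hy x h]
      have hyC := hSC hy
      obtain ⟨v, hv, hvR⟩ := hD' y hyC
      obtain ⟨hq, hqn⟩ := seg_dist_eq hC hyC hv hRpos.le hvR (by linarith)
      set q := y + (R / ‖v - y‖) • (v - y) with hqd
      have hqy : ‖q - y‖ = R := by rw [hqd, add_sub_cancel_left]; exact hqn
      have a1 := hglip y hyC x hx q hq
      rw [hgout y hyC q hq hqy.ge] at a1
      have a2 := hlip q hq x hx
      have a3 := norm_add_le (gl y x - g0 q) (g0 q - g0 x)
      rw [sub_add_sub_cancel] at a3
      have a4 : ‖x - q‖ ≤ ‖x - y‖ + ‖q - y‖ := by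
        rw [norm_sub_rev q y]; simpa using norm_add_le (x - y) (y - q)
      rw [norm_sub_rev q x] at a2
      nlinarith [norm_nonneg (x - q)]
    · push Not at h
      rw [hgo x h]; simp; positivity
  · intro x hx
    obtain ⟨y, hy, h⟩ := hcov x hx
    rw [max_eq_left (by positivity)] at h
    refine ⟨y, hSC hy, h, ?_⟩
    intro z hz hzy
    rw [hgin y hy z (by linarith), hgin y hy y (by simpa using hRpos)]
    exact hgz y (hSC hy) z hzy

lemma nonexp_perturb {C : Set X} (hC_bdd : Bornology.IsBounded C)
    (hC_conv : Convex ℝ C) {D : ℝ} (hDpos : 0 < D) (hD : ∀ p ∈ C, ∃ w ∈ C, D ≤ ‖w - p‖)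
    (f0 : NonexpMap C) {ε : ℝ} (hε : 0 < ε) :
    ∃ δ : ℝ, 0 < δ ∧ δ < 1 ∧ ∀ ρ : ℝ, 0 < ρ → ρ / δ ≤ D → 4 * (ρ / δ) < ε / 4 →
      ∃ g : NonexpMap C, dist g f0 < ε ∧ ∀ x : C, ∃ y : C, dist x y ≤ 2 * (ρ / δ) ∧
        ∀ z : C, dist z y = ρ → dist (g.1 z) (g.1 y) = ρ := by
  classical
  obtain ⟨B, hB⟩ := Metric.isBounded_iff.1 hC_bdd
  rcases C.eq_empty_or_nonempty with rfl | ⟨c, hc⟩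
  · refine ⟨1 / 2, by norm_num, by norm_num, fun ρ _ _ _ => ⟨f0, by simpa using hε, fun x => ?_⟩⟩
    exact x.2.elim
  have hB0 : 0 ≤ B := by simpa using hB hc hc
  refine ⟨min (1 / 2) (ε / (4 * (B + 1))), by positivity, (min_le_left _ _).trans_lt (by norm_num), ?_⟩
  set δ := min (1 / 2) (ε / (4 * (B + 1))) with hδd
  have hδ0 : 0 < δ := by positivity
  have hδ1 : δ < 1 := (min_le_left _ _).trans_lt (by norm_num)
  have hδB : δ * B ≤ ε / 4 := by
    have h1 : δ ≤ ε / (4 * (B + 1)) := min_le_right _ _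
    rw [le_div_iff₀ (by positivity)] at h1
    nlinarith
  intro ρ hρ hρD hρε
  set F : X → X := fun x => if h : x ∈ C then (f0.1 ⟨x, h⟩ : X) else c with hF
  have hFx : ∀ x : C, F x = f0.1 x := fun x => by simp [hF]
  have hFC : ∀ x ∈ C, F x ∈ C := fun x hx => by
    rw [hFx ⟨x, hx⟩]; exact (f0.1 ⟨x, hx⟩).2
  have hFl : ∀ x ∈ C, ∀ y ∈ C, ‖F x - F y‖ ≤ ‖x - y‖ := fun x hx y hy => by
    have := f0.2.dist_le_mul ⟨x, hx⟩ ⟨y, hy⟩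
    rw [hFx ⟨x, hx⟩, hFx ⟨y, hy⟩, ← dist_eq_norm, ← dist_eq_norm]
    simpa [Subtype.dist_eq] using this
  obtain ⟨g, hgC, hgl, hgclose, hgy⟩ := perturb hC_conv (fun x => F x + δ • (c - F x))
    (fun x hx => hC_conv.add_smul_sub_mem (hFC x hx) hc ⟨hδ0.le, hδ1.le⟩) hδ0 hδ1 hρ
    (by
      intro x hx y hy
      have e : F x + δ • (c - F x) - (F y + δ • (c - F y)) = (1 - δ) • (F x - F y) := by
        rw [smul_sub, smul_sub, sub_smul, one_smul, smul_sub]; abel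
      rw [e, norm_smul, Real.norm_of_nonneg (by linarith)]
      exact mul_le_mul_of_nonneg_left (hFl x hx y hy) (by linarith))
    (fun p hp => by
      obtain ⟨w, hw, h⟩ := hD p hp
      exact ⟨w, hw, hρD.trans h⟩)
  let g1 : C → C := fun x => ⟨g x, hgC x.2⟩
  have hg1 : LipschitzWith 1 g1 := LipschitzWith.mk_one fun x y => by
    rw [Subtype.dist_eq, Subtype.dist_eq, dist_eq_norm, dist_eq_norm]
    exact hgl x x.2 y y.2
  let g2 : BoundedContinuousFunction C C := BoundedContinuousFunction.mkOfBound ⟨g1, hg1.continuous⟩ B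
    (fun x y => hB (g1 x).2 (g1 y).2)
  refine ⟨⟨g2, hg1⟩, ?_, ?_⟩
  · have : dist g2 f0.1 ≤ ε / 2 := by
      rw [BoundedContinuousFunction.dist_le (by positivity)]
      intro x
      have h1 := hgclose x x.2
      have h2 : ‖δ • (c - F x)‖ ≤ ε / 4 := by
        rw [norm_smul, Real.norm_of_nonneg hδ0.le, ← dist_eq_norm]
        exact (mul_le_mul_of_nonneg_left (hB hc (hFC x x.2)) hδ0.le).trans hδB
      have h3 := norm_add_le (g x - (F x + δ • (c - F x))) (δ • (c - F x))
      have e : g x - (F x + δ • (c - F x)) + δ • (c - F x) = g x - F x := by abel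
      rw [e] at h3
      change dist (g x) (f0.1 x : X) ≤ _
      rw [← hFx, dist_eq_norm]
      linarith
    exact lt_of_le_of_lt this (by linarith)
  · intro x
    obtain ⟨y, hy, hxy, hz⟩ := hgy x x.2
    refine ⟨⟨y, hy⟩, by simpa [Subtype.dist_eq, dist_eq_norm] using hxy, fun z hzy => ?_⟩
    have := hz z z.2 (by simpa [Subtype.dist_eq, dist_eq_norm] using hzy)
    change dist (g z) (g y) = ρ
    rwa [dist_eq_norm]

/-- the good sets -/
def goodSet (C : Set X) (η : ℝ) (φ : ℝ → ℝ) (n : ℕ) : Set (NonexpMap C) :=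
  {f | ∃ s r : ℝ, 0 < s ∧ s < η ∧ 0 < r ∧ r < 1 / ((n : ℝ) + 1) ∧ r ≤ φ s ∧
    ∀ x : C, ∃ y : C, ball y s ⊆ ball x r ∧ ∀ z ∈ ball y s, ∃ z' : C, 0 < dist z' z ∧
      dist z' z ≤ 1 / ((n : ℝ) + 1) ∧
      (1 - 1 / ((n : ℝ) + 1)) * dist z' z < dist (f.1 z') (f.1 z)}

lemma good_dense {C : Set X} (hC_bdd : Bornology.IsBounded C)
    (hC_conv : Convex ℝ C) {D : ℝ} (hDpos : 0 < D) (hD : ∀ p ∈ C, ∃ w ∈ C, D ≤ ‖w - p‖)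
    {η : ℝ} (hη : 0 < η) {φ : ℝ → ℝ}
    (hφ_lim : Filter.Tendsto (fun t => φ t / t) (nhdsWithin 0 (Set.Ioi 0)) Filter.atTop) (n : ℕ)
    (f0 : NonexpMap C) {ε : ℝ} (hε : 0 < ε) :
    ∃ g : NonexpMap C, dist g f0 < ε ∧ ∃ s > 0, ball g s ⊆ goodSet C η φ n := by
  obtain ⟨δ, hδ0, hδ1, H⟩ := nonexp_perturb hC_bdd hC_conv hDpos hD f0 hε
  set N : ℝ := (n : ℝ) + 1 with hN
  have hN1 : 1 ≤ N := by simp [hN]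
  set c : ℝ := min η (δ / (15 * N) * min (1 / N) (min D (ε / 16))) with hc
  have hc0 : 0 < c := by positivity
  obtain ⟨s, hs1, hs0, hsc⟩ := ((hφ_lim.eventually_ge_atTop (15 * N / δ)).and
    (Ioo_mem_nhdsGT hc0)).exists
  have hsη : s < η := hsc.trans_le (min_le_left _ _)
  set ρ := 5 * N * s with hρd
  set R := ρ / δ with hRd
  have hρ : 0 < ρ := by positivity
  have hR : 0 < R := by positivity
  have hρR : ρ ≤ R := by rw [hRd, le_div_iff₀ hδ0]; nlinarith
  have hsρ : 5 * s ≤ ρ := by rw [hρd]; nlinarith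
  have h3R : 3 * R < min (1 / N) (min D (ε / 16)) := by
    have : s < δ / (15 * N) * min (1 / N) (min D (ε / 16)) := hsc.trans_le (min_le_right _ _)
    have e : 3 * R = s / (δ / (15 * N)) := by rw [hRd, hρd]; field_simp; ring
    rw [e, div_lt_iff₀ (by positivity)]; linarith
  have a1 : 3 * R < 1 / N := h3R.trans_le (min_le_left _ _)
  have a2 : 3 * R < D := h3R.trans_le ((min_le_right _ _).trans (min_le_left _ _))
  have a3 : 3 * R < ε / 16 := h3R.trans_le ((min_le_right _ _).trans (min_le_right _ _))
  have hφs : 3 * R ≤ φ s := by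
    rw [le_div_iff₀ hs0] at hs1
    have e : 3 * R = 15 * N / δ * s := by rw [hRd, hρd]; ring
    rw [e]; exact hs1
  obtain ⟨g, hgf, hg⟩ := H ρ hρ (by linarith) (by linarith)
  refine ⟨g, hgf, s, hs0, ?_⟩
  intro f hf
  have hfg : ∀ x, dist (f.1 x) (g.1 x) < s := fun x =>
    (BoundedContinuousFunction.dist_coe_le_dist (f := f.1) (g := g.1) x).trans_lt hf
  refine ⟨s, 3 * R, hs0, hsη, by positivity, a1, hφs, fun x => ?_⟩
  obtain ⟨y, hxy, hy⟩ := hg x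
  refine ⟨y, ?_, ?_⟩
  · apply ball_subset_ball'
    rw [dist_comm]; linarith
  · intro z hz
    have hz : dist z y < s := hz
    obtain ⟨w, hw, hwD⟩ := hD y y.2
    obtain ⟨hq, hqn⟩ := seg_dist_eq hC_conv y.2 hw hρ.le (by linarith) (by linarith)
    obtain ⟨z', hz'⟩ : ∃ z' : C, dist z' y = ρ := ⟨⟨_, hq⟩, by
      rw [Subtype.dist_eq, dist_eq_norm]; simpa using hqn⟩
    have b1 := hy z' hz'
    have b2 := hfg z'
    have b3 := hfg y
    have b4 : dist (f.1 z) (f.1 y) < s := lt_of_le_of_lt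
      (by simpa using f.2.dist_le_mul z y) hz
    have b5 : dist z' z ≤ ρ + s := by
      have := dist_triangle z' y z
      rw [dist_comm y z] at this; linarith
    have b6 : ρ - s ≤ dist z' z := by
      have := dist_triangle z' z y
      linarith
    have b7 : ρ - 3 * s < dist (f.1 z') (f.1 z) := by
      have t1 := dist_triangle (g.1 z') (f.1 z') (g.1 y)
      have t2 := dist_triangle (f.1 z') (f.1 z) (g.1 y)
      have t3 := dist_triangle (f.1 z) (f.1 y) (g.1 y)
      rw [dist_comm (g.1 z') (f.1 z')] at t1
      linarith
    have hNs : ρ / N = 5 * s := by rw [hρd]; field_simp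
    refine ⟨z', by linarith, by linarith, lt_of_le_of_lt ?_ b7⟩
    have hN0 : 0 ≤ 1 - 1 / N := by
      rw [sub_nonneg, div_le_one (by linarith)]; exact hN1
    have hN2 : 0 < 1 / N := by positivity
    calc (1 - 1 / N) * dist z' z ≤ (1 - 1 / N) * (ρ + s) := by gcongr
      _ = ρ + s - ρ / N - 1 / N * s := by ring
      _ ≤ ρ - 3 * s := by rw [hNs]; nlinarith

/-- the pieces of the exceptional set -/
def excSet {C : Set X} (f : C → C) (m : ℕ) : Set C :=
  {x | ∀ y : C, 0 < dist y x → dist y x ≤ 1 / ((m : ℝ) + 1) →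
    dist (f y) (f x) ≤ (1 - 1 / ((m : ℝ) + 1)) * dist y x}

lemma compl_eq {C : Set X} (f : C → C) (hf : LipschitzWith 1 f) :
    {x : C | LipPt f x = 1}ᶜ = ⋃ m, excSet f m := by
  have hnn : ∀ x r, 0 ≤ LipScale f x r := fun x r => Real.sSup_nonneg (by
    rintro _ ⟨y, -, rfl⟩; positivity)
  have hq : ∀ x y : C, 0 < dist y x → dist (f y) (f x) / dist y x ≤ 1 := fun x y h => by
    rw [div_le_one h]; simpa using hf.dist_le_mul y x
  have hbdd : ∀ x : C, BddBelow ((fun r : ℝ => LipScale f x r) '' Set.Ioi 0) := fun x =>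
    ⟨0, by rintro _ ⟨r, -, rfl⟩; exact hnn x r⟩
  ext x
  simp only [mem_compl_iff, mem_setOf_eq, mem_iUnion]
  constructor
  · intro h
    have hle : LipPt f x ≤ 1 := by
      refine (csInf_le (hbdd x) ⟨1, by simp, rfl⟩).trans ?_
      refine Real.sSup_le ?_ zero_le_one
      rintro _ ⟨y, hy, rfl⟩
      exact hq x y hy.1
    have hlt : LipPt f x < 1 := lt_of_le_of_ne hle h
    obtain ⟨_, ⟨r, hr, rfl⟩, hrl⟩ := exists_lt_of_csInf_lt
      ((nonempty_Ioi (a := (0 : ℝ))).image (fun r : ℝ => LipScale f x r)) hlt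
    have hr : 0 < r := hr
    simp only at hrl
    obtain ⟨m, hm⟩ := exists_nat_one_div_lt (show 0 < min r (1 - LipScale f x r) from
      lt_min hr (by linarith))
    refine ⟨m, fun y hy0 hy => ?_⟩
    have h1 := hm.trans_le (min_le_left _ _)
    have h2 := hm.trans_le (min_le_right _ _)
    have h3 : dist (f y) (f x) / dist y x ≤ LipScale f x r := by
      refine le_csSup ⟨1, ?_⟩ ⟨y, ⟨hy0, by linarith⟩, rfl⟩
      rintro _ ⟨y, hy, rfl⟩
      exact hq x y hy.1
    rw [div_le_iff₀ hy0] at h3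
    refine h3.trans ?_
    gcongr
    linarith
  · rintro ⟨m, hm⟩ h
    have hm0 : (0 : ℝ) < 1 / ((m : ℝ) + 1) := by positivity
    have hm1 : 1 / ((m : ℝ) + 1) ≤ 1 := by
      rw [div_le_one (by positivity)]; simp
    have : LipPt f x ≤ 1 - 1 / ((m : ℝ) + 1) := by
      refine (csInf_le (hbdd x) ⟨1 / ((m : ℝ) + 1), hm0, rfl⟩).trans ?_
      refine Real.sSup_le ?_ (by linarith)
      rintro _ ⟨y, hy, rfl⟩
      simp only
      rw [div_le_iff₀ hy.1]
      exact hm y hy.1 hy.2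
    linarith

lemma exc_porous {C : Set X} (hC_conv : Convex ℝ C) {D : ℝ} (hDpos : 0 < D)
    (hD : ∀ p ∈ C, ∃ w ∈ C, D ≤ ‖w - p‖)
    {η : ℝ} (hη : 0 < η) {φ : ℝ → ℝ} (hφ_mono : StrictMonoOn φ (Set.Ioo 0 η))
    (f : NonexpMap C) (hf : ∀ n, f ∈ goodSet C η φ n) (m : ℕ) :
    IsPhiUpperPorous φ (excSet (⇑f.1) m) := by
  intro x _
  have key : ∀ e > 0, ∃ s r : ℝ, 0 < s ∧ s < η ∧ 0 < r ∧ r < e ∧ r ≤ φ s ∧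
      s ∈ porHoles (excSet (⇑f.1) m) x r := by
    intro e he
    obtain ⟨k, hk⟩ := exists_nat_one_div_lt he
    set n := max k m
    have hnk : 1 / ((n : ℝ) + 1) ≤ 1 / ((k : ℝ) + 1) :=
      one_div_le_one_div_of_le (by positivity) (by simp [n])
    have hnm : 1 / ((n : ℝ) + 1) ≤ 1 / ((m : ℝ) + 1) :=
      one_div_le_one_div_of_le (by positivity) (by simp [n])
    obtain ⟨s, r, hs, hsη, hr, hrn, hrφ, H⟩ := hf n
    refine ⟨s, r, hs, hsη, hr, by linarith, hrφ, hs, ?_⟩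
    obtain ⟨y, hy, hz⟩ := H x
    refine ⟨y, fun z hzy => ⟨hy hzy, fun hzm => ?_⟩⟩
    obtain ⟨z', h0, h1, h2⟩ := hz z hzy
    have h3 := hzm z' h0 (h1.trans hnm)
    have : (1 - 1 / ((m : ℝ) + 1)) * dist z' z ≤ (1 - 1 / ((n : ℝ) + 1)) * dist z' z := by
      gcongr
    linarith
  refine ⟨fun r hr => ?_, ?_⟩
  · obtain ⟨s, r', -, -, -, hr', -, h0, y, hy⟩ := key r hr
    exact ⟨s, h0, y, hy.trans (sdiff_subset_sdiff_left (ball_subset_ball hr'.le))⟩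
  · have hfreq : ∃ᶠ r in 𝓝[>] (0 : ℝ), (1 : EReal) ≤
        ((φ (porGamma (excSet (⇑f.1) m) x r) / r : ℝ) : EReal) := by
      rw [Filter.frequently_iff]
      intro U hU
      obtain ⟨u, hu0, hu⟩ := mem_nhdsGT_iff_exists_Ioo_subset.1 hU
      have hu0 : 0 < u := hu0
      obtain ⟨s, r, hs, hsη, hr, hre, hrφ, hhole⟩ := key (min u (min D (η / 4))) (by positivity)
      have r1 : r < u := hre.trans_le (min_le_left _ _)
      have r2 : r < D := hre.trans_le ((min_le_right _ _).trans (min_le_left _ _))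
      have r3 : r < η / 4 := hre.trans_le ((min_le_right _ _).trans (min_le_right _ _))
      refine ⟨r, hu ⟨hr, r1⟩, ?_⟩
      have hub : ∀ t ∈ porHoles (excSet (⇑f.1) m) x r, t ≤ 2 * r := by
        rintro t ⟨ht0, y, hy⟩
        by_contra hcon
        push Not at hcon
        obtain ⟨w, hw, hwD⟩ := hD x x.2
        obtain ⟨hq, hqn⟩ := seg_dist_eq hC_conv x.2 hw hr.le (by linarith) (by linarith)
        obtain ⟨z', hz'⟩ : ∃ z' : C, dist z' x = r := ⟨⟨_, hq⟩, by
          rw [Subtype.dist_eq, dist_eq_norm]; simpa using hqn⟩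
        have hyx : dist y x < r := (hy (mem_ball_self ht0)).1
        have hz'y : z' ∈ ball y t := by
          rw [mem_ball]
          have := dist_triangle z' x y
          rw [dist_comm x y] at this
          linarith
        have : dist z' x < r := (hy hz'y).1
        linarith
      have hle : s ≤ porGamma (excSet (⇑f.1) m) x r := le_csSup ⟨2 * r, hub⟩ hhole
      have hge : porGamma (excSet (⇑f.1) m) x r ≤ 2 * r := csSup_le ⟨s, hhole⟩ hub
      have hφ := hφ_mono.monotoneOn ⟨hs, hsη⟩ ⟨hs.trans_le hle, by linarith⟩ hle
      have : (1 : ℝ) ≤ φ (porGamma (excSet (⇑f.1) m) x r) / r := by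
        rw [le_div_iff₀ hr]; linarith
      exact_mod_cast this
    exact lt_of_lt_of_le zero_lt_one (Filter.le_limsup_of_frequently_le hfreq)

end Helpers

/-- Let `C` be a closed, bounded, convex, nontrivial subset of a
Banach space, `η ∈ (0,1)` and `φ : (0,η) → (0,∞)` strictly increasing, concave, with
`φ(t)/t → ∞` as `t → 0`.  Then there is a residual subset `G` of `M(C)` such that for
every `f ∈ G` the set `C \ R(f)` is σ-`φ`-upper porous in `C`. -/
theorem stmt_6 {X : Type*} [NormedAddCommGroup X] [NormedSpace ℝ X] [CompleteSpace X]
    (C : Set X) (hC_closed : IsClosed C) (hC_bdd : Bornology.IsBounded C)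
    (hC_conv : Convex ℝ C) (hC_nontriv : C.Nontrivial)
    (η : ℝ) (hη : η ∈ Set.Ioo (0 : ℝ) 1) (φ : ℝ → ℝ)
    (hφ_mono : StrictMonoOn φ (Set.Ioo 0 η))
    (hφ_conc : ConcaveOn ℝ (Set.Ioo 0 η) φ)
    (hφ_pos : ∀ t ∈ Set.Ioo 0 η, 0 < φ t)
    (hφ_lim : Filter.Tendsto (fun t => φ t / t) (nhdsWithin 0 (Set.Ioi 0)) Filter.atTop) :
    ∃ G : Set (NonexpMap C), G ∈ residual (NonexpMap C) ∧
      ∀ f ∈ G, IsSigmaPhiUpperPorous φ ({x : ↥C | LipPt (⇑(f.1)) x = 1}ᶜ) := by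
  obtain ⟨a, ha, b, hb, hab⟩ := hC_nontriv
  have hab' : 0 < ‖a - b‖ := norm_pos_iff.2 (sub_ne_zero.2 hab)
  have hD : ∀ p ∈ C, ∃ w ∈ C, ‖a - b‖ / 2 ≤ ‖w - p‖ := by
    intro p _
    by_contra hcon
    push Not at hcon
    have h1 := hcon a ha
    have h2 := hcon b hb
    have h3 := norm_sub_le (a - p) (b - p)
    rw [sub_sub_sub_cancel_right] at h3
    linarith
  refine ⟨⋂ n, goodSet C η φ n, ?_, ?_⟩
  · rw [countable_iInter_mem]
    intro n
    refine mem_of_superset (residual_of_dense_open isOpen_interior ?_) interior_subset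
    rw [Metric.dense_iff]
    intro f0 ε hε
    obtain ⟨g, hg, s, hs, hsub⟩ := good_dense hC_bdd hC_conv (half_pos hab') hD hη.1 hφ_lim n f0 hε
    exact ⟨g, hg, mem_interior.2 ⟨_, hsub, isOpen_ball, mem_ball_self hs⟩⟩
  · intro f hf
    exact ⟨fun m => excSet (⇑f.1) m, compl_eq _ f.2,
      exc_porous hC_conv (half_pos hab') hD hη.1 hφ_mono f (fun n => mem_iInter.1 hf n)⟩
end

section
/- Let X be a normed space, let C ⊆ X be a bounded convex set, and let M = M(C) denote the space of non-expansive mappings C → C equipped with the supremum metric. Let λ ∈ (0,1), k ∈ ℕ, K > 1, and let φ, ξ : (0,1/K) → (0,∞) be strictly increasing concave functions satisfying φ(t)·ξ(t) ≥ t/K for all t ∈ (0,1/K) and lim_{t→0} φ(t) = lim_{t→0} ξ(t) = 0. Let (s_j)_{j∈ℕ} be a strictly decreasing sequence in (0,1) ∩ (0, sup φ) ∩ (0, diam C / 2) converging to 0 and satisfying φ^{-1}(s_j)/s_j = 2·φ^{-1}(s_{j+1})/s_{j+1} for all j ∈ ℕ. Let (Γ_j)_{j∈ℕ} be a sequence of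 subsets of C such that each Γ_j is s_j-separated and contains at least two points. Let P denote the set of mappings f ∈ M with the property that for every j ≥ k there exist x ∈ Γ_j and y ∈ C with ‖y−x‖ < (1−λ)·φ^{-1}(s_j)/(48·(1+diam C)) such that Lip(f, y, φ^{-1}(s_j)) ≤ λ. Then P is ξ-lower porous at every point of M (in particular, P is a ξ-lower porous subset of M). -/
open Filter Metric Set Topology

lemma pw_core {X : Type*} [NormedAddCommGroup X] [NormedSpace ℝ X] (y z : X) (η R τ : ℝ)
    (hη : 0 < η) (hτ : 0 < τ) (hτR : τ = η * (R - τ))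
    (hz : τ ≤ ‖z‖) (hzy : ‖z‖ ≤ ‖y‖) :
    ‖(1 + η - η * R / ‖y‖) • y - (1 + η - η * R / ‖z‖) • z‖ ≤ (1 + η) * ‖y - z‖ := by
  have hZ : 0 < ‖z‖ := by linarith
  have hY : 0 < ‖y‖ := by linarith
  have hR : η * R = (1 + η) * τ := by linarith
  have e : (1 + η - η * R / ‖y‖) • y - (1 + η - η * R / ‖z‖) • z
      = (1 + η - η * R / ‖y‖) • (y - z) + (η * R / ‖z‖ - η * R / ‖y‖) • z := by
    module
  have hRp : 0 ≤ η * R := by rw [hR]; positivity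
  have h1 : 0 ≤ 1 + η - η * R / ‖y‖ := by
    rw [sub_nonneg, div_le_iff₀ hY, hR]
    exact mul_le_mul_of_nonneg_left (by linarith) (by linarith)
  have h2 : 0 ≤ η * R / ‖z‖ - η * R / ‖y‖ := by
    rw [sub_nonneg]
    exact div_le_div_of_nonneg_left hRp hZ hzy
  rw [e]
  refine (norm_add_le _ _).trans ?_
  rw [norm_smul, norm_smul, Real.norm_of_nonneg h1, Real.norm_of_nonneg h2]
  have h3 : ‖y‖ - ‖z‖ ≤ ‖y - z‖ := norm_sub_norm_le y z
  have h4 : 0 ≤ η * R / ‖y‖ := by positivity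
  have h5 : η * R / ‖y‖ * ‖y‖ = η * R := by field_simp
  have h6 : η * R / ‖z‖ * ‖z‖ = η * R := by field_simp
  nlinarith [mul_le_mul_of_nonneg_left h3 h4]

open Classical in
/-- local modification of `G` near `x`. -/
noncomputable def locA {X : Type*} [NormedAddCommGroup X] [NormedSpace ℝ X] (G : X → X)
    (η R τ : ℝ) (v : X → X) (x y : X) : X :=
  if ‖y - x‖ < τ then G x + (τ - ‖y - x‖) • v x
  else G (x + (1 + η - η * R / ‖y - x‖) • (y - x))

section
variable {X : Type*} [NormedAddCommGroup X] [NormedSpace ℝ X] {C : Set X} {G v : X → X}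
  {η R τ : ℝ}

lemma pi_mem (hC : Convex ℝ C) (hη : 0 < η) (hτ : 0 < τ) (hτR : τ = η * (R - τ))
    {x y : X} (hx : x ∈ C) (hy : y ∈ C) (h1 : τ ≤ ‖y - x‖) (h2 : ‖y - x‖ ≤ R) :
    x + (1 + η - η * R / ‖y - x‖) • (y - x) ∈ C := by
  have hY : 0 < ‖y - x‖ := by linarith
  have hR : η * R = (1 + η) * τ := by linarith
  apply hC.add_smul_sub_mem hx hy
  constructor
  · rw [sub_nonneg, div_le_iff₀ hY, hR]
    exact mul_le_mul_of_nonneg_left (by linarith) (by linarith)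
  · have : η ≤ η * R / ‖y - x‖ := by
      rw [le_div_iff₀ hY]
      exact mul_le_mul_of_nonneg_left (by linarith) (by linarith)
    linarith

lemma locA_mem (hC : Convex ℝ C) (hG : ∀ y ∈ C, G y ∈ C) (hη : 0 < η) (hτ : 0 < τ)
    (hτR : τ = η * (R - τ))
    (hv : ∀ x ∈ C, ‖v x‖ = 1 ∧ ∀ t ∈ Set.Icc 0 τ, G x + t • v x ∈ C)
    {x y : X} (hx : x ∈ C) (hy : y ∈ C) (h2 : ‖y - x‖ ≤ R) :
    locA G η R τ v x y ∈ C := by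
  unfold locA
  split_ifs with h
  · exact (hv x hx).2 _ ⟨by linarith, by linarith [norm_nonneg (y - x)]⟩
  · exact hG _ (pi_mem hC hη hτ hτR hx hy (by linarith) h2)

lemma locA_near (hC : Convex ℝ C) (hη : 0 < η) (hη1 : η ≤ 1) (hτ : 0 < τ)
    (hGL : ∀ y ∈ C, ∀ z ∈ C, ‖G y - G z‖ ≤ (1 - η) * ‖y - z‖)
    (hτR : τ = η * (R - τ))
    (hv : ∀ x ∈ C, ‖v x‖ = 1 ∧ ∀ t ∈ Set.Icc 0 τ, G x + t • v x ∈ C)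
    {x y : X} (hx : x ∈ C) (hy : y ∈ C) (h2 : ‖y - x‖ ≤ R) :
    ‖locA G η R τ v x y - G y‖ ≤ η * (R - ‖y - x‖) := by
  unfold locA
  split_ifs with h
  · have e : G x + (τ - ‖y - x‖) • v x - G y = (τ - ‖y - x‖) • v x + (G x - G y) := by abel
    rw [e]
    refine (norm_add_le _ _).trans ?_
    rw [norm_smul, (hv x hx).1, Real.norm_of_nonneg (by linarith)]
    have := hGL x hx y hy
    rw [norm_sub_rev x y] at this
    nlinarith [norm_nonneg (y - x)]
  · push Not at h
    have hY : 0 < ‖y - x‖ := by linarith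
    refine (hGL _ (pi_mem hC hη hτ hτR hx hy h h2) y hy).trans ?_
    have e : x + (1 + η - η * R / ‖y - x‖) • (y - x) - y
        = (-(η * R / ‖y - x‖ - η)) • (y - x) := by module
    have hn : 0 ≤ η * R / ‖y - x‖ - η := by
      rw [sub_nonneg, le_div_iff₀ hY]
      exact mul_le_mul_of_nonneg_left (by linarith) (by linarith)
    rw [e, norm_smul, norm_neg, Real.norm_of_nonneg hn]
    have h5 : (η * R / ‖y - x‖ - η) * ‖y - x‖ = η * (R - ‖y - x‖) := by field_simp
    rw [h5]
    have : 0 ≤ η * (R - ‖y - x‖) := mul_nonneg hη.le (by linarith)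
    nlinarith

lemma locA_lip_aux (hC : Convex ℝ C) (hη : 0 < η) (hη1 : η ≤ 1) (hτ : 0 < τ)
    (hGL : ∀ y ∈ C, ∀ z ∈ C, ‖G y - G z‖ ≤ (1 - η) * ‖y - z‖)
    (hτR : τ = η * (R - τ))
    (hv : ∀ x ∈ C, ‖v x‖ = 1 ∧ ∀ t ∈ Set.Icc 0 τ, G x + t • v x ∈ C)
    {x y z : X} (hx : x ∈ C) (hy : y ∈ C) (hz : z ∈ C) (h2 : ‖y - x‖ ≤ R)
    (hzy : ‖z - x‖ ≤ ‖y - x‖) :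
    ‖locA G η R τ v x y - locA G η R τ v x z‖ ≤ ‖y - z‖ := by
  have htri : ‖y - x‖ - ‖z - x‖ ≤ ‖y - z‖ := by
    have := norm_sub_norm_le (y - x) (z - x)
    simpa using this
  have hR : η * R = (1 + η) * τ := by linarith
  unfold locA
  split_ifs with h h' h'
  · have e : G x + (τ - ‖y - x‖) • v x - (G x + (τ - ‖z - x‖) • v x)
        = (-(‖y - x‖ - ‖z - x‖)) • v x := by module
    rw [e, norm_smul, norm_neg, (hv x hx).1, Real.norm_of_nonneg (by linarith)]
    linarith
  · linarith
  · push Not at h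
    have hY : 0 < ‖y - x‖ := by linarith
    set p := x + (1 + η - η * R / ‖y - x‖) • (y - x) with hp
    have e : G p - (G x + (τ - ‖z - x‖) • v x)
        = (G p - G x) - (τ - ‖z - x‖) • v x := by abel
    rw [e]
    refine (norm_sub_le _ _).trans ?_
    rw [norm_smul, (hv x hx).1, Real.norm_of_nonneg (by linarith)]
    have h1 := hGL p (pi_mem hC hη hτ hτR hx hy h h2) x hx
    have hn : 0 ≤ 1 + η - η * R / ‖y - x‖ := by
      rw [sub_nonneg, div_le_iff₀ hY, hR]
      exact mul_le_mul_of_nonneg_left (by linarith) (by linarith)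
    have e2 : p - x = (1 + η - η * R / ‖y - x‖) • (y - x) := by rw [hp]; abel
    rw [e2, norm_smul, Real.norm_of_nonneg hn] at h1
    have h5 : (1 + η - η * R / ‖y - x‖) * ‖y - x‖ = (1 + η) * (‖y - x‖ - τ) := by
      have : (1 + η - η * R / ‖y - x‖) * ‖y - x‖ = (1 + η) * ‖y - x‖ - η * R := by field_simp
      rw [this, hR]; ring
    rw [h5] at h1
    have : (1 - η) * ((1 + η) * (‖y - x‖ - τ)) ≤ ‖y - x‖ - τ := by
      have : 0 ≤ η ^ 2 * (‖y - x‖ - τ) := mul_nonneg (by positivity) (by linarith)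
      nlinarith
    linarith
  · push Not at h h'
    refine (hGL _ (pi_mem hC hη hτ hτR hx hy h h2) _
      (pi_mem hC hη hτ hτR hx hz h' (by linarith))).trans ?_
    have := pw_core (y - x) (z - x) η R τ hη hτ hτR h' hzy
    rw [sub_sub_sub_cancel_right] at this
    rw [add_sub_add_left_eq_sub]
    have h1 : 0 ≤ η ^ 2 * ‖y - z‖ := by positivity
    have h2 := mul_le_mul_of_nonneg_left this (sub_nonneg.2 hη1)
    nlinarith

lemma locA_lip (hC : Convex ℝ C) (hη : 0 < η) (hη1 : η ≤ 1) (hτ : 0 < τ)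
    (hGL : ∀ y ∈ C, ∀ z ∈ C, ‖G y - G z‖ ≤ (1 - η) * ‖y - z‖)
    (hτR : τ = η * (R - τ))
    (hv : ∀ x ∈ C, ‖v x‖ = 1 ∧ ∀ t ∈ Set.Icc 0 τ, G x + t • v x ∈ C)
    {x y z : X} (hx : x ∈ C) (hy : y ∈ C) (hz : z ∈ C) (h2 : ‖y - x‖ ≤ R)
    (h3 : ‖z - x‖ ≤ R) :
    ‖locA G η R τ v x y - locA G η R τ v x z‖ ≤ ‖y - z‖ := by
  rcases le_total ‖z - x‖ ‖y - x‖ with h | h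
  · exact locA_lip_aux hC hη hη1 hτ hGL hτR hv hx hy hz h2 h
  · rw [norm_sub_rev, norm_sub_rev y z]
    exact locA_lip_aux hC hη hη1 hτ hGL hτR hv hx hz hy h3 h

lemma perturb_s14 (hC : Convex ℝ C) (hη : 0 < η) (hη1 : η ≤ 1) (hτ : 0 < τ)
    (hG : ∀ y ∈ C, G y ∈ C)
    (hGL : ∀ y ∈ C, ∀ z ∈ C, ‖G y - G z‖ ≤ (1 - η) * ‖y - z‖)
    (hτR : τ = η * (R - τ))
    (hfar : ∀ p ∈ C, ∃ q ∈ C, τ ≤ ‖q - p‖)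
    {Γ : Set X} (hΓ : Γ ⊆ C) (hsep : ∀ x ∈ Γ, ∀ y ∈ Γ, x ≠ y → 2 * R ≤ ‖y - x‖) :
    ∃ H : X → X, (∀ y ∈ C, H y ∈ C) ∧ (∀ y ∈ C, ∀ z ∈ C, ‖H y - H z‖ ≤ ‖y - z‖) ∧
      (∀ y ∈ C, ‖H y - G y‖ ≤ η * R) ∧
      ∀ x ∈ Γ, ∃ w : X, ‖w‖ = 1 ∧ ∀ y ∈ C, ‖y - x‖ ≤ τ →
        H y = G x + (τ - ‖y - x‖) • w := by
  classical
  have hRτ : τ < R := by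
    by_contra h
    push Not at h
    nlinarith
  have hex : ∀ x : X, ∃ w : X, x ∈ C → ‖w‖ = 1 ∧ ∀ t ∈ Set.Icc 0 τ, G x + t • w ∈ C := by
    intro x
    by_cases hx : x ∈ C
    · obtain ⟨q, hq, hqn⟩ := hfar (G x) (hG x hx)
      have hpos : 0 < ‖q - G x‖ := by linarith
      refine ⟨‖q - G x‖⁻¹ • (q - G x), fun _ => ⟨?_, ?_⟩⟩
      · rw [norm_smul, norm_inv, norm_norm, inv_mul_cancel₀ hpos.ne']
      · intro t ht
        rw [smul_smul]
        apply hC.add_smul_sub_mem (hG x hx) hq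
        refine ⟨mul_nonneg ht.1 (by positivity), ?_⟩
        rw [← div_eq_mul_inv, div_le_one hpos]
        linarith [ht.2]
    · exact ⟨0, fun h => absurd h hx⟩
  choose v hv using hex
  let H : X → X := fun y => if h : ∃ x ∈ Γ, ‖y - x‖ < R then locA G η R τ v h.choose y else G y
  have huniq : ∀ y, ∀ x ∈ Γ, ∀ x' ∈ Γ, ‖y - x‖ < R → ‖y - x'‖ < R → x = x' := by
    intro y x hx x' hx' h1 h2
    by_contra hne
    have h3 := hsep x hx x' hx' hne
    have h4 : ‖x' - x‖ ≤ ‖y - x‖ + ‖y - x'‖ := by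
      have := norm_sub_le (y - x) (y - x')
      simpa using this
    linarith
  have hin : ∀ y, ∀ x ∈ Γ, ‖y - x‖ < R → H y = locA G η R τ v x y := by
    intro y x hx h
    have hh : ∃ x ∈ Γ, ‖y - x‖ < R := ⟨x, hx, h⟩
    have : H y = locA G η R τ v hh.choose y := dif_pos hh
    rw [this, huniq y x hx hh.choose hh.choose_spec.1 h hh.choose_spec.2]
  have hout : ∀ y, (∀ x ∈ Γ, R ≤ ‖y - x‖) → H y = G y := by
    intro y h
    refine dif_neg ?_
    rintro ⟨x, hx, h'⟩
    linarith [h x hx]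
  have hcase : ∀ y, (∃ x ∈ Γ, ‖y - x‖ < R) ∨ (∀ x ∈ Γ, R ≤ ‖y - x‖) := by
    intro y
    by_cases h : ∃ x ∈ Γ, ‖y - x‖ < R
    · exact Or.inl h
    · push Not at h; exact Or.inr h
  -- mixed case
  have hmix : ∀ y ∈ C, ∀ z ∈ C, ∀ x ∈ Γ, ‖y - x‖ < R → (∀ x' ∈ Γ, R ≤ ‖z - x'‖) →
      ‖H y - H z‖ ≤ ‖y - z‖ := by
    intro y hy z hz x hx h1 h2
    rw [hin y x hx h1, hout z h2]
    have h3 := locA_near hC hη hη1 hτ hGL hτR hv (hΓ hx) hy h1.le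
    have h4 := hGL y hy z hz
    have h5 : ‖locA G η R τ v x y - G z‖ ≤ ‖locA G η R τ v x y - G y‖ + ‖G y - G z‖ :=
      norm_sub_le_norm_sub_add_norm_sub _ _ _
    have h6 : R ≤ ‖z - y‖ + ‖y - x‖ :=
      (h2 x hx).trans (norm_sub_le_norm_sub_add_norm_sub _ _ _)
    rw [norm_sub_rev z y] at h6
    nlinarith
  refine ⟨H, ?_, ?_, ?_, ?_⟩
  · intro y hy
    rcases hcase y with ⟨x, hx, h⟩ | h
    · rw [hin y x hx h]
      exact locA_mem hC hG hη hτ hτR hv (hΓ hx) hy h.le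
    · rw [hout y h]; exact hG y hy
  · intro y hy z hz
    rcases hcase y with ⟨x, hx, h⟩ | h <;> rcases hcase z with ⟨x', hx', h'⟩ | h'
    · by_cases hxx : x = x'
      · subst hxx
        rw [hin y x hx h, hin z x hx h']
        exact locA_lip hC hη hη1 hτ hGL hτR hv (hΓ hx) hy hz h.le h'.le
      · rw [hin y x hx h, hin z x' hx' h']
        have h3 := locA_near hC hη hη1 hτ hGL hτR hv (hΓ hx) hy h.le
        have h3' := locA_near hC hη hη1 hτ hGL hτR hv (hΓ hx') hz h'.le
        have h4 := hGL y hy z hz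
        have h5 : ‖locA G η R τ v x y - locA G η R τ v x' z‖
            ≤ ‖locA G η R τ v x y - G y‖ + ‖G y - locA G η R τ v x' z‖ :=
          norm_sub_le_norm_sub_add_norm_sub _ _ _
        have h5' : ‖G y - locA G η R τ v x' z‖
            ≤ ‖G y - G z‖ + ‖G z - locA G η R τ v x' z‖ :=
          norm_sub_le_norm_sub_add_norm_sub _ _ _
        rw [norm_sub_rev (G z)] at h5'
        have h6 := hsep x hx x' hx' hxx
        have h7 : ‖x' - x‖ ≤ ‖x' - z‖ + ‖z - x‖ := norm_sub_le_norm_sub_add_norm_sub _ _ _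
        have h8 : ‖z - x‖ ≤ ‖z - y‖ + ‖y - x‖ := norm_sub_le_norm_sub_add_norm_sub _ _ _
        rw [norm_sub_rev z y] at h8
        rw [norm_sub_rev x' z] at h7
        nlinarith
    · exact hmix y hy z hz x hx h h'
    · rw [norm_sub_rev, norm_sub_rev y z]
      exact hmix z hz y hy x' hx' h' h
    · rw [hout y h, hout z h']
      have := hGL y hy z hz
      nlinarith [norm_nonneg (y - z)]
  · intro y hy
    rcases hcase y with ⟨x, hx, h⟩ | h
    · rw [hin y x hx h]
      have h3 := locA_near hC hη hη1 hτ hGL hτR hv (hΓ hx) hy h.le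
      nlinarith [norm_nonneg (y - x)]
    · rw [hout y h]
      have : 0 ≤ η * R := mul_nonneg hη.le (by linarith)
      simpa using this
  · intro x hx
    refine ⟨v x, (hv x (hΓ hx)).1, ?_⟩
    intro y hy h
    rw [hin y x hx (by linarith)]
    unfold locA
    split_ifs with h'
    · rfl
    · have h'' : ‖y - x‖ = τ := by linarith
      have hR : η * R = (1 + η) * τ := by linarith
      rw [h'', hR, mul_div_cancel_right₀ _ hτ.ne']
      simp

/-- Build a non-expansive map from a function on `X`. -/
lemma exists_nonexp (hb : Bornology.IsBounded C) (H : X → X) (h1 : ∀ y ∈ C, H y ∈ C)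
    (h2 : ∀ y ∈ C, ∀ z ∈ C, ‖H y - H z‖ ≤ ‖y - z‖) :
    ∃ h : NonexpMap C, ∀ y : ↥C, ((h.1 y : ↥C) : X) = H y := by
  have hL : LipschitzWith 1 (fun y : ↥C => (⟨H y, h1 y y.2⟩ : ↥C)) := by
    apply LipschitzWith.of_dist_le_mul
    intro y z
    rw [Subtype.dist_eq, Subtype.dist_eq, dist_eq_norm, dist_eq_norm]
    simpa using h2 y y.2 z z.2
  refine ⟨⟨BoundedContinuousFunction.mkOfBound ⟨_, hL.continuous⟩ (Metric.diam C) ?_, hL⟩, ?_⟩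
  · intro y z
    exact Metric.dist_le_diam_of_mem hb (h1 y y.2) (h1 z z.2)
  · intro y; rfl

lemma nonexp_norm (f : NonexpMap C) (y z : ↥C) :
    ‖((f.1 y : ↥C) : X) - f.1 z‖ ≤ ‖(y : X) - z‖ := by
  have := f.2.dist_le_mul y z
  rw [Subtype.dist_eq, Subtype.dist_eq, dist_eq_norm, dist_eq_norm] at this
  simpa using this

lemma nonexp_dist (f g : NonexpMap C) (y : ↥C) :
    ‖((f.1 y : ↥C) : X) - g.1 y‖ ≤ dist f g := by
  have := BoundedContinuousFunction.dist_coe_le_dist (f := f.1) (g := g.1) y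
  rw [Subtype.dist_eq, dist_eq_norm] at this
  exact this

lemma nonexp_dist_le (f g : NonexpMap C) {r : ℝ} (hr : 0 ≤ r)
    (h : ∀ y : ↥C, ‖((f.1 y : ↥C) : X) - g.1 y‖ ≤ r) : dist f g ≤ r := by
  refine (BoundedContinuousFunction.dist_le hr).2 ?_
  intro y
  rw [Subtype.dist_eq, dist_eq_norm]
  exact h y

lemma exists_comb (hb : Bornology.IsBounded C) (hC : Convex ℝ C) (f g : NonexpMap C) {θ : ℝ}
    (h0 : 0 ≤ θ) (h1 : θ ≤ 1) :
    ∃ w : NonexpMap C, (∀ y : ↥C, ((w.1 y : ↥C) : X) = (1 - θ) • ((f.1 y : ↥C) : X)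
        + θ • ((g.1 y : ↥C) : X)) ∧
      dist f w ≤ θ * dist f g ∧ dist w g ≤ (1 - θ) * dist f g := by
  classical
  obtain ⟨w, hw⟩ := exists_nonexp (C := C) hb
    (fun y => if h : y ∈ C then (1 - θ) • ((f.1 ⟨y, h⟩ : ↥C) : X)
        + θ • ((g.1 ⟨y, h⟩ : ↥C) : X) else 0) (by
      intro y hy
      simp only [hy, dif_pos]
      exact hC (f.1 ⟨y, hy⟩).2 (g.1 ⟨y, hy⟩).2 (by linarith) h0 (by ring)) (by
      intro y hy z hz
      simp only [hy, hz, dif_pos]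
      have a := nonexp_norm f ⟨y, hy⟩ ⟨z, hz⟩
      have b := nonexp_norm g ⟨y, hy⟩ ⟨z, hz⟩
      rw [add_sub_add_comm, ← smul_sub, ← smul_sub]
      refine (norm_add_le _ _).trans ?_
      rw [norm_smul, norm_smul, Real.norm_of_nonneg h0, Real.norm_of_nonneg (by linarith)]
      have a' := mul_le_mul_of_nonneg_left a (sub_nonneg.2 h1)
      have b' := mul_le_mul_of_nonneg_left b h0
      simp only at a' b'
      linarith)
  have hw' : ∀ y : ↥C, ((w.1 y : ↥C) : X) = (1 - θ) • ((f.1 y : ↥C) : X)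
        + θ • ((g.1 y : ↥C) : X) := by
    intro y
    rw [hw]
    simp
  refine ⟨w, hw', ?_, ?_⟩
  · refine nonexp_dist_le _ _ (mul_nonneg h0 dist_nonneg) ?_
    intro y
    rw [hw']
    have : ((f.1 y : ↥C) : X) - ((1 - θ) • ((f.1 y : ↥C) : X) + θ • ((g.1 y : ↥C) : X))
      = θ • (((f.1 y : ↥C) : X) - g.1 y) := by module
    rw [this, norm_smul, Real.norm_of_nonneg h0]
    exact mul_le_mul_of_nonneg_left (nonexp_dist f g y) h0
  · refine nonexp_dist_le _ _ (mul_nonneg (by linarith) dist_nonneg) ?_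
    intro y
    rw [hw']
    have : ((1 - θ) • ((f.1 y : ↥C) : X) + θ • ((g.1 y : ↥C) : X)) - ((g.1 y : ↥C) : X)
      = (1 - θ) • (((f.1 y : ↥C) : X) - g.1 y) := by module
    rw [this, norm_smul, Real.norm_of_nonneg (by linarith)]
    exact mul_le_mul_of_nonneg_left (nonexp_dist f g y) (by linarith)

/-- holes in small balls are small -/
lemma hole_le (hb : Bornology.IsBounded C) (hC : Convex ℝ C) {a b : X} (ha : a ∈ C) (hbC : b ∈ C)
    (g : NonexpMap C) (P : Set (NonexpMap C)) {r s : ℝ} (hr : 0 < r) (hrs : 8 * r < ‖a - b‖)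
    (hs : s ∈ porHoles P g r) : s ≤ 2 * r := by
  obtain ⟨hs0, y, hy⟩ := hs
  by_contra hlt
  push Not at hlt
  have hyg : dist y g < r := (hy (Metric.mem_ball_self hs0)).1
  obtain ⟨ca, hca⟩ := exists_nonexp (C := C) hb (fun _ => a) (fun _ _ => ha)
    (fun y _ z _ => by simp)
  obtain ⟨cb, hcb⟩ := exists_nonexp (C := C) hb (fun _ => b) (fun _ _ => hbC)
    (fun y _ z _ => by simp)
  have hab : ‖a - b‖ ≤ dist ca cb := by
    have := nonexp_dist ca cb ⟨a, ha⟩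
    rwa [hca, hcb] at this
  obtain ⟨z, hz⟩ : ∃ z : NonexpMap C, 4 * r ≤ dist y z := by
    by_contra hno
    push Not at hno
    have h1 := hno ca
    have h2 := hno cb
    have h3 := dist_triangle_left ca cb y
    linarith
  have hd : 0 < dist y z := by linarith
  obtain ⟨w, -, hw1, hw2⟩ := exists_comb hb hC y z (θ := 2 * r / dist y z) (by positivity)
    (by rw [div_le_one hd]; linarith)
  have e : 2 * r / dist y z * dist y z = 2 * r := by field_simp
  rw [e] at hw1
  rw [sub_mul, e] at hw2
  have hwg : dist w g < r := (hy (by rw [Metric.mem_ball, dist_comm]; linarith)).1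
  have h1 := dist_triangle_right y w g
  have h2 := dist_triangle y w z
  linarith

/-- the hole -/
lemma main_hole (hb : Bornology.IsBounded C) (hC : Convex ℝ C) (g : NonexpMap C)
    {Γ : Set X} (hΓ : Γ ⊆ C) (hΓn : Γ.Nontrivial) {s t lam : ℝ}
    (hsep : ∀ x ∈ Γ, ∀ y ∈ Γ, x ≠ y → s ≤ ‖y - x‖) (hs0 : 0 < s) (hs1 : s < 1)
    (hsD : s < Metric.diam C / 2) (hl0 : 0 < lam) (hl1 : lam < 1) (hη : 0 < η) (hη1 : η ≤ 1)
    (hηt : η * s ≤ t) (htη : t ≤ 2 * η * s) :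
    ∃ h : NonexpMap C, dist h g + (1 - lam) * t / 32 ≤ 2 * η * (1 + Metric.diam C) ∧
      ∀ f : NonexpMap C, dist f h < (1 - lam) * t / 32 →
        ∀ x : ↥C, (x : X) ∈ Γ → ∀ y : ↥C,
          ‖(y : X) - (x : X)‖ < (1 - lam) * t / (48 * (1 + Metric.diam C)) →
          lam < LipScale (⇑(f.1)) y t := by
  classical
  set D := Metric.diam C with hD
  have hD0 : 0 ≤ D := Metric.diam_nonneg
  have ht : 0 < t := lt_of_lt_of_le (by positivity) hηt
  obtain ⟨c0, hc0⟩ : C.Nonempty := hΓn.nonempty.mono hΓ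
  let G : X → X := fun y => if h : y ∈ C then (1 - η) • ((g.1 ⟨y, h⟩ : ↥C) : X) + η • c0 else 0
  have hGe : ∀ y (h : y ∈ C), G y = (1 - η) • ((g.1 ⟨y, h⟩ : ↥C) : X) + η • c0 :=
    fun y h => dif_pos h
  have hG : ∀ y ∈ C, G y ∈ C := by
    intro y hy
    rw [hGe y hy]
    exact hC (g.1 ⟨y, hy⟩).2 hc0 (by linarith) hη.le (by ring)
  have hGL : ∀ y ∈ C, ∀ z ∈ C, ‖G y - G z‖ ≤ (1 - η) * ‖y - z‖ := by
    intro y hy z hz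
    rw [hGe y hy, hGe z hz, add_sub_add_right_eq_sub, ← smul_sub, norm_smul,
      Real.norm_of_nonneg (by linarith)]
    exact mul_le_mul_of_nonneg_left (nonexp_norm g ⟨y, hy⟩ ⟨z, hz⟩) (by linarith)
  have hGg : ∀ y (h : y ∈ C), ‖G y - g.1 ⟨y, h⟩‖ ≤ η * D := by
    intro y hy
    have e : G y - g.1 ⟨y, hy⟩ = η • (c0 - g.1 ⟨y, hy⟩) := by rw [hGe y hy]; module
    rw [e, norm_smul, Real.norm_of_nonneg hη.le, ← dist_eq_norm]
    exact mul_le_mul_of_nonneg_left (Metric.dist_le_diam_of_mem hb hc0 (g.1 ⟨y, hy⟩).2) hη.le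
  obtain ⟨τ, hτR⟩ : ∃ τ : ℝ, τ = η * (s / 2 - τ) := by
    refine ⟨η * (s / 2) / (1 + η), ?_⟩
    field_simp
    ring
  have hτe : (1 + η) * τ = η * s / 2 := by linarith
  have hτ : 0 < τ := by
    have : 0 < (1 + η) * τ := by rw [hτe]; positivity
    exact pos_of_mul_pos_right this (by linarith)
  have hτt : τ ≤ t / 2 := by nlinarith
  have htτ : t ≤ 8 * τ := by nlinarith
  have hτs : τ ≤ s / 2 := by nlinarith
  have hfar : ∀ p ∈ C, ∃ q ∈ C, τ ≤ ‖q - p‖ := by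
    intro p hp
    by_contra hno
    push Not at hno
    have : D ≤ s := by
      refine Metric.diam_le_of_forall_dist_le hs0.le ?_
      intro u hu w hw
      have h1 := hno u hu
      have h2 := hno w hw
      rw [dist_eq_norm]
      have : ‖u - w‖ ≤ ‖u - p‖ + ‖w - p‖ := by
        have := norm_sub_le (u - p) (w - p)
        simpa using this
      linarith
    linarith
  obtain ⟨H, hH1, hH2, hH3, hH4⟩ := perturb_s14 (R := s / 2) hC hη hη1 hτ hG hGL hτR hfar hΓ
    (by intro x hx y hy hxy; have := hsep x hx y hy hxy; linarith)
  obtain ⟨h, hh⟩ := exists_nonexp hb H hH1 hH2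
  have hε : (1 - lam) * t / 32 ≤ η := by nlinarith
  refine ⟨h, ?_, ?_⟩
  · have : dist h g ≤ η * (s / 2) + η * D := by
      refine nonexp_dist_le _ _ (by positivity) ?_
      intro y
      rw [hh]
      refine (norm_sub_le_norm_sub_add_norm_sub _ (G y) _).trans ?_
      exact add_le_add (hH3 y y.2) (hGg y y.2)
    nlinarith
  · intro f hf x hx y hy
    obtain ⟨w, hw, hHw⟩ := hH4 x hx
    -- the test point
    obtain ⟨x', hx', hne⟩ := hΓn.exists_ne (x : X)
    have hxx := hsep x hx x' hx' hne.symm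
    have hpos : 0 < ‖x' - (x : X)‖ := by linarith
    set z : X := (x : X) + (τ / ‖x' - (x : X)‖) • (x' - (x : X)) with hz
    have hzC : z ∈ C := by
      apply hC.add_smul_sub_mem x.2 (hΓ hx')
      exact ⟨by positivity, by rw [div_le_one hpos]; linarith⟩
    have hzx : ‖z - x‖ = τ := by
      rw [hz, add_sub_cancel_left, norm_smul, Real.norm_of_nonneg (by positivity)]
      field_simp
    have hδ : (1 - lam) * t / (48 * (1 + D)) ≤ (1 - lam) * t / 48 := by
      apply div_le_div_of_nonneg_left (mul_nonneg (by linarith) ht.le) (by norm_num)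
      linarith
    have hyx : ‖(y : X) - x‖ < (1 - lam) * t / 48 := lt_of_lt_of_le hy hδ
    have hyτ : ‖(y : X) - x‖ ≤ τ := by nlinarith
    have hHz := hHw z hzC hzx.le
    have hHy := hHw y y.2 hyτ
    have hHzy : ‖H y - H z‖ = τ - ‖(y : X) - x‖ := by
      rw [hHz, hHy, hzx, add_sub_add_left_eq_sub, sub_self, zero_smul, sub_zero, norm_smul, hw,
        Real.norm_of_nonneg (by linarith), mul_one]
    let z' : ↥C := ⟨z, hzC⟩
    have hfy : ‖((f.1 y : ↥C) : X) - H y‖ < (1 - lam) * t / 32 := by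
      rw [← hh]; exact (nonexp_dist f h y).trans_lt hf
    have hfz : ‖((f.1 z' : ↥C) : X) - H z‖ < (1 - lam) * t / 32 := by
      have := hh z'
      change _ = H z at this
      rw [← this]; exact (nonexp_dist f h z').trans_lt hf
    have htri : ‖H y - H z‖ ≤ ‖((f.1 y : ↥C) : X) - H y‖ + ‖((f.1 z' : ↥C) : X) - H z‖
        + dist (f.1 z') (f.1 y) := by
      rw [Subtype.dist_eq, dist_eq_norm]
      have h1 := norm_sub_le_norm_sub_add_norm_sub (H y) ((f.1 y : ↥C) : X) (H z)
      have h2 := norm_sub_le_norm_sub_add_norm_sub ((f.1 y : ↥C) : X) ((f.1 z' : ↥C) : X) (H z)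
      rw [norm_sub_rev (H y) ((f.1 y : ↥C) : X)] at h1
      rw [norm_sub_rev ((f.1 y : ↥C) : X) ((f.1 z' : ↥C) : X)] at h2
      linarith
    have hdist : dist z' y = ‖z - y‖ := by rw [Subtype.dist_eq, dist_eq_norm]
    have hd1 : dist z' y ≤ τ + ‖(y : X) - x‖ := by
      rw [hdist, ← hzx]
      have := norm_sub_le (z - x) ((y : X) - x)
      simpa using this
    have hd2 : τ - ‖(y : X) - x‖ ≤ dist z' y := by
      rw [hdist, ← hzx]
      have := norm_sub_norm_le (z - x) ((y : X) - x)
      simpa using this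
    have hlt : (1 - lam) * t ≤ t := by nlinarith
    have hd0 : 0 < dist z' y := by linarith
    have hdt : dist z' y ≤ t := by linarith
    have hle : dist (f.1 z') (f.1 y) / dist z' y ≤ LipScale (⇑(f.1)) y t := by
      apply le_csSup
      · refine ⟨1, ?_⟩
        rintro _ ⟨u, hu, rfl⟩
        have := f.2.dist_le_mul u y
        simp only [NNReal.coe_one, one_mul] at this
        exact div_le_one_of_le₀ this dist_nonneg
      · exact ⟨z', ⟨hd0, hdt⟩, rfl⟩
    refine lt_of_lt_of_le ?_ hle
    rw [lt_div_iff₀ hd0]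
    have h1 : lam * dist z' y ≤ lam * τ + ‖(y : X) - x‖ := by
      nlinarith [norm_nonneg ((y : X) - x)]
    have h2 : (1 - lam) * t ≤ (1 - lam) * (8 * τ) := mul_le_mul_of_nonneg_left htτ (by linarith)
    linarith

end

lemma conc_scale {ξ : ℝ → ℝ} {b c t : ℝ} (hξ : ConcaveOn ℝ (Set.Ioo 0 b) ξ)
    (hpos : ∀ t ∈ Set.Ioo 0 b, 0 < ξ t) (ht : t ∈ Set.Ioo 0 b) (hc0 : 0 < c) (hc1 : c < 1) :
    c / 2 * ξ t ≤ ξ (c * t) := by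
  obtain ⟨ht0, htb⟩ := ht
  have hu : c / 2 * t ∈ Set.Ioo 0 b := ⟨by positivity, by nlinarith⟩
  have hne : 2 - c ≠ 0 := by linarith
  have hw : 0 ≤ c / (2 - c) := div_nonneg hc0.le (by linarith)
  have hw1 : c / (2 - c) ≤ 1 := by rw [div_le_one (by linarith)]; linarith
  have hw2 : c / 2 ≤ c / (2 - c) :=
    div_le_div_of_nonneg_left hc0.le (by linarith) (by linarith)
  have h := hξ.2 hu ⟨ht0, htb⟩ (sub_nonneg.2 hw1) hw (by ring)
  simp only [smul_eq_mul] at h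
  have e : (1 - c / (2 - c)) * (c / 2 * t) + c / (2 - c) * t = c * t := by
    field_simp
    ring
  rw [e] at h
  have h1 := mul_nonneg (sub_nonneg.2 hw1) (hpos _ hu).le
  have h2 := mul_le_mul_of_nonneg_right hw2 (hpos t ⟨ht0, htb⟩).le
  linarith

/-- (Lemma on `ξ`-lower porosity of the sets `P`.)  With `C` a
bounded convex subset of a normed space, `λ ∈ (0,1)`, `k ∈ ℕ`, `K > 1`, `φ, ξ` strictly
increasing concave on `(0,1/K)` with `φ(t)ξ(t) ≥ t/K` and `φ, ξ → 0` at `0`, a strictly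
decreasing null sequence `(s_j)` in `(0,1) ∩ (0, sup φ) ∩ (0, diam C / 2)` with
`φ⁻¹(s_j)/s_j = 2·φ⁻¹(s_{j+1})/s_{j+1}`, and `Γ_j ⊆ C` an `s_j`-separated set with at
least two points, the set `P` of all `f ∈ M(C)` such that for every `j ≥ k` there are
`x ∈ Γ_j` and `y ∈ C` with `‖y-x‖ < (1-λ)·φ⁻¹(s_j)/(48·(1+diam C))` and
`Lip(f,y,φ⁻¹(s_j)) ≤ λ`, is `ξ`-lower porous at every point of `M(C)`.  (Here `ψ`
denotes the inverse `φ⁻¹`.) -/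
theorem stmt_14 {X : Type*} [NormedAddCommGroup X] [NormedSpace ℝ X]
    (C : Set X) (hC_bdd : Bornology.IsBounded C) (hC_conv : Convex ℝ C)
    (lam : ℝ) (hlam : lam ∈ Set.Ioo (0 : ℝ) 1) (k : ℕ)
    (K : ℝ) (hK : 1 < K) (φ ξ : ℝ → ℝ)
    (hφ_mono : StrictMonoOn φ (Set.Ioo 0 (1 / K)))
    (hφ_conc : ConcaveOn ℝ (Set.Ioo 0 (1 / K)) φ)
    (hφ_pos : ∀ t ∈ Set.Ioo 0 (1 / K), 0 < φ t)
    (hξ_mono : StrictMonoOn ξ (Set.Ioo 0 (1 / K)))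
    (hξ_conc : ConcaveOn ℝ (Set.Ioo 0 (1 / K)) ξ)
    (hξ_pos : ∀ t ∈ Set.Ioo 0 (1 / K), 0 < ξ t)
    (hprod : ∀ t ∈ Set.Ioo 0 (1 / K), t / K ≤ φ t * ξ t)
    (hφ_lim : Filter.Tendsto φ (nhdsWithin 0 (Set.Ioi 0)) (nhds 0))
    (hξ_lim : Filter.Tendsto ξ (nhdsWithin 0 (Set.Ioi 0)) (nhds 0))
    (ψ : ℝ → ℝ)
    (hψ : ∀ u ∈ Set.Ioo 0 (sSup (φ '' Set.Ioo 0 (1 / K))),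
      ψ u ∈ Set.Ioo 0 (1 / K) ∧ φ (ψ u) = u)
    (sq : ℕ → ℝ) (hsq_anti : StrictAnti sq)
    (hsq_mem : ∀ j, sq j ∈ Set.Ioo (0 : ℝ) 1 ∧
      sq j < sSup (φ '' Set.Ioo 0 (1 / K)) ∧ sq j < Metric.diam C / 2)
    (hsq_lim : Filter.Tendsto sq Filter.atTop (nhds 0))
    (hsq_rec : ∀ j, ψ (sq j) / sq j = 2 * (ψ (sq (j + 1)) / sq (j + 1)))
    (Γ : ℕ → Set X) (hΓC : ∀ j, Γ j ⊆ C)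
    (hΓ_sep : ∀ j, ∀ x ∈ Γ j, ∀ y ∈ Γ j, x ≠ y → sq j ≤ ‖y - x‖)
    (hΓ_nontriv : ∀ j, (Γ j).Nontrivial) :
    ∀ g : NonexpMap C,
      IsPhiLowerPorousAt ξ
        {f : NonexpMap C | ∀ j, k ≤ j →
          ∃ x : ↥C, (x : X) ∈ Γ j ∧ ∃ y : ↥C,
            ‖(y : X) - (x : X)‖ < (1 - lam) * ψ (sq j) / (48 * (1 + Metric.diam C)) ∧
            LipScale (⇑(f.1)) y (ψ (sq j)) ≤ lam} g := by
  intro g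
  obtain ⟨hl0, hl1⟩ := hlam
  set D := Metric.diam C with hD
  have hD0 : 0 ≤ D := Metric.diam_nonneg
  set P : Set (NonexpMap C) := {f : NonexpMap C | ∀ j, k ≤ j →
          ∃ x : ↥C, (x : X) ∈ Γ j ∧ ∃ y : ↥C,
            ‖(y : X) - (x : X)‖ < (1 - lam) * ψ (sq j) / (48 * (1 + D)) ∧
            LipScale (⇑(f.1)) y (ψ (sq j)) ≤ lam} with hP
  have hψj : ∀ j, ψ (sq j) ∈ Set.Ioo 0 (1 / K) ∧ φ (ψ (sq j)) = sq j := fun j =>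
    hψ _ ⟨(hsq_mem j).1.1, (hsq_mem j).2.1⟩
  have hq : ∀ j, 0 < ψ (sq j) / sq j := fun j => div_pos (hψj j).1.1 (hsq_mem j).1.1
  have hqk : ∀ n, ψ (sq (k + n)) / sq (k + n) = ψ (sq k) / sq k * (1 / 2) ^ n := by
    intro n
    induction n with
    | zero => simp
    | succ n ih =>
      have := hsq_rec (k + n)
      rw [ih] at this
      rw [← add_assoc, pow_succ]
      linarith
  -- holes for small radii
  have key : ∀ r, 0 < r → r / (2 * (1 + D)) ≤ 1 → r / (2 * (1 + D)) ≤ ψ (sq k) / sq k →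
      ∃ j, (1 - lam) * ψ (sq j) / 32 ∈ porHoles P g r ∧
        r / (2 * (1 + D)) ≤ ψ (sq j) / sq j := by
    intro r hr hη1 hηk
    set η := r / (2 * (1 + D)) with hη
    have hη0 : 0 < η := by positivity
    have hrη : 2 * η * (1 + D) = r := by rw [hη]; field_simp
    obtain ⟨n, hn1, hn2⟩ : ∃ n : ℕ, η ≤ ψ (sq k) / sq k * (1 / 2) ^ n ∧
        ψ (sq k) / sq k * (1 / 2) ^ (n + 1) < η := by
      have hx0 : 0 < η / (ψ (sq k) / sq k) := div_pos hη0 (hq k)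
      have hx1 : η / (ψ (sq k) / sq k) ≤ 1 := by rw [div_le_one (hq k)]; exact hηk
      obtain ⟨n, h1, h2⟩ := exists_nat_pow_near_of_lt_one hx0 hx1
        (by norm_num : (0 : ℝ) < 1 / 2) (by norm_num)
      refine ⟨n, ?_, ?_⟩
      · rw [div_le_iff₀ (hq k)] at h2; linarith
      · rw [lt_div_iff₀ (hq k)] at h1; linarith
    have hs0 := (hsq_mem (k + n)).1.1
    have ht0 := (hψj (k + n)).1.1
    have hn1' : η ≤ ψ (sq (k + n)) / sq (k + n) := by rw [hqk]; exact hn1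
    have hn2' : ψ (sq (k + n)) / sq (k + n) ≤ 2 * η := by
      rw [hqk]; rw [pow_succ] at hn2; linarith
    refine ⟨k + n, ⟨?_, ?_⟩, hn1'⟩
    · have := mul_pos (sub_pos.2 hl1) ht0
      positivity
    rw [le_div_iff₀ hs0] at hn1'
    rw [div_le_iff₀ hs0] at hn2'
    obtain ⟨h, hh1, hh2⟩ := main_hole hC_bdd hC_conv g (hΓC (k + n)) (hΓ_nontriv (k + n))
      (hΓ_sep (k + n)) hs0 (hsq_mem (k + n)).1.2 (hsq_mem (k + n)).2.2 hl0 hl1 hη0 hη1 hn1' hn2'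
    rw [← hD, hrη] at hh1
    refine ⟨h, ?_⟩
    intro f hf
    rw [Metric.mem_ball] at hf
    refine ⟨?_, ?_⟩
    · rw [Metric.mem_ball]
      have := dist_triangle f h g
      linarith
    · intro hfP
      obtain ⟨x, hx, y, hy, hlip⟩ := hfP (k + n) (by omega)
      exact absurd hlip (not_le.2 (hh2 f hf x hx y hy))
  obtain ⟨r0, hr0, hr0'⟩ : ∃ r0 > 0, ∀ r, 0 < r → r ≤ r0 →
      r / (2 * (1 + D)) ≤ 1 ∧ r / (2 * (1 + D)) ≤ ψ (sq k) / sq k := by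
    refine ⟨min 1 (ψ (sq k) / sq k) * (2 * (1 + D)),
      mul_pos (lt_min one_pos (hq k)) (by positivity), ?_⟩
    intro r hr hle
    rw [← div_le_iff₀ (by positivity)] at hle
    exact ⟨hle.trans (min_le_left _ _), hle.trans (min_le_right _ _)⟩
  refine ⟨?_, ?_⟩
  · intro r hr
    obtain ⟨h1, h2⟩ := hr0' (min r r0) (lt_min hr hr0) (min_le_right _ _)
    obtain ⟨j, ⟨hj0, y, hy⟩, -⟩ := key (min r r0) (lt_min hr hr0) h1 h2
    exact ⟨_, hj0, y, fun f hf =>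
      ⟨Metric.ball_subset_ball (min_le_left _ _) (hy hf).1, (hy hf).2⟩⟩
  · obtain ⟨a, ha, b, hb, hab⟩ := hΓ_nontriv 0
    have hab' : 0 < ‖a - b‖ := norm_pos_iff.2 (sub_ne_zero.2 hab)
    have hK0 : 0 < K := by linarith
    set c := (1 - lam) / 32 with hc
    have hc0 : 0 < c := by rw [hc]; linarith
    have hc1 : c < 1 := by rw [hc]; linarith
    set m : ℝ := c / (4 * K * (1 + D)) with hm
    have hm0 : 0 < m := by positivity
    have hev : ∀ᶠ r : ℝ in nhdsWithin 0 (Set.Ioi 0),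
        ((m : ℝ) : EReal) ≤ ((ξ (porGamma P g r) / r : ℝ) : EReal) := by
      have hlim : ∀ x : ℝ, 0 < x → ∀ᶠ r : ℝ in nhdsWithin 0 (Set.Ioi 0), r < x := fun x hx =>
        (Iio_mem_nhds hx |> mem_nhdsWithin_of_mem_nhds)
      filter_upwards [self_mem_nhdsWithin, hlim r0 hr0, hlim (‖a - b‖ / 8) (by positivity),
        hlim (1 / K / 2) (by positivity)] with r hr h1 h2 h3
      have hr : 0 < r := hr
      obtain ⟨h4, h5⟩ := hr0' r hr h1.le
      obtain ⟨j, hj, hjr⟩ := key r hr h4 h5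
      have hub : ∀ s ∈ porHoles P g r, s ≤ 2 * r := fun s hs =>
        hole_le hC_bdd hC_conv (hΓC 0 ha) (hΓC 0 hb) g P hr (by linarith) hs
      have hγ1 : (1 - lam) * ψ (sq j) / 32 ≤ porGamma P g r := le_csSup ⟨_, hub⟩ hj
      have hγ2 : porGamma P g r ≤ 2 * r := csSup_le ⟨_, hj⟩ hub
      have e : (1 - lam) * ψ (sq j) / 32 = c * ψ (sq j) := by rw [hc]; ring
      have hs0 := (hsq_mem j).1.1
      obtain ⟨hψI, hφψ⟩ := hψj j
      rw [e] at hγ1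
      have hε0 : 0 < c * ψ (sq j) := mul_pos hc0 hψI.1
      have hmono : ξ (c * ψ (sq j)) ≤ ξ (porGamma P g r) :=
        hξ_mono.monotoneOn ⟨hε0, by linarith⟩ ⟨by linarith, by linarith⟩ hγ1
      have h6 := conc_scale hξ_conc hξ_pos hψI hc0 hc1
      have h7 := hprod _ hψI
      rw [hφψ] at h7
      have h8 : ψ (sq j) / sq j / K ≤ ξ (ψ (sq j)) := by
        rw [div_right_comm, div_le_iff₀ hs0]; linarith
      have h9 : r / (2 * (1 + D)) / K ≤ ξ (ψ (sq j)) :=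
        (div_le_div_of_nonneg_right hjr hK0.le).trans h8
      have h10 := mul_le_mul_of_nonneg_left h9 (by positivity : 0 ≤ c / 2)
      rw [EReal.coe_le_coe_iff, le_div_iff₀ hr]
      have e2 : m * r = c / 2 * (r / (2 * (1 + D)) / K) := by
        rw [hm]; field_simp; norm_num
      rw [e2]
      linarith
    exact lt_of_lt_of_le (EReal.coe_pos.2 hm0) (Filter.le_liminf_of_le (by isBoundedDefault) hev)
end
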